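/- Let $G$ be a simple graph on vertex set $\{1,\dots,n\}$ with edge set $E(G)$, and let $\mathcal{M}_G$ be the set of real symmetric positive definite $n\times n$ matrices $K$ with $K_{ij}=0$ whenever $i\ne j$ and $ij\notin E(G)$. The maximum likelihood threshold $\mathrm{MLT}(G)$ is the smallest positive integer $m$ such that for Lebesgue-almost every real $n\times m$ matrix $X$ the function $K\mapsto \operatorname{tr}(XX^{T}K)-\log\det K$ attains a minimum on $\mathcal{M}_G$. For an integer $d\ge 0$, a map $p:\{1,\dots,n\}\to\mathbb{R}^d$ and an edge $ij\in E(G)$, let $R_{ij}(p)\in(\mathbb{R}^d)^n$ be the vector whose $i$-th block is $p(i)-p(j)$, whose $j$-th block is $p(j)-p(i)$, and whose other blocks are zero; $G$ is $d$-independent if for Lebesgue-almost every $p$ the vectors $R_{ij}(p)$, $ij\in E(G)$, are linearly independent (so $G$ is $0$-independent if and only if it has no edges). If $G$ is $3$-independent, then $\mathrm{MLT}(G)=d+1$, where $d$ is the smallest nonnegative integer such that $G$ is $d$-independent. -/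

import Mathlib

open MeasureTheory Matrix

noncomputable section

/-- The objective function `K ↦ tr(S K) − log det K` of Gaussian maximum likelihood,
where `S` is the sample covariance matrix. -/
def mlObjective {n : ℕ} (S K : Matrix (Fin n) (Fin n) ℝ) : ℝ :=
  (S * K).trace - Real.log K.det

/-- The maximum likelihood threshold of a set `M` of positive definite matrices:
the smallest positive integer `d` such that for Lebesgue-almost every real `n × d`
matrix `X`, the function `K ↦ tr(X Xᵀ K) − log det K` attains a minimum on `M`. -/
def mlt (n : ℕ) (M : Set (Matrix (Fin n) (Fin n) ℝ)) : ℕ :=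
  sInf {d : ℕ | 0 < d ∧
    ∀ᵐ X : Fin n → Fin d → ℝ ∂volume,
      ∃ K ∈ M, ∀ K' ∈ M,
        mlObjective (Matrix.of X * (Matrix.of X)ᵀ) K ≤
          mlObjective (Matrix.of X * (Matrix.of X)ᵀ) K'}

/-- The Gaussian graphical model of a graph `G` on `{1,…,n}`: all symmetric positive
definite matrices whose off-diagonal entries vanish at non-edges of `G`. -/
def graphModel (n : ℕ) (G : SimpleGraph (Fin n)) : Set (Matrix (Fin n) (Fin n) ℝ) :=
  {K | K.PosDef ∧ ∀ i j, i ≠ j → ¬ G.Adj i j → K i j = 0}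

/-- The rigidity vector `R_{ij}(p)`: the block vector in `(ℝ^d)^n` whose `i`-th block is
`p i − p j`, whose `j`-th block is `p j − p i`, and whose other blocks are zero. -/
def rigidityVec {n d : ℕ} (p : Fin n → Fin d → ℝ) (i j : Fin n) : Fin n → Fin d → ℝ :=
  fun k => if k = i then p i - p j else if k = j then p j - p i else 0

/-- A graph `G` is `d`-independent if for Lebesgue-almost every `p : {1,…,n} → ℝ^d`,
the rigidity vectors `{R_{ij}(p) : ij ∈ E(G)}` are linearly independent. (Each edge is listed
once, as the pair `(i, j)` with `i < j`. For `d = 0` every rigidity vector is zero, so exactly the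
edgeless graphs are `0`-independent.) -/
def IsIndepGraph {n : ℕ} (d : ℕ) (G : SimpleGraph (Fin n)) : Prop :=
  ∀ᵐ p : Fin n → Fin d → ℝ ∂volume,
    LinearIndependent ℝ (fun e : {e : Fin n × Fin n // G.Adj e.1 e.2 ∧ e.1 < e.2} =>
      rigidityVec p e.1.1 e.1.2)

end

/-! ### Families of linear maps depending polynomially on a parameter -/

section LinearFamilies

open Polynomial Topology Filter

variable {P L N : Type*} [AddCommGroup P] [Module ℝ P] [AddCommGroup L] [Module ℝ L]
  [AddCommGroup N] [Module ℝ N]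

/-- A curve in a real vector space all of whose coordinates are polynomial functions. -/
def IsPolyCurve (φ : ℝ → P) : Prop :=
  ∀ l : P →ₗ[ℝ] ℝ, ∃ Q : ℝ[X], ∀ t, l (φ t) = Q.eval t

lemma IsPolyCurve.of_pi {ι κ : Type*} [Fintype ι] [Fintype κ] {φ : ℝ → ι → κ → ℝ}
    (h : ∀ i k, ∃ Q : ℝ[X], ∀ t, φ t i k = Q.eval t) : IsPolyCurve φ := by
  classical
  intro l
  choose Q hQ using h
  refine ⟨∑ i, ∑ k, C (l (Pi.single i (Pi.single k 1))) * Q i k, fun t => ?_⟩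
  have h1 : φ t = ∑ i, ∑ k, (Q i k).eval t • (Pi.single i (Pi.single k (1 : ℝ)) : ι → κ → ℝ) := by
    funext i k
    simp only [Finset.sum_apply, Pi.smul_apply, smul_eq_mul]
    rw [Finset.sum_eq_single i, Finset.sum_eq_single k]
    · simp [hQ]
    · intro b _ hb; simp [hb.symm]
    · simp
    · intro b _ hb; simp [hb.symm]
    · simp
  rw [h1]
  simp only [map_sum, map_smul, eval_finsetSum, eval_mul, eval_C, smul_eq_mul]
  exact Finset.sum_congr rfl fun i _ => Finset.sum_congr rfl fun k _ => mul_comm _ _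

lemma IsPolyCurve.line (x v : P) : IsPolyCurve fun t : ℝ => x + t • v := fun l =>
  ⟨C (l x) + X * C (l v), fun t => by simp; ring⟩

lemma exists_poly_det {n : Type*} [Fintype n] [DecidableEq n] {M : ℝ → Matrix n n ℝ}
    (h : ∀ i j, ∃ Q : ℝ[X], ∀ t, M t i j = Q.eval t) : ∃ Q : ℝ[X], ∀ t, (M t).det = Q.eval t := by
  choose Q hQ using h
  refine ⟨(Matrix.of Q).det, fun t => ?_⟩
  have : M t = (Polynomial.evalRingHom t).mapMatrix (Matrix.of Q) := by
    ext i j; simp [hQ]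
  rw [this, ← RingHom.map_det]; rfl

lemma finite_setOf_eq_zero_of_poly {f : ℝ → ℝ} (h : ∃ Q : ℝ[X], ∀ t, f t = Q.eval t) {t₀ : ℝ}
    (h0 : f t₀ ≠ 0) : {t | f t = 0}.Finite := by
  obtain ⟨Q, hQ⟩ := h
  have hQ0 : Q ≠ 0 := by rintro rfl; simp [hQ] at h0
  refine (Q.roots.toFinset.finite_toSet).subset fun t ht => ?_
  simp only [Set.mem_ofPred_eq, hQ] at ht
  simp [hQ0, ht]

lemma injective_of_det_toMatrix_ne_zero {ι : Type*} [Fintype ι] [DecidableEq ι]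
    (b : Module.Basis ι ℝ L) (f : L →ₗ[ℝ] N) (C : N →ₗ[ℝ] L)
    (h : (LinearMap.toMatrix b b (C ∘ₗ f)).det ≠ 0) : Function.Injective f := by
  rw [LinearMap.det_toMatrix] at h
  have : FiniteDimensional ℝ L := b.finiteDimensional_of_finite
  have h1 : Function.Injective (C ∘ₗ f) := (LinearMap.equivOfDetNeZero _ h).injective
  exact Function.Injective.of_comp (f := C) (by simpa using h1)

/-- Injectivity at one parameter of a polynomial family of linear maps implies injectivity at all
but finitely many parameters. -/
lemma finite_setOf_not_injective [FiniteDimensional ℝ L] (A : P →ₗ[ℝ] L →ₗ[ℝ] N) {φ : ℝ → P}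
    (hφ : IsPolyCurve φ) {t₀ : ℝ} (h : Function.Injective (A (φ t₀))) :
    {t | ¬ Function.Injective (A (φ t))}.Finite := by
  obtain ⟨C, hC⟩ := LinearMap.exists_leftInverse_of_injective _ (LinearMap.ker_eq_bot.2 h)
  let b := Module.finBasis ℝ L
  let M : ℝ → Matrix _ _ ℝ := fun t => LinearMap.toMatrix b b (C ∘ₗ A (φ t))
  have hM : ∃ Q : ℝ[X], ∀ t, (M t).det = Q.eval t := by
    refine exists_poly_det fun i j => ?_
    exact hφ ((b.coord i) ∘ₗ C ∘ₗ A.flip (b j)) |>.imp fun Q hQ t => by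
      rw [← hQ t]; simp [M, LinearMap.toMatrix_apply]
  have h0 : (M t₀).det ≠ 0 := by simp [M, hC]
  refine (finite_setOf_eq_zero_of_poly hM h0).subset fun t ht => ?_
  by_contra hdet
  apply ht
  exact injective_of_det_toMatrix_ne_zero b _ C hdet

variable [TopologicalSpace P] [IsTopologicalAddGroup P] [ContinuousSMul ℝ P] [T2Space P]
  [FiniteDimensional ℝ P]

lemma continuous_toMatrix_family {U : Type*} [AddCommGroup U] [Module ℝ U] {ι κ : Type*}
    [Fintype ι] [Fintype κ] [DecidableEq κ] (b : Module.Basis κ ℝ L) (b' : Module.Basis ι ℝ U)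
    (A : P →ₗ[ℝ] L →ₗ[ℝ] N) (C : N →ₗ[ℝ] U) :
    Continuous fun p => LinearMap.toMatrix b b' (C ∘ₗ A p) := by
  refine continuous_matrix fun i j => ?_
  have := LinearMap.continuous_of_finiteDimensional ((b'.coord i) ∘ₗ C ∘ₗ A.flip (b j))
  convert this using 2
  simp [LinearMap.toMatrix_apply]

lemma eventually_injective [FiniteDimensional ℝ L] (A : P →ₗ[ℝ] L →ₗ[ℝ] N) {p₀ : P}
    (h : Function.Injective (A p₀)) : ∀ᶠ p in 𝓝 p₀, Function.Injective (A p) := by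
  obtain ⟨C, hC⟩ := LinearMap.exists_leftInverse_of_injective _ (LinearMap.ker_eq_bot.2 h)
  let b := Module.finBasis ℝ L
  have hc := (continuous_toMatrix_family b b A C).matrix_det
  have h0 : (LinearMap.toMatrix b b (C ∘ₗ A p₀)).det ≠ 0 := by simp [hC]
  filter_upwards [hc.continuousAt.eventually_ne h0] with p hp
  exact injective_of_det_toMatrix_ne_zero b _ C hp

/-- Kernel elements extend continuously to nearby parameters at which the rank does not jump. -/
lemma exists_continuous_kernel [FiniteDimensional ℝ L] [FiniteDimensional ℝ N]
    [TopologicalSpace L] [IsTopologicalAddGroup L] [ContinuousSMul ℝ L]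
    (A : P →ₗ[ℝ] L →ₗ[ℝ] N) {p₀ : P} {k₀ : L} (hk : A p₀ k₀ = 0)
    (hr : ∀ᶠ p in 𝓝 p₀, Module.finrank ℝ (LinearMap.ker (A p₀)) ≤
      Module.finrank ℝ (LinearMap.ker (A p))) :
    ∃ (U : Set P) (k : P → L), IsOpen U ∧ p₀ ∈ U ∧ ContinuousOn k U ∧ k p₀ = k₀ ∧
      ∀ p ∈ U, A p (k p) = 0 := by
  obtain ⟨W, hW⟩ := Submodule.exists_isCompl (LinearMap.ker (A p₀))
  have hinj : Function.Injective (A p₀ ∘ₗ W.subtype) := by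
    rw [← LinearMap.ker_eq_bot, LinearMap.ker_comp, Submodule.eq_bot_iff]
    intro w hw
    have : (w : L) ∈ LinearMap.ker (A p₀) ⊓ W := ⟨hw, w.2⟩
    rw [hW.inf_eq_bot] at this
    exact Subtype.ext (by simpa using this)
  obtain ⟨C, hC⟩ := LinearMap.exists_leftInverse_of_injective _ (LinearMap.ker_eq_bot.2 hinj)
  let B : P →ₗ[ℝ] W →ₗ[ℝ] N := (LinearMap.lcomp ℝ N W.subtype) ∘ₗ A
  have hB : ∀ p, B p = A p ∘ₗ W.subtype := fun p => rfl
  let b := Module.finBasis ℝ W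
  let M : P → Matrix _ _ ℝ := fun p => LinearMap.toMatrix b b (C ∘ₗ B p)
  have hMc : Continuous M := continuous_toMatrix_family b b B C
  have h0 : (M p₀).det ≠ 0 := by simp [M, hB, hC]
  let v : P → Fin (Module.finrank ℝ W) → ℝ := fun p => b.repr (C (A p k₀))
  have hvc : Continuous v := continuous_pi fun i =>
    LinearMap.continuous_of_finiteDimensional ((b.coord i) ∘ₗ C ∘ₗ A.flip k₀)
  have hev : ∀ᶠ p in 𝓝 p₀, (M p).det ≠ 0 ∧ Module.finrank ℝ (LinearMap.ker (A p₀)) ≤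
      Module.finrank ℝ (LinearMap.ker (A p)) :=
    (hMc.matrix_det.continuousAt.eventually_ne h0).and hr
  obtain ⟨U, hU, hUo, hpU⟩ := eventually_nhds_iff.1 hev
  refine ⟨U, fun p => k₀ - ∑ i, ((M p)⁻¹ *ᵥ v p) i • (b i : L), hUo, hpU, ?_, ?_, ?_⟩
  · refine continuousOn_const.sub (continuousOn_finsetSum _ fun i _ => ?_)
    refine ContinuousOn.smul ?_ continuousOn_const
    have h1 : ContinuousOn (fun p => (M p)⁻¹) U := fun p hp => by
      refine ContinuousAt.continuousWithinAt ?_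
      have h3 : ContinuousAt (fun p => (M p).det⁻¹ • (M p).adjugate) p :=
        (hMc.matrix_det.continuousAt.inv₀ (hU p hp).1).smul hMc.matrix_adjugate.continuousAt
      simpa [Matrix.inv_def] using h3
    have h2 : ContinuousOn (fun p => (M p)⁻¹ *ᵥ v p) U := by
      rw [continuousOn_iff_continuous_domRestrict] at h1 ⊢
      exact h1.matrix_mulVec (hvc.comp continuous_subtype_val)
    exact (continuous_apply i).comp_continuousOn h2
  · have : v p₀ = 0 := by funext i; simp [v, hk]
    simp [this]
  · intro p hp
    have hBinj : Function.Injective (B p) := injective_of_det_toMatrix_ne_zero b _ C (hU p hp).1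
    have hrange : LinearMap.range (B p) = LinearMap.range (A p) := by
      refine Submodule.eq_of_le_of_finrank_le ?_ ?_
      · rw [hB]; exact LinearMap.range_comp_le_range _ _
      · rw [LinearMap.finrank_range_of_inj hBinj]
        have h1 := LinearMap.finrank_range_add_finrank_ker (A p)
        have h2 := Submodule.finrank_add_eq_of_isCompl hW
        have h3 := (hU p hp).2
        omega
    obtain ⟨w, hw⟩ : A p k₀ ∈ LinearMap.range (B p) := hrange ▸ LinearMap.mem_range_self _ _
    have h4 : M p *ᵥ b.repr w = v p := by
      simp only [M, v]
      rw [LinearMap.toMatrix_mulVec_repr]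
      simp [← hw]
    have h5 : (M p)⁻¹ *ᵥ v p = b.repr w := by
      rw [← h4, Matrix.mulVec_mulVec, Matrix.nonsing_inv_mul _ (isUnit_iff_ne_zero.2 (hU p hp).1),
        Matrix.one_mulVec]
    have h6 : ∑ i, ((M p)⁻¹ *ᵥ v p) i • (b i : L) = w := by
      rw [h5]
      have := congrArg W.subtype (b.sum_repr w)
      rw [map_sum] at this
      exact this
    beta_reduce
    rw [h6, map_sub, sub_eq_zero, ← hw]
    rfl

end LinearFamilies

/-! ### Stress matrices of vector configurations -/

section Stress

open Topology Filter

variable {V : Type*} {d : ℕ}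

/-- Symmetric matrices whose off-diagonal support is contained in the edge set `F`. -/
def patternSpace (F : Set (Sym2 V)) : Submodule ℝ (Matrix V V ℝ) where
  carrier := {K | (∀ i j, K j i = K i j) ∧ ∀ i j, i ≠ j → s(i, j) ∉ F → K i j = 0}
  add_mem' {K K'} h h' := ⟨fun i j => by simp [h.1 i j, h'.1 i j],
    fun i j hij hF => by simp [h.2 i j hij hF, h'.2 i j hij hF]⟩
  zero_mem' := ⟨fun _ _ => rfl, fun _ _ _ _ => rfl⟩
  smul_mem' c K h := ⟨fun i j => by simp [h.1 i j], fun i j hij hF => by simp [h.2 i j hij hF]⟩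

lemma patternSpace_mono {F F' : Set (Sym2 V)} (h : F ⊆ F') :
    patternSpace F ≤ patternSpace F' :=
  fun _ hK => ⟨hK.1, fun i j hij hF => hK.2 i j hij fun hF' => hF (h hF')⟩

/-- The linear combinations of three of the configuration vectors. -/
noncomputable def tripleMap (i j k : V) :
    (V → Fin 3 → ℝ) →ₗ[ℝ] (Fin 3 → ℝ) →ₗ[ℝ] (Fin 3 → ℝ) :=
  LinearMap.mk₂ ℝ (fun p c => c 0 • p i + c 1 • p j + c 2 • p k)
    (fun p q c => by simp only [Pi.add_apply, smul_add]; abel)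
    (fun c p q => by simp only [Pi.smul_apply, smul_add, smul_comm c])
    (fun p c c' => by simp only [Pi.add_apply, add_smul]; abel)
    (fun c p c' => by simp only [Pi.smul_apply, smul_eq_mul, mul_smul, smul_add])

lemma tripleMap_injective_iff {i j k : V} {p : V → Fin 3 → ℝ} :
    Function.Injective (tripleMap i j k p) ↔
      ∀ a b c : ℝ, a • p i + b • p j + c • p k = 0 → a = 0 ∧ b = 0 ∧ c = 0 := by
  rw [← LinearMap.ker_eq_bot, Submodule.eq_bot_iff]
  constructor
  · intro h a b c habc
    have := h ![a, b, c] (by simpa [tripleMap] using habc)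
    exact ⟨by simpa using congrFun this 0, by simpa using congrFun this 1,
      by simpa using congrFun this 2⟩
  · intro h c hc
    obtain ⟨h0, h1, h2⟩ := h _ _ _ (show c 0 • p i + c 1 • p j + c 2 • p k = 0 from hc)
    funext l; fin_cases l <;> assumption

/-- Any three vectors of the configuration are linearly independent. -/
def GenPos (p : V → Fin 3 → ℝ) : Prop :=
  ∀ i j k, i ≠ j → i ≠ k → j ≠ k →
    ∀ a b c : ℝ, a • p i + b • p j + c • p k = 0 → a = 0 ∧ b = 0 ∧ c = 0

lemma exists_triple {i j k : V} (hij : i ≠ j) (hik : i ≠ k) (hjk : j ≠ k) :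
    ∃ p : V → Fin 3 → ℝ, Function.Injective (tripleMap i j k p) := by
  classical
  refine ⟨fun v => if v = i then ![1, 0, 0] else if v = j then ![0, 1, 0] else ![0, 0, 1], ?_⟩
  rw [tripleMap_injective_iff]
  intro a b c h
  have h0 := congrFun h 0
  have h1 := congrFun h 1
  have h2 := congrFun h 2
  simp [hij.symm, hik.symm, hjk.symm] at h0 h1 h2
  exact ⟨h0, h1, h2⟩

variable [Fintype V]

/-- The matrices with pattern `F` that annihilate the configuration `p`. -/
def stressSpace (p : V → Fin d → ℝ) (F : Set (Sym2 V)) : Submodule ℝ (Matrix V V ℝ) where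
  carrier := {K | K ∈ patternSpace F ∧ ∀ i, ∑ j, K i j • p j = 0}
  add_mem' {K K'} h h' := ⟨add_mem h.1 h'.1, fun i => by
    simp [add_smul, Finset.sum_add_distrib, h.2 i, h'.2 i]⟩
  zero_mem' := ⟨zero_mem _, fun i => by simp⟩
  smul_mem' c K h := ⟨Submodule.smul_mem _ c h.1, fun i => by
    simp [mul_smul, ← Finset.smul_sum, h.2 i]⟩

lemma stressSpace_mono (p : V → Fin d → ℝ) {F F' : Set (Sym2 V)} (h : F ⊆ F') :
    stressSpace p F ≤ stressSpace p F' := fun _ hK => ⟨patternSpace_mono h hK.1, hK.2⟩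

lemma mem_stressSpace_of_eq_zero {p : V → Fin d → ℝ} {F F' : Set (Sym2 V)} {K : Matrix V V ℝ}
    (hK : K ∈ stressSpace p F)
    (h : ∀ i j, i ≠ j → s(i, j) ∈ F → s(i, j) ∉ F' → K i j = 0) : K ∈ stressSpace p F' :=
  ⟨⟨hK.1.1, fun i j hij hF' => by
    by_cases hF : s(i, j) ∈ F
    · exact h i j hij hF hF'
    · exact hK.1.2 i j hij hF⟩, hK.2⟩

/-- The force `i ↦ ∑ j, K i j • p j`, bilinear in the configuration and the matrix. -/
noncomputable def stressMap (d : ℕ) (F : Set (Sym2 V)) :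
    (V → Fin d → ℝ) →ₗ[ℝ] patternSpace F →ₗ[ℝ] (V → Fin d → ℝ) :=
  LinearMap.mk₂ ℝ (fun p K i => ∑ j, (K : Matrix V V ℝ) i j • p j)
    (fun p q K => by funext i; simp [Finset.sum_add_distrib])
    (fun c p K => by funext i; simp only [Pi.smul_apply, Finset.smul_sum, smul_comm c])
    (fun p K K' => by funext i; simp [add_smul, Finset.sum_add_distrib])
    (fun c p K => by funext i; simp [Finset.smul_sum, mul_smul])

lemma stressMap_apply (F : Set (Sym2 V)) (p : V → Fin d → ℝ) (K : patternSpace F) (i : V) :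
    stressMap d F p K i = ∑ j, (K : Matrix V V ℝ) i j • p j := rfl

lemma stressMap_injective_iff {F : Set (Sym2 V)} {p : V → Fin d → ℝ} :
    Function.Injective (stressMap d F p) ↔ stressSpace p F = ⊥ := by
  rw [← LinearMap.ker_eq_bot, Submodule.eq_bot_iff, Submodule.eq_bot_iff]
  constructor
  · intro h K hK
    have := h ⟨K, hK.1⟩ (by funext i; exact hK.2 i)
    exact congrArg Subtype.val this
  · intro h K hK
    exact Subtype.ext (h K ⟨K.2, fun i => congrFun hK i⟩)

lemma map_ker_stressMap (F : Set (Sym2 V)) (p : V → Fin d → ℝ) :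
    (LinearMap.ker (stressMap d F p)).map (patternSpace F).subtype = stressSpace p F := by
  ext K
  constructor
  · rintro ⟨K, hK, rfl⟩
    exact ⟨K.2, fun i => congrFun hK i⟩
  · intro hK
    exact ⟨⟨K, hK.1⟩, by funext i; exact hK.2 i, rfl⟩

lemma finrank_ker_stressMap (F : Set (Sym2 V)) (p : V → Fin d → ℝ) :
    Module.finrank ℝ (LinearMap.ker (stressMap d F p)) = Module.finrank ℝ (stressSpace p F) := by
  rw [← map_ker_stressMap]
  exact (LinearEquiv.finrank_eq (Submodule.equivMapOfInjective _
    (Submodule.injective_subtype _) _))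

/-- An edge set is generically independent if some configuration has no nonzero stress. -/
def GenIndep (d : ℕ) (F : Set (Sym2 V)) : Prop := ∃ q : V → Fin d → ℝ, stressSpace q F = ⊥

lemma GenIndep.mono {F F' : Set (Sym2 V)} (h : GenIndep d F') (hF : F ⊆ F') : GenIndep d F :=
  h.imp fun q hq => eq_bot_iff.2 ((stressSpace_mono q hF).trans (le_of_eq hq))

lemma ae_injective {P L N : Type*} [NormedAddCommGroup P] [NormedSpace ℝ P]
    [FiniteDimensional ℝ P] [MeasurableSpace P] [BorelSpace P] (μ : Measure P) [μ.IsAddHaarMeasure]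
    [AddCommGroup L] [Module ℝ L] [AddCommGroup N] [Module ℝ N] [FiniteDimensional ℝ L]
    (A : P →ₗ[ℝ] L →ₗ[ℝ] N) {p₀ : P} (h : Function.Injective (A p₀)) :
    ∀ᵐ p ∂μ, Function.Injective (A p) := by
  let T : ℝ →ₗ[ℝ] P := LinearMap.toSpanSingleton ℝ P p₀
  have hopen : IsOpen {p | Function.Injective (A p)} :=
    isOpen_iff_mem_nhds.2 fun p hp => eventually_injective A hp
  refine ae_mem_of_ae_add_linearMap_mem T volume μ hopen.measurableSet fun y => ?_
  have h1 : {t : ℝ | ¬ Function.Injective (A (y + t • p₀))}.Finite := by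
    by_cases hy : ∃ t₀ : ℝ, Function.Injective (A (y + t₀ • p₀))
    · obtain ⟨t₀, ht₀⟩ := hy
      exact finite_setOf_not_injective A (IsPolyCurve.line y p₀) ht₀
    · exfalso
      push Not at hy
      have h2 := finite_setOf_not_injective A (IsPolyCurve.line p₀ y) (t₀ := 0) (by simpa using h)
      have h3 : {t : ℝ | t ≠ 0} ⊆ {t | ¬ Function.Injective (A (p₀ + t • y))} := by
        intro t ht hinj
        apply hy t⁻¹
        have : y + t⁻¹ • p₀ = t⁻¹ • (p₀ + t • y) := by
          rw [smul_add, smul_smul, inv_mul_cancel₀ ht, one_smul, add_comm]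
        rw [this, map_smul]
        intro a b hab
        apply hinj
        simp only [LinearMap.smul_apply] at hab
        exact smul_right_injective N (inv_ne_zero ht) hab
      refine (h2.subset h3).not_infinite ?_
      have : {t : ℝ | t ≠ 0} = ({0} : Set ℝ)ᶜ := rfl
      rw [this]
      exact (Set.finite_singleton (0 : ℝ)).infinite_compl
  have h2 : volume {t : ℝ | ¬ Function.Injective (A (y + t • p₀))} = 0 := h1.measure_zero _
  exact h2

lemma GenIndep.ae {F : Set (Sym2 V)} (h : GenIndep d F) :
    ∀ᵐ p : V → Fin d → ℝ, stressSpace p F = ⊥ := by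
  obtain ⟨q, hq⟩ := h
  have := ae_injective volume (stressMap d F) (stressMap_injective_iff.2 hq)
  exact this.mono fun p hp => stressMap_injective_iff.1 hp

lemma eventually_stressSpace_eq_bot {F : Set (Sym2 V)} {p₀ : V → Fin d → ℝ}
    (h : stressSpace p₀ F = ⊥) : ∀ᶠ p in 𝓝 p₀, stressSpace p F = ⊥ := by
  have := eventually_injective (stressMap d F) (stressMap_injective_iff.2 h)
  exact this.mono fun p hp => stressMap_injective_iff.1 hp

lemma finite_stressSpace_ne_bot {F : Set (Sym2 V)} {φ : ℝ → V → Fin d → ℝ}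
    (hφ : IsPolyCurve φ) {t₀ : ℝ} (h : stressSpace (φ t₀) F = ⊥) :
    {t | stressSpace (φ t) F ≠ ⊥}.Finite := by
  have := finite_setOf_not_injective (stressMap d F) hφ (stressMap_injective_iff.2 h)
  simpa only [stressMap_injective_iff] using this

/-- A configuration in general position with no stress on any generically independent edge set. -/
def IsGeneric (p : V → Fin 3 → ℝ) : Prop :=
  GenPos p ∧ ∀ F : Set (Sym2 V), GenIndep 3 F → stressSpace p F = ⊥

lemma ae_isGeneric : ∀ᵐ p : V → Fin 3 → ℝ, IsGeneric p := by
  classical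
  refine Filter.Eventually.and ?_ ?_
  · change ∀ᵐ p : V → Fin 3 → ℝ, ∀ i j k, i ≠ j → i ≠ k → j ≠ k →
      ∀ a b c : ℝ, a • p i + b • p j + c • p k = 0 → a = 0 ∧ b = 0 ∧ c = 0
    rw [MeasureTheory.ae_all_iff]; intro i
    rw [MeasureTheory.ae_all_iff]; intro j
    rw [MeasureTheory.ae_all_iff]; intro k
    by_cases h : i ≠ j ∧ i ≠ k ∧ j ≠ k
    · obtain ⟨q, hq⟩ := exists_triple h.1 h.2.1 h.2.2
      filter_upwards [ae_injective volume (tripleMap i j k) hq] with p hp _ _ _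
      exact tripleMap_injective_iff.1 hp
    · exact Filter.Eventually.of_forall fun p h1 h2 h3 => (h ⟨h1, h2, h3⟩).elim
  · rw [MeasureTheory.ae_all_iff]; intro F
    by_cases h : GenIndep (V := V) 3 F
    · filter_upwards [h.ae] with p hp _ using hp
    · exact Filter.Eventually.of_forall fun p h' => (h h').elim

lemma IsGeneric.eventually {p₀ : V → Fin 3 → ℝ} (h : IsGeneric p₀) :
    ∀ᶠ p in 𝓝 p₀, IsGeneric p := by
  classical
  refine Filter.Eventually.and ?_ ?_
  · change ∀ᶠ p in 𝓝 p₀, ∀ i j k, i ≠ j → i ≠ k → j ≠ k →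
      ∀ a b c : ℝ, a • p i + b • p j + c • p k = 0 → a = 0 ∧ b = 0 ∧ c = 0
    simp only [Filter.eventually_all]
    intro i j k hij hik hjk
    filter_upwards [eventually_injective (tripleMap i j k)
      (tripleMap_injective_iff.2 (h.1 i j k hij hik hjk))] with p hp
    exact tripleMap_injective_iff.1 hp
  · rw [Filter.eventually_all]
    intro F
    by_cases hF : GenIndep (V := V) 3 F
    · exact (eventually_stressSpace_eq_bot (h.2 F hF)).mono fun p hp _ => hp
    · exact Filter.Eventually.of_forall fun p h' => (hF h').elim

lemma dense_isGeneric : Dense {p : V → Fin 3 → ℝ | IsGeneric p} :=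
  Measure.dense_of_ae ae_isGeneric

lemma exists_isGeneric : ∃ p : V → Fin 3 → ℝ, IsGeneric p := dense_isGeneric.nonempty

end Stress

set_option linter.unusedSectionVars false

/-! ### The generic rigidity matroid -/

section RigidityMatroid

open Topology Filter

variable {V : Type*} [DecidableEq V]

/-- The symmetric `0`-`1` matrix of a single edge. -/
def edgeMat (e : Sym2 V) : Matrix V V ℝ := Matrix.of fun i j => if s(i, j) = e then 1 else 0

lemma edgeMat_apply (e : Sym2 V) (i j : V) : edgeMat e i j = if s(i, j) = e then 1 else 0 := rfl

lemma edgeMat_mem {F : Set (Sym2 V)} {e : Sym2 V} (he : e ∈ F) : edgeMat e ∈ patternSpace F := by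
  refine ⟨fun i j => by rw [edgeMat_apply, edgeMat_apply, Sym2.eq_swap], fun i j _ hF => ?_⟩
  rw [edgeMat_apply, if_neg]
  rintro rfl
  exact hF he

lemma sub_smul_edgeMat_mem {F : Set (Sym2 V)} {K : Matrix V V ℝ} {a b : V}
    (hK : K ∈ patternSpace (insert s(a, b) F)) : K - K a b • edgeMat s(a, b) ∈ patternSpace F := by
  have h1 : edgeMat s(a, b) ∈ patternSpace (insert s(a, b) F) := edgeMat_mem (Set.mem_insert _ _)
  refine ⟨(sub_mem hK (Submodule.smul_mem _ (K a b) h1)).1, fun i j hij hF => ?_⟩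
  by_cases h : s(i, j) = s(a, b)
  · have : K i j = K a b := by
      rcases Sym2.eq_iff.1 h with ⟨rfl, rfl⟩ | ⟨rfl, rfl⟩
      · rfl
      · exact hK.1 _ _
    simp [edgeMat_apply, h, this]
  · have : K i j = 0 := hK.2 i j hij (by simp [h, hF])
    simp [edgeMat_apply, h, this]

variable [Fintype V]

lemma finrank_patternSpace {F : Set (Sym2 V)} (hF : ∀ e ∈ F, ¬ e.IsDiag) :
    Module.finrank ℝ (patternSpace F) = Fintype.card V + F.ncard := by
  classical
  let g : (F → ℝ) → Sym2 V → ℝ := fun f e => if h : e ∈ F then f ⟨e, h⟩ else 0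
  let φ : patternSpace F ≃ₗ[ℝ] (V → ℝ) × (F → ℝ) :=
    { toFun := fun K => (fun i => K.1 i i, fun e => Sym2.lift ⟨fun i j => K.1 i j,
        fun i j => (K.2.1 j i)⟩ e.1)
      map_add' := fun K K' => by
        refine Prod.ext (by funext i; rfl) ?_
        funext ⟨e, he⟩
        induction e with | _ a b => rfl
      map_smul' := fun c K => by
        refine Prod.ext (by funext i; rfl) ?_
        funext ⟨e, he⟩
        induction e with | _ a b => rfl
      invFun := fun x => ⟨Matrix.of fun i j => if i = j then x.1 i else g x.2 s(i, j), by
        refine ⟨fun i j => ?_, fun i j hij h => ?_⟩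
        · simp only [Matrix.of_apply]
          by_cases h : i = j
          · simp [h]
          · rw [if_neg h, if_neg (Ne.symm h), Sym2.eq_swap]
        · simp [hij, g, h]⟩
      left_inv := fun K => by
        ext i j
        by_cases h : i = j
        · simp [h]
        · simp only [Matrix.of_apply, if_neg h, g]
          split_ifs with hm
          · rfl
          · exact (K.2.2 i j h hm).symm
      right_inv := fun x => by
        refine Prod.ext (by funext i; simp) ?_
        funext ⟨e, he⟩
        induction e with
        | _ a b =>
          have hab : a ≠ b := fun h => hF _ he (by simp [h])
          simp [hab, g, he] }
  rw [φ.finrank_eq, Module.finrank_prod, Module.finrank_fintype_fun_eq_card,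
    Module.finrank_fintype_fun_eq_card, Set.ncard_eq_toFinset_card', Set.toFinset_card]

lemma sum_sub_row {n : ℕ} (K K' : Matrix V V ℝ) (p : V → Fin n → ℝ) (i : V) :
    ∑ j, (K - K') i j • p j = ∑ j, K i j • p j - ∑ j, K' i j • p j := by
  simp [sub_smul, Finset.sum_sub_distrib]

lemma sum_add_row {n : ℕ} (K K' : Matrix V V ℝ) (p : V → Fin n → ℝ) (i : V) :
    ∑ j, (K + K') i j • p j = ∑ j, K i j • p j + ∑ j, K' i j • p j := by
  simp [add_smul, Finset.sum_add_distrib]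

lemma sum_smul_row {n : ℕ} (c : ℝ) (K : Matrix V V ℝ) (p : V → Fin n → ℝ) (i : V) :
    ∑ j, (c • K) i j • p j = c • ∑ j, K i j • p j := by
  simp [mul_smul, Finset.smul_sum]

lemma row_sum_of_support {n : ℕ} {K : Matrix V V ℝ} {p : V → Fin n → ℝ} {v a b : V} (hva : v ≠ a)
    (hvb : v ≠ b) (hab : a ≠ b) (h : ∀ j, j ≠ v → j ≠ a → j ≠ b → K v j = 0) :
    ∑ j, K v j • p j = K v v • p v + K v a • p a + K v b • p b := by
  rw [← Finset.sum_subset (Finset.subset_univ {v, a, b})]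
  · rw [Finset.sum_insert (by simp [hva, hvb]), Finset.sum_insert (by simp [hab]),
      Finset.sum_singleton, add_assoc]
  · intro j _ hj
    simp only [Finset.mem_insert, Finset.mem_singleton, not_or] at hj
    rw [h j hj.1 hj.2.1 hj.2.2, zero_smul]

/-- Attaching a new vertex by two edges preserves generic independence. -/
lemma GenIndep.zero_extension {F : Set (Sym2 V)} (hF : GenIndep 3 F) {v a b : V}
    (hv : ∀ e ∈ F, v ∉ e) (hva : v ≠ a) (hvb : v ≠ b) (hab : a ≠ b) :
    GenIndep 3 (insert s(v, a) (insert s(v, b) F)) := by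
  obtain ⟨p, hp⟩ := exists_isGeneric (V := V)
  refine ⟨p, (Submodule.eq_bot_iff _).2 fun K hK => ?_⟩
  have hz : ∀ j, j ≠ v → j ≠ a → j ≠ b → K v j = 0 := fun j h1 h2 h3 =>
    hK.1.2 v j h1.symm (by
      rintro (h | h | h)
      · exact h2 (by simpa [hva] using h)
      · exact h3 (by simpa [hvb] using h)
      · exact hv _ h (by simp))
  have h0 := hK.2 v
  rw [row_sum_of_support hva hvb hab hz] at h0
  obtain ⟨-, h1, h2⟩ := hp.1 v a b hva hvb hab _ _ _ h0
  have hK' : K ∈ stressSpace p F := by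
    refine mem_stressSpace_of_eq_zero hK fun i j hij hm hn => ?_
    rcases hm with h | h | h
    · rcases Sym2.eq_iff.1 h with ⟨rfl, rfl⟩ | ⟨rfl, rfl⟩
      · exact h1
      · rw [← h1]; exact hK.1.1 _ _
    · rcases Sym2.eq_iff.1 h with ⟨rfl, rfl⟩ | ⟨rfl, rfl⟩
      · exact h2
      · rw [← h2]; exact hK.1.1 _ _
    · exact absurd h hn
  have := hp.2 F hF
  rw [this] at hK'
  simpa using hK'

lemma genIndep_empty : GenIndep 3 (∅ : Set (Sym2 V)) := by
  refine ⟨fun _ => ![1, 0, 0], (Submodule.eq_bot_iff _).2 fun K hK => ?_⟩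
  have hoff : ∀ i j, i ≠ j → K i j = 0 := fun i j hij => hK.1.2 i j hij (by simp)
  ext i j
  by_cases h : i = j
  · subst h
    have h0 := congrFun (hK.2 i) 0
    rw [Finset.sum_eq_single i (fun j _ hj => by rw [hoff i j hj.symm, zero_smul]) (by simp)] at h0
    simpa using h0
  · exact hoff i j h

lemma map_stressMap_le {I J : Set (Sym2 V)} {p : V → Fin 3 → ℝ} (hJ : J.Finite)
    (hdiag : ∀ e ∈ J, ¬ e.IsDiag)
    (h : ∀ e ∈ J, e ∉ I → ∃ K ∈ stressSpace p (insert e I), K ∉ patternSpace I) :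
    ∀ K ∈ patternSpace J, ∃ K' ∈ patternSpace I, ∀ i, ∑ j, K i j • p j = ∑ j, K' i j • p j := by
  induction J, hJ using Set.Finite.induction_on with
  | empty => exact fun K hK => ⟨K, patternSpace_mono (Set.empty_subset _) hK, fun i => rfl⟩
  | @insert e J heJ hJ ih =>
    intro K hK
    induction e with | _ a b =>
    obtain ⟨K₁, hK₁, h₁⟩ := ih (fun e he => hdiag e (Set.mem_insert_of_mem _ he))
      (fun e he => h e (Set.mem_insert_of_mem _ he)) _ (sub_smul_edgeMat_mem hK)
    obtain ⟨K₂, hK₂, h₂⟩ : ∃ K₂ ∈ patternSpace I, ∀ i,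
        ∑ j, edgeMat s(a, b) i j • p j = ∑ j, K₂ i j • p j := by
      by_cases heI : s(a, b) ∈ I
      · exact ⟨_, edgeMat_mem heI, fun i => rfl⟩
      · obtain ⟨Q, hQ, hQI⟩ := h _ (Set.mem_insert _ _) heI
        have hab : a ≠ b := fun hab => hdiag _ (Set.mem_insert _ _) (by simp [hab])
        have h4 := sub_smul_edgeMat_mem hQ.1
        have h5 : Q a b ≠ 0 := fun h0 => hQI (by simpa [h0] using h4)
        refine ⟨-(Q a b)⁻¹ • (Q - Q a b • edgeMat s(a, b)), Submodule.smul_mem _ _ h4, fun i => ?_⟩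
        rw [sum_smul_row, sum_sub_row, sum_smul_row, hQ.2 i, zero_sub, neg_smul, smul_neg, neg_neg,
          smul_smul, inv_mul_cancel₀ h5, one_smul]
    refine ⟨K₁ + K a b • K₂, add_mem hK₁ (Submodule.smul_mem _ _ hK₂), fun i => ?_⟩
    have h6 := h₁ i
    rw [sum_sub_row, sum_smul_row, h₂] at h6
    rw [sum_add_row, sum_smul_row, ← h6]
    abel

lemma GenIndep.augment {I J : Set (Sym2 V)} (hI : GenIndep 3 I) (hJ : GenIndep 3 J)
    (hId : ∀ e ∈ I, ¬ e.IsDiag) (hJd : ∀ e ∈ J, ¬ e.IsDiag) (hlt : I.ncard < J.ncard) :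
    ∃ e ∈ J, e ∉ I ∧ GenIndep 3 (insert e I) := by
  by_contra! hcon
  obtain ⟨p, hp⟩ := exists_isGeneric (V := V)
  have h1 := map_stressMap_le (p := p) (I := I) (Set.toFinite J) hJd (fun e he heI => by
    by_contra! h2
    refine hcon e he heI ⟨p, (Submodule.eq_bot_iff _).2 fun K hK => ?_⟩
    have h3 : K ∈ stressSpace p I := ⟨h2 K hK, hK.2⟩
    rw [hp.2 I hI] at h3
    simpa using h3)
  have hinjI := stressMap_injective_iff.2 (hp.2 I hI)
  have hinjJ := stressMap_injective_iff.2 (hp.2 J hJ)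
  have hle : LinearMap.range (stressMap 3 J p) ≤ LinearMap.range (stressMap 3 I p) := by
    rintro _ ⟨K, rfl⟩
    obtain ⟨K', hK', h⟩ := h1 K K.2
    exact ⟨⟨K', hK'⟩, funext fun i => (h i).symm⟩
  have h4 := Submodule.finrank_mono hle
  rw [LinearMap.finrank_range_of_inj hinjI, LinearMap.finrank_range_of_inj hinjJ,
    finrank_patternSpace hId, finrank_patternSpace hJd] at h4
  omega

variable (V) in
/-- The generic rigidity matroid of the plane, on the edges of the complete graph on `V`. -/
def rigidityMatroid : Matroid (Sym2 V) :=
  (IndepMatroid.ofFinite (E := {e : Sym2 V | ¬ e.IsDiag}) (Set.toFinite _)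
    (fun F => (∀ e ∈ F, ¬ e.IsDiag) ∧ GenIndep 3 F)
    ⟨fun e he => he.elim, genIndep_empty⟩
    (fun _ _ hJ hIJ => ⟨fun e he => hJ.1 e (hIJ he), hJ.2.mono hIJ⟩)
    (fun I J hI hJ hlt => by
      obtain ⟨e, he, heI, h⟩ := hI.2.augment hJ.2 hI.1 hJ.1 hlt
      refine ⟨e, he, heI, ?_, h⟩
      rintro f (rfl | hf)
      · exact hJ.1 _ he
      · exact hI.1 f hf)
    (fun _ hI e he => hI.1 e he)).matroid

lemma rigidityMatroid_ground : (rigidityMatroid V).E = {e : Sym2 V | ¬ e.IsDiag} := rfl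

lemma GenPos.eq_zero_of_cross {p : V → Fin 3 → ℝ} (hp : GenPos p) {i j k : V} (hij : i ≠ j)
    (hik : i ≠ k) (hjk : j ≠ k) {w : Fin 3 → ℝ} (hi : crossProduct w (p i) = 0)
    (hj : crossProduct w (p j) = 0) : w = 0 := by
  have key : ∀ u : Fin 3 → ℝ, crossProduct w u = 0 → ∀ l, (u ⬝ᵥ u) * w l = (u ⬝ᵥ w) * u l := by
    intro u hu l
    have h0 := congrFun hu 0
    have h1 := congrFun hu 1
    have h2 := congrFun hu 2
    simp [cross_apply] at h0 h1 h2
    simp only [dotProduct, Fin.sum_univ_three]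
    fin_cases l <;> simp only [Fin.zero_eta, Fin.mk_one, Fin.reduceFinMk]
    · linear_combination u 1 * h2 - u 2 * h1
    · linear_combination u 2 * h0 - u 0 * h2
    · linear_combination u 0 * h1 - u 1 * h0
  have hne : ∀ i j k, i ≠ j → i ≠ k → j ≠ k → p i ⬝ᵥ p i ≠ 0 := by
    intro i j k hij hik hjk h0
    have h1 : p i = 0 := by simpa using h0
    have := hp i j k hij hik hjk 1 0 0 (by simp [h1])
    simp at this
  have hi' : w = ((p i ⬝ᵥ w) / (p i ⬝ᵥ p i)) • p i := by
    funext l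
    have h1 := hne i j k hij hik hjk
    have := key _ hi l
    simp only [Pi.smul_apply, smul_eq_mul]
    field_simp
    linarith
  have hj' : w = ((p j ⬝ᵥ w) / (p j ⬝ᵥ p j)) • p j := by
    funext l
    have h1 := hne j i k hij.symm hjk hik
    have := key _ hj l
    simp only [Pi.smul_apply, smul_eq_mul]
    field_simp
    linarith
  have := hp i j k hij hik hjk ((p i ⬝ᵥ w) / (p i ⬝ᵥ p i)) (-((p j ⬝ᵥ w) / (p j ⬝ᵥ p j))) 0 (by
    rw [zero_smul, add_zero, neg_smul, ← hi', ← hj', add_neg_cancel])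
  rw [hi', this.1, zero_smul]

lemma sum_mul_antisymm {K c : Matrix V V ℝ} (hK : ∀ i j, K j i = K i j)
    (hc : ∀ i j, c j i = - c i j) : ∑ i, ∑ j, K i j * c i j = 0 := by
  have h : ∑ i, ∑ j, K i j * c i j = - ∑ i, ∑ j, K i j * c i j := by
    conv_lhs => rw [Finset.sum_comm]
    rw [← Finset.sum_neg_distrib]
    refine Finset.sum_congr rfl fun i _ => ?_
    rw [← Finset.sum_neg_distrib]
    refine Finset.sum_congr rfl fun j _ => ?_
    rw [hK, hc]; ring
  linarith

lemma GenIndep.ncard_add_three_le {F : Set (Sym2 V)} (hF : GenIndep 3 F)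
    (hd : ∀ e ∈ F, ¬ e.IsDiag) (hV : 3 ≤ Fintype.card V) :
    F.ncard + 3 ≤ 2 * Fintype.card V := by
  obtain ⟨p, hp⟩ := exists_isGeneric (V := V)
  obtain ⟨i, j, k, hij, hik, hjk⟩ := Fintype.two_lt_card_iff.1 hV
  let T : (Fin 3 → ℝ) →ₗ[ℝ] (V → Fin 3 → ℝ) :=
    LinearMap.pi fun i => (crossProduct (R := ℝ)).flip (p i)
  have hT : ∀ w i, T w i = crossProduct w (p i) := fun w i => rfl
  let Ψ : patternSpace F × (Fin 3 → ℝ) →ₗ[ℝ] (V → Fin 3 → ℝ) := (stressMap 3 F p).coprod T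
  have horth : ∀ (K : patternSpace F) w, ∑ i, (stressMap 3 F p K i) ⬝ᵥ (T w i) = 0 := by
    intro K w
    have := sum_mul_antisymm (K := (K : Matrix V V ℝ))
      (c := fun i j => p j ⬝ᵥ crossProduct w (p i)) K.2.1 (fun i j => by
        simp [dotProduct, Fin.sum_univ_three, cross_apply]; ring)
    rw [← this]
    refine Finset.sum_congr rfl fun i _ => ?_
    rw [stressMap_apply, hT, sum_dotProduct]
    exact Finset.sum_congr rfl fun j _ => smul_dotProduct _ _ _
  have hinj : Function.Injective Ψ := by
    rw [← LinearMap.ker_eq_bot, Submodule.eq_bot_iff]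
    rintro ⟨K, w⟩ h
    have h1 : ∀ i, stressMap 3 F p K i = - T w i := fun i => by
      have := congrFun (show stressMap 3 F p K + T w = 0 from h) i
      exact eq_neg_of_add_eq_zero_left this
    have h2 : ∑ i, T w i ⬝ᵥ T w i = 0 := by
      have := horth K w
      simp only [h1, neg_dotProduct, Finset.sum_neg_distrib, neg_eq_zero] at this
      exact this
    have h3 : ∀ i, T w i = 0 := fun i => by
      have := (Finset.sum_eq_zero_iff_of_nonneg (fun i _ => by
        simpa using dotProduct_star_self_nonneg (T w i))).1 h2 i (Finset.mem_univ _)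
      simpa using this
    have hw : w = 0 := hp.1.eq_zero_of_cross hij hik hjk (h3 i) (h3 j)
    have hK : K = 0 := by
      apply stressMap_injective_iff.2 (hp.2 F hF)
      funext i
      rw [h1, h3]; simp
    rw [hw, hK]; rfl
  have := LinearMap.finrank_le_finrank_of_injective hinj
  rw [Module.finrank_prod, finrank_patternSpace hd, Module.finrank_fintype_fun_eq_card,
    Module.finrank_pi_fintype] at this
  simp at this
  omega

end RigidityMatroid

/-! ### Counting in the rigidity matroid -/

section Counting

variable {V : Type*}

/-- The edges of the complete graph on `X`. -/
def edgesOn (X : Set V) : Set (Sym2 V) := {e | ¬ e.IsDiag ∧ ∀ v ∈ e, v ∈ X}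

/-- The vertices covered by an edge set. -/
def verts (F : Set (Sym2 V)) : Set V := {v | ∃ e ∈ F, v ∈ e}

/-- The edges of `F` at the vertex `v`. -/
def starAt (F : Set (Sym2 V)) (v : V) : Set (Sym2 V) := {e ∈ F | v ∈ e}

lemma mk_mem_edgesOn {X : Set V} {a b : V} : s(a, b) ∈ edgesOn X ↔ a ≠ b ∧ a ∈ X ∧ b ∈ X := by
  simp [edgesOn]

lemma edgesOn_mono {X Y : Set V} (h : X ⊆ Y) : edgesOn X ⊆ edgesOn Y :=
  fun _ he => ⟨he.1, fun v hv => h (he.2 v hv)⟩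

lemma verts_mono {F F' : Set (Sym2 V)} (h : F ⊆ F') : verts F ⊆ verts F' :=
  fun _ ⟨e, he, hv⟩ => ⟨e, h he, hv⟩

lemma subset_edgesOn_verts {F : Set (Sym2 V)} (h : ∀ e ∈ F, ¬ e.IsDiag) : F ⊆ edgesOn (verts F) :=
  fun e he => ⟨h e he, fun _ hv => ⟨e, he, hv⟩⟩

lemma verts_subset {F : Set (Sym2 V)} {X : Set V} (h : F ⊆ edgesOn X) : verts F ⊆ X :=
  fun v ⟨_, he, hv⟩ => (h he).2 v hv

lemma left_mem_verts {F : Set (Sym2 V)} {a b : V} (h : s(a, b) ∈ F) : a ∈ verts F :=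
  ⟨_, h, by simp⟩

lemma right_mem_verts {F : Set (Sym2 V)} {a b : V} (h : s(a, b) ∈ F) : b ∈ verts F :=
  ⟨_, h, by simp⟩

lemma edgesOn_pair {a b : V} (hab : a ≠ b) : edgesOn {a, b} = {s(a, b)} := by
  ext e
  induction e with | _ u w =>
  rw [mk_mem_edgesOn, Set.mem_singleton_iff, Sym2.eq_iff]
  simp only [Set.mem_insert_iff, Set.mem_singleton_iff]
  constructor
  · rintro ⟨h, rfl | rfl, rfl | rfl⟩ <;> simp_all
  · rintro (⟨rfl, rfl⟩ | ⟨rfl, rfl⟩) <;> simp [hab, hab.symm]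

variable [Fintype V] [DecidableEq V]

local notation "𝓜" => rigidityMatroid V

lemma subset_ground_iff {F : Set (Sym2 V)} : F ⊆ (𝓜).E ↔ ∀ e ∈ F, ¬ e.IsDiag := Iff.rfl

lemma edgesOn_subset_ground (X : Set V) : edgesOn X ⊆ (𝓜).E := fun _ he => he.1

lemma insert_not_isDiag {F : Set (Sym2 V)} (h : ∀ e ∈ F, ¬ e.IsDiag) {a b : V} (hab : a ≠ b) :
    ∀ e ∈ insert s(a, b) F, ¬ e.IsDiag := by
  rintro e (rfl | he)
  · simpa using hab
  · exact h e he

lemma indep_zero_extension {F : Set (Sym2 V)} (hF : (𝓜).Indep F) {v a b : V}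
    (hv : v ∉ verts F) (hva : v ≠ a) (hvb : v ≠ b) (hab : a ≠ b) :
    (𝓜).Indep (insert s(v, a) (insert s(v, b) F)) :=
  ⟨insert_not_isDiag (insert_not_isDiag hF.1 hvb) hva,
    GenIndep.zero_extension hF.2 (fun e he hve => hv ⟨e, he, hve⟩) hva hvb hab⟩

/-- Extending an independent set on `X` by attaching each vertex of `Y` to `a, b ∈ X`. -/
lemma exists_indep_extension {I : Set (Sym2 V)} (hI : (𝓜).Indep I) {X Y : Set V}
    (hIX : I ⊆ edgesOn X) {a b : V} (ha : a ∈ X) (hb : b ∈ X) (hab : a ≠ b) (hXY : Disjoint X Y) :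
    ∃ I', I ⊆ I' ∧ (𝓜).Indep I' ∧ I' ⊆ I ∪ edgesOn (Y ∪ {a, b}) ∧
      I'.ncard = I.ncard + 2 * Y.ncard := by
  induction Y, Set.toFinite Y using Set.Finite.induction_on with
  | empty => exact ⟨I, subset_rfl, hI, Set.subset_union_left, by simp⟩
  | @insert v Y hvY hY ih =>
    obtain ⟨I', h1, h2, h3, h4⟩ := ih (hXY.mono_right (Set.subset_insert _ _))
    have hvX : v ∉ X := fun h => Set.disjoint_left.1 hXY h (Set.mem_insert _ _)
    have hva : v ≠ a := fun h => hvX (h ▸ ha)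
    have hvb : v ≠ b := fun h => hvX (h ▸ hb)
    have hv : v ∉ verts I' := by
      rintro ⟨e, he, hve⟩
      rcases h3 he with h | h
      · exact hvX ((hIX h).2 v hve)
      · rcases h.2 v hve with h | h | h
        · exact hvY h
        · exact hva h
        · exact hvb h
    have hn : ∀ c, s(v, c) ∉ I' := fun c hc => hv (left_mem_verts hc)
    refine ⟨_, h1.trans ((Set.subset_insert _ _).trans (Set.subset_insert _ _)),
      indep_zero_extension h2 hv hva hvb hab, ?_, ?_⟩
    · have hm : edgesOn (Y ∪ {a, b}) ⊆ edgesOn (insert v Y ∪ {a, b}) :=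
        edgesOn_mono (Set.union_subset_union_left _ (Set.subset_insert _ _))
      rintro e (rfl | rfl | he)
      · right; rw [mk_mem_edgesOn]; simp [hva]
      · right; rw [mk_mem_edgesOn]; simp [hvb]
      · exact (h3 he).imp id fun h => hm h
    · rw [Set.ncard_insert_of_notMem _ (Set.toFinite _), Set.ncard_insert_of_notMem (hn _)
        (Set.toFinite _), Set.ncard_insert_of_notMem hvY, h4]
      · ring
      · rintro (h | h)
        · exact hab (by simpa [hvb] using h)
        · exact hn _ h

lemma ncard_add_three_le {F : Set (Sym2 V)} (hF : (𝓜).Indep F) {X : Set V} (hFX : F ⊆ edgesOn X)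
    (hX : 2 ≤ X.ncard) : F.ncard + 3 ≤ 2 * X.ncard := by
  obtain ⟨a, ha, b, hb, hab⟩ := (Set.one_lt_ncard (Set.toFinite X)).1 hX
  rcases hX.eq_or_lt with h2 | h3
  · have : X = {a, b} := by
      refine (Set.eq_of_subset_of_ncard_le ?_ ?_).symm
      · rintro u (rfl | rfl) <;> assumption
      · rw [← h2, Set.ncard_pair hab]
    rw [this, edgesOn_pair hab] at hFX
    have := Set.ncard_le_ncard hFX
    rw [Set.ncard_singleton] at this
    omega
  · obtain ⟨I', h1, hi, h4, h5⟩ := exists_indep_extension hF hFX ha hb hab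
      (disjoint_compl_right (a := X))
    have hc := Set.ncard_add_ncard_compl X
    rw [Nat.card_eq_fintype_card] at hc
    have := GenIndep.ncard_add_three_le hi.2 hi.1 (by omega)
    omega

lemma exists_indep_ncard_eq {X : Set V} (hX : 2 ≤ X.ncard) :
    ∃ I ⊆ edgesOn X, (𝓜).Indep I ∧ I.ncard + 3 = 2 * X.ncard := by
  obtain ⟨a, ha, b, hb, hab⟩ := (Set.one_lt_ncard (Set.toFinite X)).1 hX
  have h0 : (𝓜).Indep ∅ := (𝓜).empty_indep
  have h1 : (𝓜).Indep {s(a, b)} := by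
    by_cases h3 : 3 ≤ Fintype.card V
    · obtain ⟨c, hc⟩ : ∃ c, c ∉ ({a, b} : Finset V) := by
        by_contra! h
        have := Finset.card_le_card (fun x _ => h x : Finset.univ ⊆ ({a, b} : Finset V))
        rw [Finset.card_univ, Finset.card_pair hab] at this
        omega
      simp only [Finset.mem_insert, Finset.mem_singleton, not_or] at hc
      refine (indep_zero_extension h0 (v := a) (a := b) (b := c) (by simp [verts]) hab
        (Ne.symm hc.1) (Ne.symm hc.2)).subset (by simp)
    · refine ⟨by simpa using hab, ?_⟩
      refine ⟨fun v => if v = a then ![1, 0, 0] else ![0, 1, 0],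
        (Submodule.eq_bot_iff _).2 fun K hK => ?_⟩
      have hab' : ∀ v, v = a ∨ v = b := by
        intro v
        by_contra! h
        have := Finset.card_le_univ ({v, a, b} : Finset V)
        rw [Finset.card_insert_of_notMem (by simp [h.1, h.2]), Finset.card_pair hab] at this
        omega
      have hu : (Finset.univ : Finset V) = {a, b} := by
        ext v; simpa using hab' v
      ext i j
      have h2 := hK.2 i
      rw [hu, Finset.sum_pair hab] at h2
      have h3 := congrFun h2 0
      have h4 := congrFun h2 1
      simp [hab.symm] at h3 h4
      rcases hab' j with rfl | rfl
      · simpa using h3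
      · simpa using h4
  obtain ⟨I', -, h3, h4, h5⟩ := exists_indep_extension (X := {a, b}) (Y := X \ {a, b}) h1
    (by rw [edgesOn_pair hab]) (by simp) (by simp) hab Set.disjoint_sdiff_right
  have hsub : ({a, b} : Set V) ⊆ X := by rintro u (rfl | rfl) <;> assumption
  refine ⟨I', fun e he => ?_, h3, ?_⟩
  · rcases h4 he with h | h
    · rw [Set.mem_singleton_iff] at h; rw [h, mk_mem_edgesOn]; exact ⟨hab, ha, hb⟩
    · refine edgesOn_mono ?_ h
      rw [Set.sdiff_union_of_subset hsub]
  · have := Set.ncard_sdiff_add_ncard_of_subset hsub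
    rw [Set.ncard_pair hab] at this
    rw [h5, Set.ncard_singleton]
    omega

lemma edgesOn_subset_closure_of_ncard {I : Set (Sym2 V)} (hI : (𝓜).Indep I) {X : Set V}
    (hIX : I ⊆ edgesOn X) (hX : 2 ≤ X.ncard) (hc : 2 * X.ncard ≤ I.ncard + 3) :
    edgesOn X ⊆ (𝓜).closure I := by
  intro e he
  by_contra hcl
  have heI : e ∉ I := fun h => hcl ((𝓜).mem_closure_of_mem h hI.subset_ground)
  have h1 : (𝓜).Indep (insert e I) := by
    have := (hI.notMem_closure_iff (edgesOn_subset_ground X he)).1 hcl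
    exact this.1
  have h2 := ncard_add_three_le h1 (Set.insert_subset he hIX) hX
  rw [Set.ncard_insert_of_notMem heI] at h2
  omega

lemma edgesOn_union_subset_closure {F : Set (Sym2 V)} {X Y : Set V}
    (hX : edgesOn X ⊆ (𝓜).closure F) (hY : edgesOn Y ⊆ (𝓜).closure F) {a b : V} (hab : a ≠ b)
    (haX : a ∈ X) (haY : a ∈ Y) (hbX : b ∈ X) (hbY : b ∈ Y) :
    edgesOn (X ∪ Y) ⊆ (𝓜).closure F := by
  have hX2 : 2 ≤ X.ncard := (Set.one_lt_ncard (Set.toFinite X)).2 ⟨a, haX, b, hbX, hab⟩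
  obtain ⟨I, hIX, hI, hIc⟩ := exists_indep_ncard_eq hX2
  obtain ⟨I', h1, h2, h3, h4⟩ := exists_indep_extension (Y := Y \ X) hI hIX haX hbX hab
    Set.disjoint_sdiff_right
  have hsub : Y \ X ∪ {a, b} ⊆ Y := by
    rintro u (h | rfl | rfl)
    · exact h.1
    · exact haY
    · exact hbY
  have hun : X.ncard + (Y \ X).ncard = (X ∪ Y).ncard := by
    rw [← Set.ncard_union_eq Set.disjoint_sdiff_right, Set.union_sdiff_self]
  refine (edgesOn_subset_closure_of_ncard h2 (X := X ∪ Y) (h3.trans (Set.union_subset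
    (hIX.trans (edgesOn_mono Set.subset_union_left))
    (edgesOn_mono (hsub.trans Set.subset_union_right)))) (by omega) (by omega)).trans ?_
  refine (𝓜).closure_subset_closure_of_subset_closure (h3.trans ?_)
  exact Set.union_subset (hIX.trans hX) ((edgesOn_mono hsub).trans hY)

lemma isBasis_ncard {F I : Set (Sym2 V)} {X : Set V} (hI : (𝓜).IsBasis I F) (hFX : F ⊆ edgesOn X)
    (hX : 2 ≤ X.ncard) (h : edgesOn X ⊆ (𝓜).closure F) : I.ncard + 3 = 2 * X.ncard := by
  have h1 := ncard_add_three_le hI.indep (hI.subset.trans hFX) hX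
  obtain ⟨J, hJX, hJ, hJc⟩ := exists_indep_ncard_eq hX
  have h2 : J.encard ≤ (𝓜).eRk ((𝓜).closure I) :=
    hJ.encard_le_eRk_of_subset (hJX.trans (h.trans hI.closure_eq_closure.symm.subset))
  rw [Matroid.eRk_closure_eq, hI.indep.eRk_eq_encard, ← (Set.toFinite J).cast_ncard_eq,
    ← (Set.toFinite I).cast_ncard_eq, Nat.cast_le] at h2
  omega

lemma genIndep_of_card_le {F : Set (Sym2 V)} (h : Fintype.card V ≤ 3) : GenIndep 3 F := by
  obtain ⟨f⟩ : Nonempty (V ↪ Fin 3) :=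
    Function.Embedding.nonempty_of_card_le (by simpa using h)
  refine ⟨fun v => Pi.single (f v) 1, (Submodule.eq_bot_iff _).2 fun K hK => ?_⟩
  ext i j
  have h1 := congrFun (hK.2 i) (f j)
  rw [Finset.sum_apply, Finset.sum_eq_single j] at h1
  · simpa using h1
  · intro k _ hk
    simp [f.injective.ne hk.symm]
  · simp

lemma four_le_card_of_isCircuit {C : Set (Sym2 V)} (hC : (𝓜).IsCircuit C) :
    4 ≤ Fintype.card V := by
  by_contra h
  exact hC.not_indep ⟨hC.subset_ground, genIndep_of_card_le (by omega)⟩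

lemma eq_mk_of_mem {e : Sym2 V} {v : V} (h : v ∈ e) : ∃ a, e = s(v, a) := by
  obtain ⟨a, ha⟩ := h
  exact ⟨a, ha⟩

/-- Every vertex of a circuit has degree at least three. -/
lemma three_le_degree_of_isCircuit {C : Set (Sym2 V)} (hC : (𝓜).IsCircuit C) {v : V}
    (hv : v ∈ verts C) : 3 ≤ (starAt C v).ncard := by
  by_contra hlt
  have hH : (𝓜).Indep (C \ starAt C v) := by
    refine hC.ssubset_indep ⟨Set.sdiff_subset, fun h => ?_⟩
    obtain ⟨e, he, hve⟩ := hv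
    exact (h he).2 ⟨he, hve⟩
  have hvH : v ∉ verts (C \ starAt C v) := by
    rintro ⟨e, he, hve⟩
    exact he.2 ⟨he.1, hve⟩
  suffices ∃ a b, v ≠ a ∧ v ≠ b ∧ a ≠ b ∧ starAt C v ⊆ {s(v, a), s(v, b)} by
    obtain ⟨a, b, hva, hvb, hab, hs⟩ := this
    refine hC.not_indep ((indep_zero_extension hH hvH hva hvb hab).subset fun e he => ?_)
    by_cases h : e ∈ starAt C v
    · rcases hs h with rfl | rfl <;> simp
    · exact Or.inr (Or.inr ⟨he, h⟩)
  have hcard := four_le_card_of_isCircuit hC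
  have hne : (starAt C v).Nonempty := by
    obtain ⟨e, he, hve⟩ := hv
    exact ⟨e, he, hve⟩
  have hpos : 0 < (starAt C v).ncard := (Set.ncard_pos).2 hne
  have hmk : ∀ e ∈ starAt C v, ∃ a, v ≠ a ∧ e = s(v, a) := by
    intro e he
    obtain ⟨a, rfl⟩ := eq_mk_of_mem he.2
    exact ⟨a, fun h => hC.subset_ground he.1 (by simp [h]), rfl⟩
  rcases (show (starAt C v).ncard = 1 ∨ (starAt C v).ncard = 2 by omega) with h | h
  · obtain ⟨e, he⟩ := Set.ncard_eq_one.1 h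
    obtain ⟨a, hva, rfl⟩ := hmk e (by rw [he]; simp)
    obtain ⟨c, hc⟩ : ∃ c, c ∉ ({v, a} : Finset V) := by
      by_contra! h
      have := Finset.card_le_card (fun x _ => h x : Finset.univ ⊆ ({v, a} : Finset V))
      rw [Finset.card_univ, Finset.card_pair hva] at this
      omega
    simp only [Finset.mem_insert, Finset.mem_singleton, not_or] at hc
    exact ⟨a, c, hva, Ne.symm hc.1, Ne.symm hc.2, by rw [he]; simp⟩
  · obtain ⟨e, f, hef, he⟩ := Set.ncard_eq_two.1 h
    obtain ⟨a, hva, rfl⟩ := hmk e (by rw [he]; simp)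
    obtain ⟨b, hvb, rfl⟩ := hmk f (by rw [he]; simp)
    exact ⟨a, b, hva, hvb, fun h => hef (by rw [h]), he.subset⟩

/-- Double counting of incidences between a vertex set and an edge set. -/
lemma sum_degree_le {F : Set (Sym2 V)} (hF : ∀ e ∈ F, ¬ e.IsDiag) (Z : Finset V) :
    ∑ z ∈ Z, (starAt F z).ncard ≤
      {e ∈ F | ∃ z ∈ Z, z ∈ e}.ncard + (F ∩ edgesOn (Z : Set V)).ncard := by
  classical
  have h1 : ∀ z, (starAt F z).ncard = (F.toFinset.filter (fun e => z ∈ e)).card := by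
    intro z
    rw [Set.ncard_eq_toFinset_card']
    congr 1
    ext e; rw [Set.mem_toFinset]; simp [starAt]
  simp only [h1]
  have h2 := Finset.sum_card_bipartiteAbove_eq_sum_card_bipartiteBelow
    (s := Z) (t := F.toFinset) (fun z e => z ∈ e)
  simp only [Finset.bipartiteAbove, Finset.bipartiteBelow] at h2
  rw [h2]
  have h3 : {e ∈ F | ∃ z ∈ Z, z ∈ e}.ncard
      = ∑ e ∈ F.toFinset, if ∃ z ∈ Z, z ∈ e then 1 else 0 := by
    rw [Set.ncard_eq_toFinset_card', ← Finset.card_filter]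
    congr 1
    ext e; simp
  have h4 : (F ∩ edgesOn (Z : Set V)).ncard
      = ∑ e ∈ F.toFinset, if e ∈ edgesOn (Z : Set V) then 1 else 0 := by
    rw [Set.ncard_eq_toFinset_card', ← Finset.card_filter]
    congr 1
    ext e; simp
  rw [h3, h4, ← Finset.sum_add_distrib]
  refine Finset.sum_le_sum fun e he => ?_
  have hed : ¬ e.IsDiag := hF e (by simpa using he)
  induction e with | _ a b =>
  have hab : a ≠ b := by simpa using hed
  have h5 : Z.filter (fun z => z ∈ s(a, b)) ⊆ {a, b} := by
    intro z hz; simpa using (Finset.mem_filter.1 hz).2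
  by_cases ha : a ∈ Z <;> by_cases hb : b ∈ Z
  · have h6 := Finset.card_le_card h5
    rw [Finset.card_pair hab] at h6
    rw [if_pos ⟨a, ha, by simp⟩, if_pos (mk_mem_edgesOn.2 ⟨hab, ha, hb⟩)]
    exact h6
  · rw [if_pos ⟨a, ha, by simp⟩]
    have : Z.filter (fun z => z ∈ s(a, b)) ⊆ {a} := by
      intro z hz
      have h7 := Finset.mem_filter.1 hz
      rcases Sym2.mem_iff.1 h7.2 with rfl | rfl
      · simp
      · exact absurd h7.1 hb
    have := Finset.card_le_card this
    rw [Finset.card_singleton] at this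
    omega
  · rw [if_pos ⟨b, hb, by simp⟩]
    have : Z.filter (fun z => z ∈ s(a, b)) ⊆ {b} := by
      intro z hz
      have h7 := Finset.mem_filter.1 hz
      rcases Sym2.mem_iff.1 h7.2 with rfl | rfl
      · exact absurd h7.1 ha
      · simp
    have := Finset.card_le_card this
    rw [Finset.card_singleton] at this
    omega
  · have : Z.filter (fun z => z ∈ s(a, b)) = ∅ := by
      rw [Finset.filter_eq_empty_iff]
      intro z hz h
      rcases Sym2.mem_iff.1 h with rfl | rfl
      · exact ha hz
      · exact hb hz
    rw [this]; simp

end Counting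

/-! ### Eliminating a vertex of degree three -/

section Elimination

variable {V : Type*} [DecidableEq V]

/-- The vector with entries `1, -α, -β, -γ` at `v, a, b, c` and zero elsewhere. -/
def starVec (v a b c : V) (α β γ : ℝ) : V → ℝ := fun i =>
  if i = v then 1 else if i = a then -α else if i = b then -β else if i = c then -γ else 0

/-- The three edges joining `v` to `a, b, c`. -/
def claw (v a b c : V) : Set (Sym2 V) := {s(v, a), s(v, b), s(v, c)}

/-- The triangle on `a, b, c`. -/
def tri (a b c : V) : Set (Sym2 V) := {s(a, b), s(b, c), s(a, c)}

section starVec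

variable {v a b c : V} (α β γ : ℝ)

lemma starVec_apply_self : starVec v a b c α β γ v = 1 := by simp [starVec]

lemma starVec_apply_fst (hva : v ≠ a) : starVec v a b c α β γ a = -α := by
  simp [starVec, hva.symm]

lemma starVec_apply_snd (hvb : v ≠ b) (hab : a ≠ b) : starVec v a b c α β γ b = -β := by
  simp [starVec, hvb.symm, hab.symm]

lemma starVec_apply_trd (hvc : v ≠ c) (hac : a ≠ c) (hbc : b ≠ c) :
    starVec v a b c α β γ c = -γ := by
  simp [starVec, hvc.symm, hac.symm, hbc.symm]

lemma starVec_apply_of_ne {i : V} (hv : i ≠ v) (ha : i ≠ a) (hb : i ≠ b) (hc : i ≠ c) :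
    starVec v a b c α β γ i = 0 := by
  simp [starVec, hv, ha, hb, hc]

lemma vecMulVec_starVec_mem :
    vecMulVec (starVec v a b c α β γ) (starVec v a b c α β γ) ∈
      patternSpace (claw v a b c ∪ tri a b c) := by
  refine ⟨fun i j => mul_comm _ _, fun i j hij hF => ?_⟩
  rw [vecMulVec_apply]
  by_contra hne
  have key : ∀ i, starVec v a b c α β γ i ≠ 0 → i = v ∨ i = a ∨ i = b ∨ i = c := by
    intro i hi
    by_contra! h
    exact hi (starVec_apply_of_ne _ _ _ h.1 h.2.1 h.2.2.1 h.2.2.2)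
  apply hF
  simp only [claw, tri, Set.mem_union, Set.mem_insert_iff, Set.mem_singleton_iff, Sym2.eq_iff]
  rcases key i (left_ne_zero_of_mul hne) with h | h | h | h <;>
    rcases key j (right_ne_zero_of_mul hne) with h' | h' | h' | h' <;>
      simp [h, h'] <;> exact (hij (h.trans h'.symm)).elim

variable [Fintype V]

lemma sum_starVec_smul {d : ℕ} (hva : v ≠ a) (hvb : v ≠ b) (hvc : v ≠ c) (hab : a ≠ b)
    (hac : a ≠ c) (hbc : b ≠ c) (p : V → Fin d → ℝ) :
    ∑ j, starVec v a b c α β γ j • p j = p v - (α • p a + β • p b + γ • p c) := by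
  rw [← Finset.sum_subset (Finset.subset_univ {v, a, b, c})]
  · rw [Finset.sum_insert (by simp [hva, hvb, hvc]), Finset.sum_insert (by simp [hab, hac]),
      Finset.sum_pair hbc, starVec_apply_self, starVec_apply_fst _ _ _ hva,
      starVec_apply_snd _ _ _ hvb hab, starVec_apply_trd _ _ _ hvc hac hbc]
    simp only [one_smul, neg_smul]
    abel
  · intro j _ hj
    simp only [Finset.mem_insert, Finset.mem_singleton, not_or] at hj
    rw [starVec_apply_of_ne _ _ _ hj.1 hj.2.1 hj.2.2.1 hj.2.2.2, zero_smul]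

lemma vecMulVec_starVec_mem_stressSpace {d : ℕ} (hva : v ≠ a) (hvb : v ≠ b) (hvc : v ≠ c)
    (hab : a ≠ b) (hac : a ≠ c) (hbc : b ≠ c) {p : V → Fin d → ℝ}
    (hp : p v = α • p a + β • p b + γ • p c) :
    vecMulVec (starVec v a b c α β γ) (starVec v a b c α β γ) ∈
      stressSpace p (claw v a b c ∪ tri a b c) := by
  refine ⟨vecMulVec_starVec_mem _ _ _, fun i => ?_⟩
  have := sum_starVec_smul α β γ hva hvb hvc hab hac hbc p
  rw [hp, sub_self] at this
  simp only [vecMulVec_apply, mul_smul, ← Finset.smul_sum, this, smul_zero]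

end starVec

variable [Fintype V]

lemma row_sum_of_support_three {n : ℕ} {K : Matrix V V ℝ} {p : V → Fin n → ℝ} {v a b c : V}
    (hva : v ≠ a) (hvb : v ≠ b) (hvc : v ≠ c) (hab : a ≠ b) (hac : a ≠ c) (hbc : b ≠ c)
    (h : ∀ j, j ≠ v → j ≠ a → j ≠ b → j ≠ c → K v j = 0) :
    ∑ j, K v j • p j = K v v • p v + K v a • p a + K v b • p b + K v c • p c := by
  rw [← Finset.sum_subset (Finset.subset_univ {v, a, b, c})]
  · rw [Finset.sum_insert (by simp [hva, hvb, hvc]), Finset.sum_insert (by simp [hab, hac]),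
      Finset.sum_pair hbc]
    abel
  · intro j _ hj
    simp only [Finset.mem_insert, Finset.mem_singleton, not_or] at hj
    rw [h j hj.1 hj.2.1 hj.2.2.1 hj.2.2.2, zero_smul]

/-- The data of a degree-three vertex `v` of `F` with neighbours `a, b, c`. -/
structure IsClawAt (F : Set (Sym2 V)) (v a b c : V) : Prop where
  va : v ≠ a
  vb : v ≠ b
  vc : v ≠ c
  ab : a ≠ b
  ac : a ≠ c
  bc : b ≠ c
  star : starAt F v = claw v a b c

namespace IsClawAt

variable {F : Set (Sym2 V)} {v a b c : V}

lemma mem_iff (h : IsClawAt F v a b c) {j : V} : s(v, j) ∈ F ↔ j = a ∨ j = b ∨ j = c := by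
  have : s(v, j) ∈ F ↔ s(v, j) ∈ starAt F v := by simp [starAt]
  rw [this, h.star]
  simp [claw, h.va, h.vb, h.vc]

lemma claw_subset (h : IsClawAt F v a b c) : claw v a b c ⊆ F := by
  rw [← h.star]; exact fun e he => he.1

lemma row_eq_zero (h : IsClawAt F v a b c) {K : Matrix V V ℝ} (hK : K ∈ patternSpace F) {j : V}
    (hv : j ≠ v) (ha : j ≠ a) (hb : j ≠ b) (hc : j ≠ c) : K v j = 0 :=
  hK.2 v j hv.symm (by rw [h.mem_iff]; simp [ha, hb, hc])

lemma sub_mem (h : IsClawAt F v a b c) {p : V → Fin 3 → ℝ}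
    (hind : ∀ x y z : ℝ, x • p a + y • p b + z • p c = 0 → x = 0 ∧ y = 0 ∧ z = 0) {α β γ : ℝ}
    (hp : p v = α • p a + β • p b + γ • p c) {K : Matrix V V ℝ} (hK : K ∈ stressSpace p F) :
    K - K v v • vecMulVec (starVec v a b c α β γ) (starVec v a b c α β γ) ∈
      stressSpace p ((F \ starAt F v) ∪ tri a b c) ∧
    ∀ j, (K - K v v • vecMulVec (starVec v a b c α β γ) (starVec v a b c α β γ)) v j = 0 := by
  have hL := vecMulVec_starVec_mem_stressSpace α β γ h.va h.vb h.vc h.ab h.ac h.bc hp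
  have h1 := hK.2 v
  rw [row_sum_of_support_three h.va h.vb h.vc h.ab h.ac h.bc (fun j => h.row_eq_zero hK.1), hp]
    at h1
  obtain ⟨ha, hb, hc⟩ := hind (K v v * α + K v a) (K v v * β + K v b) (K v v * γ + K v c) (by
    rw [← h1]; module)
  have hrow : ∀ j, (K - K v v • vecMulVec (starVec v a b c α β γ) (starVec v a b c α β γ)) v j
      = 0 := by
    intro j
    simp only [Matrix.sub_apply, Matrix.smul_apply, vecMulVec_apply, starVec_apply_self,
      smul_eq_mul, one_mul]
    by_cases hjv : j = v
    · subst hjv; rw [starVec_apply_self]; ring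
    by_cases hja : j = a
    · subst hja; rw [starVec_apply_fst _ _ _ h.va]; linarith
    by_cases hjb : j = b
    · subst hjb; rw [starVec_apply_snd _ _ _ h.vb h.ab]; linarith
    by_cases hjc : j = c
    · subst hjc; rw [starVec_apply_trd _ _ _ h.vc h.ac h.bc]; linarith
    rw [starVec_apply_of_ne _ _ _ hjv hja hjb hjc, h.row_eq_zero hK.1 hjv hja hjb hjc]; ring
  have hmem : K - K v v • vecMulVec (starVec v a b c α β γ) (starVec v a b c α β γ) ∈
      stressSpace p (F ∪ (claw v a b c ∪ tri a b c)) :=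
    _root_.sub_mem (stressSpace_mono p Set.subset_union_left hK)
      (Submodule.smul_mem _ _ (stressSpace_mono p Set.subset_union_right hL))
  refine ⟨mem_stressSpace_of_eq_zero hmem fun i j hij hm hn => ?_, hrow⟩
  have hvm : v ∈ s(i, j) := by
    rcases hm with hm | hm | hm
    · by_contra hv
      exact hn (Or.inl ⟨hm, fun h => hv h.2⟩)
    · rw [← h.star] at hm; exact hm.2
    · exact (hn (Or.inr hm)).elim
  rcases Sym2.mem_iff.1 hvm with rfl | rfl
  · exact hrow j
  · rw [hmem.1.1]; exact hrow i

end IsClawAt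

lemma mem_stressSpace_congr {d : ℕ} {p q : V → Fin d → ℝ} {v : V} (hpq : ∀ i, i ≠ v → p i = q i)
    {F : Set (Sym2 V)} {K : Matrix V V ℝ} (hv : ∀ i, K i v = 0) (hK : K ∈ stressSpace p F) :
    K ∈ stressSpace q F := by
  refine ⟨hK.1, fun i => ?_⟩
  rw [← hK.2 i]
  refine Finset.sum_congr rfl fun j _ => ?_
  by_cases hj : j = v
  · subst hj; rw [hv, zero_smul, zero_smul]
  · rw [hpq j hj]

end Elimination

section Circuits

variable {V : Type*} [Fintype V] [DecidableEq V]

local notation "𝓜" => rigidityMatroid V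

lemma notMem_starAt_sdiff {F : Set (Sym2 V)} {v : V} : v ∉ verts (F \ starAt F v) := by
  rintro ⟨e, he, hve⟩
  exact he.2 ⟨he.1, hve⟩

/-- Splitting an edge `ab` by a new vertex joined to a third vertex preserves independence. -/
lemma indep_one_extension {F : Set (Sym2 V)} {v a b c : V} (h : IsClawAt F v a b c)
    (hI : (𝓜).Indep (insert s(a, b) (F \ starAt F v))) (hab : s(a, b) ∉ F) : (𝓜).Indep F := by
  obtain ⟨p, hp⟩ := exists_isGeneric (V := V)
  have hd : ∀ e ∈ F, ¬ e.IsDiag := by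
    intro e he
    by_cases hs : e ∈ starAt F v
    · rw [h.star] at hs
      rcases hs with rfl | rfl | rfl
      · simpa using h.va
      · simpa using h.vb
      · simpa using h.vc
    · exact hI.1 e (Or.inr ⟨he, hs⟩)
  let q : V → Fin 3 → ℝ := Function.update p v (p a + p b)
  have hqp : ∀ i, i ≠ v → q i = p i := fun i hi => Function.update_of_ne hi _ _
  refine ⟨hd, q, (Submodule.eq_bot_iff _).2 fun K hK => ?_⟩
  have hqv : q v = (1 : ℝ) • q a + (1 : ℝ) • q b + (0 : ℝ) • q c := by
    simp [q, Function.update_of_ne h.va.symm, Function.update_of_ne h.vb.symm]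
  obtain ⟨h1, h2⟩ := h.sub_mem (p := q) (by
    rw [hqp _ h.va.symm, hqp _ h.vb.symm, hqp _ h.vc.symm]
    exact hp.1 a b c h.ab h.ac h.bc) hqv hK
  set K' := K - K v v • vecMulVec (starVec v a b c 1 1 0) (starVec v a b c 1 1 0) with hK'
  have habv : K' a b = - K v v := by
    rw [hK']
    simp only [Matrix.sub_apply, Matrix.smul_apply, vecMulVec_apply, starVec_apply_fst _ _ _ h.va,
      starVec_apply_snd _ _ _ h.vb h.ab, hK.1.2 a b h.ab hab]
    simp
  have h3 : K' ∈ stressSpace q (insert s(a, b) (F \ starAt F v)) := by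
    refine mem_stressSpace_of_eq_zero h1 fun i j hij hm hn => ?_
    simp only [Set.mem_insert_iff, not_or] at hn
    have h4 : K i j = 0 := by
      by_cases hF : s(i, j) ∈ F
      · rcases hm with hm | hm
        · exact (hn.2 hm).elim
        · exfalso
          apply hn.2
          refine ⟨hF, fun hs => ?_⟩
          have := hs.2
          rcases hm with hm | hm | hm <;> rw [hm] at this <;>
            simp [h.va, h.vb, h.vc] at this
      · exact hK.1.2 i j hij hF
    have h5 : starVec v a b c 1 1 0 i * starVec v a b c 1 1 0 j = 0 := by
      have hc := starVec_apply_trd (1 : ℝ) 1 0 h.vc h.ac h.bc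
      rcases hm with hm | hm | hm | hm
      · exact (hn.2 hm).elim
      · exact (hn.1 hm).elim
      · rcases Sym2.eq_iff.1 hm with ⟨rfl, rfl⟩ | ⟨rfl, rfl⟩ <;> simp [hc]
      · rcases Sym2.eq_iff.1 hm with ⟨rfl, rfl⟩ | ⟨rfl, rfl⟩ <;> simp [hc]
    simp [hK', h4, vecMulVec_apply, h5]
  have h4 : K' ∈ stressSpace p (insert s(a, b) (F \ starAt F v)) :=
    mem_stressSpace_congr hqp (fun i => by rw [h3.1.1 v i]; exact h2 i) h3
  rw [hp.2 _ hI.2, Submodule.mem_bot] at h4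
  have h5 : K v v = 0 := by
    rw [h4] at habv; simpa using habv.symm
  rw [hK', h5, zero_smul, sub_zero] at h4
  exact h4

lemma IsClawAt.rotate {F : Set (Sym2 V)} {v a b c : V} (h : IsClawAt F v a b c) :
    IsClawAt F v b c a :=
  ⟨h.vb, h.vc, h.va, h.bc, h.ab.symm, h.ac.symm, h.star.trans (by
    ext e; simp only [claw, Set.mem_insert_iff, Set.mem_singleton_iff]; tauto)⟩

lemma exists_isClawAt {F : Set (Sym2 V)} (hF : ∀ e ∈ F, ¬ e.IsDiag) {v : V}
    (h : (starAt F v).ncard = 3) : ∃ a b c, IsClawAt F v a b c := by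
  obtain ⟨e, f, g, hef, heg, hfg, hs⟩ := Set.ncard_eq_three.1 h
  have hmk : ∀ e ∈ starAt F v, ∃ a, v ≠ a ∧ e = s(v, a) := by
    intro e he
    obtain ⟨a, rfl⟩ := eq_mk_of_mem he.2
    exact ⟨a, fun h => hF _ he.1 (by simp [h]), rfl⟩
  obtain ⟨a, hva, rfl⟩ := hmk e (by rw [hs]; simp)
  obtain ⟨b, hvb, rfl⟩ := hmk f (by rw [hs]; simp)
  obtain ⟨c, hvc, rfl⟩ := hmk g (by rw [hs]; simp)
  exact ⟨a, b, c, hva, hvb, hvc, fun h => hef (by rw [h]), fun h => heg (by rw [h]),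
    fun h => hfg (by rw [h]), hs⟩

lemma IsClawAt.ncard {F : Set (Sym2 V)} {v a b c : V} (h : IsClawAt F v a b c) :
    (starAt F v).ncard = 3 := by
  rw [h.star]
  exact Set.ncard_eq_three.2 ⟨_, _, _, by simp [h.ab, h.va.symm], by simp [h.ac, h.va.symm],
    by simp [h.bc, h.vb.symm], rfl⟩

/-- The neighbours of a degree-three vertex of a circuit are pairwise linked by the rest. -/
lemma mem_closure_of_claw {C : Set (Sym2 V)} (hC : (𝓜).IsCircuit C) {v a b c : V}
    (h : IsClawAt C v a b c) : s(a, b) ∈ (𝓜).closure (C \ starAt C v) := by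
  by_cases hab : s(a, b) ∈ C
  · exact (𝓜).mem_closure_of_mem ⟨hab, fun hs => by
      simpa [h.va, h.vb] using hs.2⟩ (Set.sdiff_subset.trans hC.subset_ground)
  · by_contra hcl
    have hH : (𝓜).Indep (C \ starAt C v) := hC.ssubset_indep ⟨Set.sdiff_subset, fun hs =>
      (hs (h.claw_subset (Or.inl rfl))).2 ⟨h.claw_subset (Or.inl rfl), by simp⟩⟩
    have hI := ((hH.notMem_closure_iff (show s(a, b) ∈ (𝓜).E from by
      simpa [rigidityMatroid_ground] using h.ab)).1 hcl).1
    exact hC.not_indep (indep_one_extension h hI hab)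

lemma exists_degree_three {C : Set (Sym2 V)} (hC : (𝓜).IsCircuit C) :
    ∃ v, (starAt C v).ncard = 3 := by
  classical
  by_contra! hne
  obtain ⟨e, he⟩ := hC.nonempty
  have h1 := hC.sdiff_singleton_indep he
  have hd := hC.subset_ground
  have hV : 2 ≤ (verts C).ncard := by
    induction e with | _ a b =>
    exact (Set.one_lt_ncard (Set.toFinite _)).2 ⟨a, left_mem_verts he, b, right_mem_verts he,
      fun h => hd he (by simp [h])⟩
  have h2 := ncard_add_three_le h1 (Set.sdiff_subset.trans (subset_edgesOn_verts hd)) hV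
  have h3 := sum_degree_le hd (verts C).toFinset
  have h4 : ∀ z ∈ (verts C).toFinset, 4 ≤ (starAt C z).ncard := fun z hz => by
    have := three_le_degree_of_isCircuit hC (Set.mem_toFinset.1 hz)
    have := hne z
    omega
  have h5 := Finset.card_nsmul_le_sum _ _ _ h4
  have h6 : {e ∈ C | ∃ z ∈ (verts C).toFinset, z ∈ e}.ncard ≤ C.ncard :=
    Set.ncard_le_ncard (fun e he => he.1)
  have h7 : (C ∩ edgesOn ((verts C).toFinset : Set V)).ncard ≤ C.ncard :=
    Set.ncard_le_ncard Set.inter_subset_left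
  have h8 : (C \ {e}).ncard + 1 = C.ncard := Set.ncard_sdiff_singleton_add_one he
  rw [← Set.ncard_eq_toFinset_card', smul_eq_mul] at h5
  omega

end Circuits

/-! ### Circuits are rigid -/

section RigidCircuits

variable {V : Type*} [Fintype V] [DecidableEq V]

local notation "𝓜" => rigidityMatroid V

lemma verts_insert {F : Set (Sym2 V)} {a b : V} : verts (insert s(a, b) F) = {a, b} ∪ verts F := by
  ext x
  simp [verts, or_assoc]

lemma edgesOn_triple {a b c : V} {F : Set (Sym2 V)} (h1 : s(a, b) ∈ F) (h2 : s(b, c) ∈ F)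
    (h3 : s(a, c) ∈ F) : edgesOn {a, b, c} ⊆ F := by
  intro e he
  induction e with | _ u w =>
  rw [mk_mem_edgesOn] at he
  simp only [Set.mem_insert_iff, Set.mem_singleton_iff] at he
  obtain ⟨h, rfl | rfl | rfl, rfl | rfl | rfl⟩ := he
  all_goals first | exact absurd rfl h | assumption | (rw [Sym2.eq_swap]; assumption)

lemma edgesOn_subset_closure_of_isCircuit_of_ncard {C : Set (Sym2 V)} (hC : (𝓜).IsCircuit C)
    (h : C.ncard + 2 = 2 * (verts C).ncard) : edgesOn (verts C) ⊆ (𝓜).closure C := by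
  obtain ⟨e, he⟩ := hC.nonempty
  have h1 : (C \ {e}).ncard + 1 = C.ncard := Set.ncard_sdiff_singleton_add_one he
  refine (edgesOn_subset_closure_of_ncard (hC.sdiff_singleton_indep he)
    (Set.sdiff_subset.trans (subset_edgesOn_verts hC.subset_ground)) (by omega) (by omega)).trans ?_
  exact (𝓜).closure_subset_closure Set.sdiff_subset

theorem ncard_of_isCircuit {C : Set (Sym2 V)} (hC : (𝓜).IsCircuit C) :
    C.ncard + 2 = 2 * (verts C).ncard := by
  induction hn : (verts C).ncard using Nat.strong_induction_on generalizing C with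
  | _ n ih =>
  obtain ⟨v, hv⟩ := exists_degree_three hC
  obtain ⟨a, b, c, h⟩ := exists_isClawAt hC.subset_ground hv
  have hHs : C \ starAt C v ⊂ C := ⟨Set.sdiff_subset, fun hs =>
      (hs (h.claw_subset (Or.inl rfl))).2 ⟨h.claw_subset (Or.inl rfl), by simp⟩⟩
  have hH := hC.ssubset_indep hHs
  have hvC : v ∈ verts C := ⟨_, h.claw_subset (Or.inl rfl), by simp⟩
  have key : ∀ a b c, IsClawAt C v a b c → ∃ Y ⊆ verts C \ {v}, a ∈ Y ∧ b ∈ Y ∧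
      edgesOn Y ⊆ (𝓜).closure ((C \ starAt C v) ∩ edgesOn Y) := by
    intro a b c h
    have haC : a ∈ verts C := ⟨s(v, a), h.claw_subset (Or.inl rfl), by simp⟩
    have hbC : b ∈ verts C := ⟨s(v, b), h.claw_subset (Or.inr (Or.inl rfl)), by simp⟩
    by_cases hab : s(a, b) ∈ C \ starAt C v
    · refine ⟨{a, b}, ?_, by simp, by simp, ?_⟩
      · rintro x (rfl | rfl)
        · exact ⟨haC, h.va.symm⟩
        · exact ⟨hbC, h.vb.symm⟩
      · rw [edgesOn_pair h.ab, Set.singleton_subset_iff]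
        exact (𝓜).mem_closure_of_mem ⟨hab, rfl⟩
          (Set.inter_subset_left.trans (Set.sdiff_subset.trans hC.subset_ground))
    · obtain ⟨D, hDs, hD, hDe⟩ := Matroid.exists_isCircuit_of_mem_closure
        (mem_closure_of_claw hC h) hab
      have hsub : verts D ⊆ verts C \ {v} := by
        intro x hx
        have := verts_mono hDs hx
        rw [verts_insert] at this
        rcases this with (rfl | rfl) | hx
        · exact ⟨haC, h.va.symm⟩
        · exact ⟨hbC, h.vb.symm⟩
        · refine ⟨verts_mono Set.sdiff_subset hx, ?_⟩
          rintro rfl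
          exact notMem_starAt_sdiff hx
      refine ⟨verts D, hsub, left_mem_verts hDe, right_mem_verts hDe, ?_⟩
      have hlt : (verts D).ncard < n := by
        rw [← hn]
        exact Set.ncard_lt_ncard ⟨hsub.trans Set.sdiff_subset, fun h' => (hsub (h' hvC)).2 rfl⟩
      refine (edgesOn_subset_closure_of_isCircuit_of_ncard hD (ih _ hlt hD rfl)).trans ?_
      rw [← hD.closure_sdiff_singleton_eq s(a, b)]
      refine (𝓜).closure_subset_closure fun e he => ?_
      refine ⟨?_, subset_edgesOn_verts hD.subset_ground he.1⟩
      rcases hDs he.1 with h' | h'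
      · exact (he.2 h').elim
      · exact h'
  obtain ⟨Y₁, hs₁, ha₁, hb₁, hY₁⟩ := key a b c h
  obtain ⟨Y₂, hs₂, hb₂, hc₂, hY₂⟩ := key b c a h.rotate
  obtain ⟨Y₃, hs₃, hc₃, ha₃, hY₃⟩ := key c a b h.rotate.rotate
  set Y := Y₁ ∪ Y₂ ∪ Y₃ with hY
  set H := (C \ starAt C v) ∩ edgesOn Y with hHdef
  have hmono : ∀ Z ⊆ Y, edgesOn Z ⊆ (𝓜).closure ((C \ starAt C v) ∩ edgesOn Z) →
      edgesOn Z ⊆ (𝓜).closure H := fun Z hZ h' => h'.trans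
    ((𝓜).closure_subset_closure (Set.inter_subset_inter_right _ (edgesOn_mono hZ)))
  have h1 := hmono Y₁ (by rw [hY]; intro x hx; exact Or.inl (Or.inl hx)) hY₁
  have h2 := hmono Y₂ (by rw [hY]; intro x hx; exact Or.inl (Or.inr hx)) hY₂
  have h3 := hmono Y₃ (by rw [hY]; intro x hx; exact Or.inr hx) hY₃
  have h0 : edgesOn {a, b, c} ⊆ (𝓜).closure H := edgesOn_triple
    (h1 (mk_mem_edgesOn.2 ⟨h.ab, ha₁, hb₁⟩)) (h2 (mk_mem_edgesOn.2 ⟨h.bc, hb₂, hc₂⟩))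
    (h3 (mk_mem_edgesOn.2 ⟨h.ac, ha₃, hc₃⟩))
  have h4 := edgesOn_union_subset_closure h0 h1 h.ab (by simp) ha₁ (by simp) hb₁
  have h5 := edgesOn_union_subset_closure h4 h2 h.bc (by simp) hb₂ (by simp) hc₂
  have h6 := edgesOn_union_subset_closure h5 h3 h.ac (by simp) ha₃ (by simp) hc₃
  have hrigid : edgesOn Y ⊆ (𝓜).closure H := (edgesOn_mono (by
    rw [hY]
    rintro x ((hx | hx) | hx) <;> simp [hx])).trans h6
  have hYC : Y ⊆ verts C \ {v} := Set.union_subset (Set.union_subset hs₁ hs₂) hs₃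
  have hvY : v ∉ Y := fun hv => (hYC hv).2 rfl
  have hHi : (𝓜).Indep H := hH.subset Set.inter_subset_left
  have hY2 : 2 ≤ Y.ncard := (Set.one_lt_ncard (Set.toFinite Y)).2
    ⟨a, Or.inl (Or.inl ha₁), b, Or.inl (Or.inl hb₁), h.ab⟩
  have hcount := isBasis_ncard hHi.isBasis_self Set.inter_subset_right hY2 hrigid
  have hdisj : Disjoint H (starAt C v) := Set.disjoint_left.2 fun e he hs => he.1.2 hs
  have hcard : (H ∪ starAt C v).ncard = 2 * Y.ncard := by
    rw [Set.ncard_union_eq hdisj, hv]; omega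
  have hsubE : H ∪ starAt C v ⊆ edgesOn (insert v Y) := by
    refine Set.union_subset (Set.inter_subset_right.trans (edgesOn_mono (Set.subset_insert _ _))) ?_
    rw [h.star]
    rintro e (rfl | rfl | rfl) <;> rw [mk_mem_edgesOn]
    · exact ⟨h.va, Set.mem_insert _ _, Or.inr (Or.inl (Or.inl ha₁))⟩
    · exact ⟨h.vb, Set.mem_insert _ _, Or.inr (Or.inl (Or.inl hb₁))⟩
    · exact ⟨h.vc, Set.mem_insert _ _, Or.inr (Or.inl (Or.inr hc₂))⟩
  have hYv : (insert v Y).ncard = Y.ncard + 1 := Set.ncard_insert_of_notMem hvY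
  have heq : H ∪ starAt C v = C := by
    refine hC.eq_of_not_indep_subset (fun hi => ?_) (Set.union_subset
      (Set.inter_subset_left.trans Set.sdiff_subset) fun e he => he.1)
    have := ncard_add_three_le hi hsubE (by omega)
    omega
  have hVC : verts C = insert v Y := by
    refine Set.Subset.antisymm (verts_subset (heq ▸ hsubE)) ?_
    exact Set.insert_subset hvC (hYC.trans Set.sdiff_subset)
  rw [heq] at hcard
  rw [← hn, hVC]
  omega

theorem edgesOn_subset_closure_of_isCircuit {C : Set (Sym2 V)} (hC : (𝓜).IsCircuit C) :
    edgesOn (verts C) ⊆ (𝓜).closure C :=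
  edgesOn_subset_closure_of_isCircuit_of_ncard hC (ncard_of_isCircuit hC)

lemma dep_of_ncard {F : Set (Sym2 V)} {X : Set V} (hF : F ⊆ edgesOn X)
    (hX : 2 ≤ X.ncard) (h : 2 * X.ncard ≤ F.ncard + 2) : (𝓜).Dep F := by
  refine ⟨fun hi => ?_, hF.trans (edgesOn_subset_ground X)⟩
  have := ncard_add_three_le hi hF hX
  omega

lemma two_le_ncard_verts {F : Set (Sym2 V)} (hF : ∀ e ∈ F, ¬ e.IsDiag) (hne : F.Nonempty) :
    2 ≤ (verts F).ncard := by
  obtain ⟨e, he⟩ := hne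
  induction e with | _ a b =>
  exact (Set.one_lt_ncard (Set.toFinite _)).2 ⟨a, left_mem_verts he, b, right_mem_verts he,
    fun h => hF _ he (by simp [h])⟩

/-! ### Separations of circuits -/

/-- The edges of `F` with an end in `Z`. -/
def incident (F : Set (Sym2 V)) (Z : Set V) : Set (Sym2 V) := {e ∈ F | ∃ z ∈ Z, z ∈ e}

lemma incident_subset (F : Set (Sym2 V)) (Z : Set V) : incident F Z ⊆ F := fun _ he => he.1

/-- `F` lies on `Z ∪ S ∪ W` and has no edge between `Z` and `W`. -/
structure Separates (F : Set (Sym2 V)) (Z S W : Set V) : Prop where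
  subset : F ⊆ edgesOn (Z ∪ S ∪ W)
  disj_ZS : Disjoint Z S
  disj_WS : Disjoint W S
  disj : Disjoint Z W
  notMem : ∀ z ∈ Z, ∀ w ∈ W, s(z, w) ∉ F

lemma Separates.symm {F : Set (Sym2 V)} {Z S W : Set V} (h : Separates F Z S W) :
    Separates F W S Z :=
  ⟨h.subset.trans (edgesOn_mono (by rintro x ((h | h) | h) <;> simp [h])), h.disj_WS, h.disj_ZS,
    h.disj.symm, fun w hw z hz => by rw [Sym2.eq_swap]; exact h.notMem z hz w hw⟩

lemma Separates.mono {F F' : Set (Sym2 V)} {Z S W : Set V} (h : Separates F Z S W)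
    (hF : F' ⊆ F) : Separates F' Z S W :=
  ⟨hF.trans h.subset, h.disj_ZS, h.disj_WS, h.disj, fun z hz w hw h' => h.notMem z hz w hw (hF h')⟩

lemma Separates.incident_subset {F : Set (Sym2 V)} {Z S W : Set V} (h : Separates F Z S W) :
    incident F Z ⊆ edgesOn (Z ∪ S) := by
  rintro e ⟨he, z, hz, hze⟩
  obtain ⟨u, rfl⟩ := eq_mk_of_mem hze
  have := h.subset he
  rw [mk_mem_edgesOn] at this ⊢
  refine ⟨this.1, Or.inl hz, ?_⟩
  rcases this.2.2 with hu | hu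
  · exact hu
  · exact (h.notMem z hz u hu he).elim

lemma Separates.eq_union {F : Set (Sym2 V)} {Z S W : Set V} (h : Separates F Z S W) :
    F = incident F Z ∪ (incident F W ∪ (F ∩ edgesOn S)) := by
  ext e
  constructor
  · intro he
    by_cases h1 : e ∈ incident F Z
    · exact Or.inl h1
    by_cases h2 : e ∈ incident F W
    · exact Or.inr (Or.inl h2)
    refine Or.inr (Or.inr ⟨he, (h.subset he).1, fun x hx => ?_⟩)
    rcases (h.subset he).2 x hx with (h' | h') | h'
    · exact (h1 ⟨he, x, h', hx⟩).elim
    · exact h'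
    · exact (h2 ⟨he, x, h', hx⟩).elim
  · rintro (he | he | he) <;> exact he.1

lemma Separates.disjoint_incident {F : Set (Sym2 V)} {Z S W : Set V} (h : Separates F Z S W) :
    Disjoint (incident F Z) (incident F W) := by
  refine Set.disjoint_left.2 fun e he hw => ?_
  obtain ⟨-, w, hw, hwe⟩ := hw
  rcases (h.incident_subset he).2 w hwe with h' | h'
  · exact Set.disjoint_left.1 h.disj h' hw
  · exact Set.disjoint_left.1 h.disj_WS hw h'

end RigidCircuits

/-! ### Two-sums of circuits -/

section TwoSum

variable {V : Type*} [Fintype V] [DecidableEq V]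

local notation "𝓜" => rigidityMatroid V

lemma ncard_of_separates {C : Set (Sym2 V)} (hC : (𝓜).IsCircuit C) {Z S W : Set V}
    (h : Separates C Z S W) (hS : S.ncard ≤ 2) (hZ : (incident C Z).Nonempty)
    (hW : (incident C W).Nonempty) :
    S ⊆ verts C ∧ S.ncard = 2 ∧ C ∩ edgesOn S = ∅ ∧
      (incident C Z).ncard + 3 = 2 * ((Z ∩ verts C) ∪ S).ncard := by
  have aux : ∀ {Z W : Set V}, Separates C Z S W → (incident C Z).Nonempty →
      (incident C W).Nonempty → (incident C Z).ncard + (C ∩ edgesOn S).ncard + 3 ≤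
        2 * (Z ∩ verts C).ncard + 2 * (S ∩ verts C).ncard := by
    intro Z W h hZ hW
    have hdis : Disjoint (incident C Z) (C ∩ edgesOn S) := Set.disjoint_left.2 fun e he hs => by
      obtain ⟨-, z, hz, hze⟩ := he
      exact Set.disjoint_left.1 h.disj_ZS hz (hs.2.2 z hze)
    have hdis' : Disjoint (incident C W) (C ∩ edgesOn S) := Set.disjoint_left.2 fun e he hs => by
      obtain ⟨-, z, hz, hze⟩ := he
      exact Set.disjoint_left.1 h.disj_WS hz (hs.2.2 z hze)
    have hsub : incident C Z ∪ (C ∩ edgesOn S) ⊆ C :=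
      Set.union_subset (incident_subset _ _) Set.inter_subset_left
    have hi : (𝓜).Indep (incident C Z ∪ (C ∩ edgesOn S)) := by
      refine hC.ssubset_indep ⟨hsub, fun h' => ?_⟩
      obtain ⟨e, he⟩ := hW
      rcases h' he.1 with h'' | h''
      · exact Set.disjoint_left.1 h.disjoint_incident h'' he
      · exact Set.disjoint_left.1 hdis' he h''
    have hon : incident C Z ∪ (C ∩ edgesOn S) ⊆ edgesOn ((Z ∩ verts C) ∪ (S ∩ verts C)) := by
      intro e he
      refine ⟨hC.subset_ground (hsub he), fun x hx => ?_⟩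
      have hxC : x ∈ verts C := ⟨e, hsub he, hx⟩
      rcases he with he | he
      · exact ((h.incident_subset he).2 x hx).imp (fun h => ⟨h, hxC⟩) (fun h => ⟨h, hxC⟩)
      · exact Or.inr ⟨he.2.2 x hx, hxC⟩
    have hcard : ((Z ∩ verts C) ∪ (S ∩ verts C)).ncard
        = (Z ∩ verts C).ncard + (S ∩ verts C).ncard :=
      Set.ncard_union_eq (h.disj_ZS.mono Set.inter_subset_left Set.inter_subset_left)
    have h2 : 2 ≤ ((Z ∩ verts C) ∪ (S ∩ verts C)).ncard :=
      (two_le_ncard_verts hi.1 (hZ.mono Set.subset_union_left)).trans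
        (Set.ncard_le_ncard (verts_subset hon))
    have := ncard_add_three_le hi hon h2
    rw [Set.ncard_union_eq hdis] at this
    omega
  have h1 := aux h hZ hW
  have h2 := aux h.symm hW hZ
  have h3 := ncard_of_isCircuit hC
  have h4 : C.ncard ≤ (incident C Z).ncard + ((incident C W).ncard + (C ∩ edgesOn S).ncard) := by
    conv_lhs => rw [h.eq_union]
    exact (Set.ncard_union_le _ _).trans (Nat.add_le_add_left (Set.ncard_union_le _ _) _)
  have h5 : (verts C).ncard = (Z ∩ verts C).ncard + (S ∩ verts C).ncard + (W ∩ verts C).ncard := by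
    rw [← Set.ncard_union_eq (h.disj_ZS.mono Set.inter_subset_left Set.inter_subset_left),
      ← Set.ncard_union_eq, ← Set.union_inter_distrib_right, ← Set.union_inter_distrib_right,
      Set.inter_eq_right.2 (verts_subset h.subset)]
    refine Set.disjoint_union_left.2 ⟨h.disj.mono Set.inter_subset_left Set.inter_subset_left,
      h.disj_WS.symm.mono Set.inter_subset_left Set.inter_subset_left⟩
  have h6 : (S ∩ verts C).ncard ≤ S.ncard := Set.ncard_le_ncard Set.inter_subset_left
  have h7 : S ∩ verts C = S := Set.eq_of_subset_of_ncard_le Set.inter_subset_left (by omega)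
  rw [h7] at h1 h2 h5
  refine ⟨Set.inter_eq_left.1 h7, by omega, (Set.ncard_eq_zero).1 (by omega), ?_⟩
  rw [Set.ncard_union_eq (h.disj_ZS.mono_left Set.inter_subset_left)]
  omega

lemma dep_two_sum {C₁ C₂ : Set (Sym2 V)} (h₁ : (𝓜).IsCircuit C₁) (h₂ : (𝓜).IsCircuit C₂) {x y : V}
    (hx₁ : s(x, y) ∈ C₁) (hx₂ : s(x, y) ∈ C₂) (hV : verts C₁ ∩ verts C₂ ⊆ {x, y}) :
    (𝓜).Dep (C₁ \ {s(x, y)} ∪ C₂ \ {s(x, y)}) := by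
  have hxy : x ≠ y := fun h => h₁.subset_ground hx₁ (by simp [h])
  have n₁ := ncard_of_isCircuit h₁
  have n₂ := ncard_of_isCircuit h₂
  have hV' : verts C₁ ∩ verts C₂ = {x, y} := by
    refine hV.antisymm ?_
    rintro u (rfl | rfl)
    · exact ⟨left_mem_verts hx₁, left_mem_verts hx₂⟩
    · exact ⟨right_mem_verts hx₁, right_mem_verts hx₂⟩
  have hu := Set.ncard_union_add_ncard_inter (verts C₁) (verts C₂)
  rw [hV', Set.ncard_pair hxy] at hu
  have s₁ : (C₁ \ {s(x, y)}).ncard + 1 = C₁.ncard := Set.ncard_sdiff_singleton_add_one hx₁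
  have s₂ : (C₂ \ {s(x, y)}).ncard + 1 = C₂.ncard := Set.ncard_sdiff_singleton_add_one hx₂
  have e₁ := subset_edgesOn_verts h₁.subset_ground
  have e₂ := subset_edgesOn_verts h₂.subset_ground
  have hdis : Disjoint (C₁ \ {s(x, y)}) (C₂ \ {s(x, y)}) := Set.disjoint_left.2 fun e he he' => by
    apply he.2
    rw [← edgesOn_pair hxy]
    exact ⟨h₁.subset_ground he.1, fun v hv => hV ⟨⟨e, he.1, hv⟩, ⟨e, he'.1, hv⟩⟩⟩
  have t₁ := two_le_ncard_verts h₁.subset_ground h₁.nonempty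
  have t₂ := two_le_ncard_verts h₂.subset_ground h₂.nonempty
  refine dep_of_ncard (X := verts C₁ ∪ verts C₂) ?_ (by omega) ?_
  · exact Set.union_subset (Set.sdiff_subset.trans (e₁.trans (edgesOn_mono Set.subset_union_left)))
      (Set.sdiff_subset.trans (e₂.trans (edgesOn_mono Set.subset_union_right)))
  · rw [Set.ncard_union_eq hdis]; omega

/-- A side of a two-separation of a circuit, completed by the virtual edge, is a circuit. -/
theorem isCircuit_side {C : Set (Sym2 V)} (hC : (𝓜).IsCircuit C) {Z W : Set V} {x y : V}
    (hxy : x ≠ y) (h : Separates C Z {x, y} W) (hZ : (incident C Z).Nonempty)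
    (hW : (incident C W).Nonempty) :
    s(x, y) ∉ C ∧ (𝓜).IsCircuit (insert s(x, y) (incident C Z)) := by
  have key : ∀ {Z W : Set V}, Separates C Z {x, y} W → (incident C Z).Nonempty →
      (incident C W).Nonempty → s(x, y) ∉ C ∧ ∃ D, (𝓜).IsCircuit D ∧ s(x, y) ∈ D ∧
        D ⊆ insert s(x, y) (incident C Z) := by
    intro Z W h hZ hW
    obtain ⟨h1, h2, h3, h4⟩ := ncard_of_separates hC h (Set.ncard_pair hxy).le hZ hW
    rw [edgesOn_pair hxy] at h3
    have hn : s(x, y) ∉ C := fun h' => by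
      have : s(x, y) ∈ C ∩ {s(x, y)} := ⟨h', rfl⟩
      rw [h3] at this; exact this
    have hi : (𝓜).Indep (incident C Z) := hC.ssubset_indep ⟨incident_subset _ _, fun h' => by
      obtain ⟨e, he⟩ := hW
      exact Set.disjoint_left.1 h.disjoint_incident (h' he.1) he⟩
    have hon : incident C Z ⊆ edgesOn ((Z ∩ verts C) ∪ {x, y}) := fun e he =>
      ⟨hC.subset_ground he.1, fun v hv => ((h.incident_subset he).2 v hv).imp
        (fun h => ⟨h, ⟨e, he.1, hv⟩⟩) id⟩
    have hcl := edgesOn_subset_closure_of_ncard hi hon ((two_le_ncard_verts hi.1 hZ).trans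
        (Set.ncard_le_ncard (verts_subset hon))) h4.ge (mk_mem_edgesOn.2
          ⟨hxy, Or.inr (by simp), Or.inr (by simp)⟩)
    obtain ⟨D, hD1, hD2, hD3⟩ := Matroid.exists_isCircuit_of_mem_closure hcl (fun h' => hn h'.1)
    exact ⟨hn, D, hD2, hD3, hD1⟩
  obtain ⟨hn, D₁, hD₁, hm₁, hs₁⟩ := key h hZ hW
  obtain ⟨-, D₂, hD₂, hm₂, hs₂⟩ := key h.symm hW hZ
  have hv₁ : verts D₁ ⊆ Z ∪ {x, y} := verts_subset (hs₁.trans (Set.insert_subset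
    (mk_mem_edgesOn.2 ⟨hxy, by simp, by simp⟩) h.incident_subset))
  have hv₂ : verts D₂ ⊆ W ∪ {x, y} := verts_subset (hs₂.trans (Set.insert_subset
    (mk_mem_edgesOn.2 ⟨hxy, by simp, by simp⟩) h.symm.incident_subset))
  have hdep := dep_two_sum hD₁ hD₂ hm₁ hm₂ (fun u hu => by
    rcases hv₁ hu.1 with h1 | h1
    · rcases hv₂ hu.2 with h2 | h2
      · exact (Set.disjoint_left.1 h.disj h1 h2).elim
      · exact h2
    · exact h1)
  have e₁ : D₁ \ {s(x, y)} ⊆ incident C Z := fun e he => (hs₁ he.1).resolve_left he.2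
  have e₂ : D₂ \ {s(x, y)} ⊆ incident C W := fun e he => (hs₂ he.1).resolve_left he.2
  have heq := hC.eq_of_dep_subset hdep (Set.union_subset (e₁.trans (incident_subset _ _))
    (e₂.trans (incident_subset _ _)))
  refine ⟨hn, ?_⟩
  have : insert s(x, y) (incident C Z) = D₁ := by
    refine Set.Subset.antisymm (Set.insert_subset hm₁ fun e he => ?_) hs₁
    have h1 := he.1
    rw [← heq] at h1
    rcases h1 with h1 | h1
    · exact h1.1
    · exact (Set.disjoint_left.1 h.disjoint_incident he (e₂ h1)).elim
  rw [this]; exact hD₁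

/-- Two-sums of circuits along a common edge are circuits. -/
theorem isCircuit_two_sum {C₁ C₂ : Set (Sym2 V)} (h₁ : (𝓜).IsCircuit C₁)
    (h₂ : (𝓜).IsCircuit C₂) {x y : V} (hx₁ : s(x, y) ∈ C₁) (hx₂ : s(x, y) ∈ C₂)
    (hV : verts C₁ ∩ verts C₂ ⊆ {x, y}) :
    (𝓜).IsCircuit (C₁ \ {s(x, y)} ∪ C₂ \ {s(x, y)}) := by
  have hxy : x ≠ y := fun h => h₁.subset_ground hx₁ (by simp [h])
  obtain ⟨D, hDE, hD⟩ := (dep_two_sum h₁ h₂ hx₁ hx₂ hV).exists_isCircuit_subset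
  have hE : ∀ {C₁ C₂ : Set (Sym2 V)}, (𝓜).IsCircuit C₁ → (𝓜).IsCircuit C₂ → s(x, y) ∈ C₁ →
      s(x, y) ∈ C₂ → verts C₁ ∩ verts C₂ ⊆ {x, y} →
      Separates (C₁ \ {s(x, y)} ∪ C₂ \ {s(x, y)}) (verts C₁ \ {x, y}) {x, y} (verts C₂ \ {x, y}) ∧
      incident (C₁ \ {s(x, y)} ∪ C₂ \ {s(x, y)}) (verts C₁ \ {x, y}) = C₁ \ {s(x, y)} := by
    intro C₁ C₂ h₁ h₂ hx₁ hx₂ hV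
    have hsub : ∀ u, u ∈ verts C₁ → u ∈ (verts C₁ \ {x, y}) ∪ {x, y} := fun u hu => by
      by_cases h : u ∈ ({x, y} : Set V)
      · exact Or.inr h
      · exact Or.inl ⟨hu, h⟩
    have hsep : Separates (C₁ \ {s(x, y)} ∪ C₂ \ {s(x, y)}) (verts C₁ \ {x, y}) {x, y}
        (verts C₂ \ {x, y}) := by
      refine ⟨?_, Set.disjoint_sdiff_left, Set.disjoint_sdiff_left,
        Set.disjoint_left.2 fun u hu hu' => hu.2 (hV ⟨hu.1, hu'.1⟩), ?_⟩
      · rintro e (he | he)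
        · exact ⟨h₁.subset_ground he.1, fun v hv => Or.inl (hsub v ⟨e, he.1, hv⟩)⟩
        · refine ⟨h₂.subset_ground he.1, fun v hv => ?_⟩
          by_cases h : v ∈ ({x, y} : Set V)
          · exact Or.inl (Or.inr h)
          · exact Or.inr ⟨⟨e, he.1, hv⟩, h⟩
      · rintro z hz w hw (he | he)
        · exact hw.2 (hV ⟨right_mem_verts he.1, hw.1⟩)
        · exact hz.2 (hV ⟨hz.1, left_mem_verts he.1⟩)
    refine ⟨hsep, Set.Subset.antisymm ?_ ?_⟩
    · rintro e ⟨he | he, z, hz, hze⟩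
      · exact he
      · exact (hz.2 (hV ⟨hz.1, ⟨e, he.1, hze⟩⟩)).elim
    · intro e he
      refine ⟨Or.inl he, ?_⟩
      by_contra! hcon
      apply he.2
      rw [← edgesOn_pair hxy]
      refine ⟨h₁.subset_ground he.1, fun v hv => ?_⟩
      rcases hsub v ⟨e, he.1, hv⟩ with h | h
      · exact (hcon v h hv).elim
      · exact h
  obtain ⟨hs, hi₁⟩ := hE h₁ h₂ hx₁ hx₂ hV
  obtain ⟨-, hi₂⟩ := hE h₂ h₁ hx₂ hx₁ (by rwa [Set.inter_comm])
  rw [Set.union_comm] at hi₂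
  have hsD := hs.mono hDE
  have inc_mono : ∀ Z : Set V, incident D Z ⊆ incident (C₁ \ {s(x, y)} ∪ C₂ \ {s(x, y)}) Z :=
    fun Z e he => ⟨hDE he.1, he.2⟩
  have d₁ := inc_mono (verts C₁ \ {x, y})
  have d₂ := inc_mono (verts C₂ \ {x, y})
  rw [hi₁] at d₁
  rw [hi₂] at d₂
  have hcover : ∀ e ∈ D, e ∈ incident D (verts C₁ \ {x, y}) ∨
      e ∈ incident D (verts C₂ \ {x, y}) := by
    intro e he
    have h' := hDE he
    rcases h' with h' | h'
    · rw [← hi₁] at h'; exact Or.inl ⟨he, h'.2⟩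
    · rw [← hi₂] at h'; exact Or.inr ⟨he, h'.2⟩
  have ne₁ : (incident D (verts C₁ \ {x, y})).Nonempty := by
    by_contra hne
    rw [Set.not_nonempty_iff_eq_empty] at hne
    refine hD.not_indep ((h₂.sdiff_singleton_indep hx₂).subset fun e he => ?_)
    rcases hcover e he with h | h
    · rw [hne] at h; exact h.elim
    · exact d₂ h
  have ne₂ : (incident D (verts C₂ \ {x, y})).Nonempty := by
    by_contra hne
    rw [Set.not_nonempty_iff_eq_empty] at hne
    refine hD.not_indep ((h₁.sdiff_singleton_indep hx₁).subset fun e he => ?_)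
    rcases hcover e he with h | h
    · exact d₁ h
    · rw [hne] at h; exact h.elim
  have c₁ := (isCircuit_side hD hxy hsD ne₁ ne₂).2.eq_of_subset_isCircuit h₁
    (Set.insert_subset hx₁ (d₁.trans Set.sdiff_subset))
  have c₂ := (isCircuit_side hD hxy hsD.symm ne₂ ne₁).2.eq_of_subset_isCircuit h₂
    (Set.insert_subset hx₂ (d₂.trans Set.sdiff_subset))
  have : C₁ \ {s(x, y)} ∪ C₂ \ {s(x, y)} = D := by
    refine Set.Subset.antisymm ?_ hDE
    rintro e (he | he)
    · have := he.1; rw [← c₁] at this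
      exact (this.resolve_left he.2).1
    · have := he.1; rw [← c₂] at this
      exact (this.resolve_left he.2).1
  rw [this]; exact hD

end TwoSum

/-! ### Connectivity of matroids -/

section MatroidConnectivity

variable {α : Type*} {M : Matroid α}

/-- Two meeting circuits have a circuit in their union through any two prescribed elements. -/
theorem Matroid.IsCircuit.exists_isCircuit_mem_mem [Finite α] {C₁ C₂ : Set α}
    (h₁ : M.IsCircuit C₁) (h₂ : M.IsCircuit C₂) {e f : α} (he : e ∈ C₁) (hf : f ∈ C₂)
    (hne : (C₁ ∩ C₂).Nonempty) : ∃ C ⊆ C₁ ∪ C₂, M.IsCircuit C ∧ e ∈ C ∧ f ∈ C := by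
  induction hn : (C₁ ∪ C₂).ncard using Nat.strong_induction_on generalizing C₁ C₂ with
  | _ n ih =>
  by_cases he₂ : e ∈ C₂
  · exact ⟨C₂, Set.subset_union_right, h₂, he₂, hf⟩
  by_cases hf₁ : f ∈ C₁
  · exact ⟨C₁, Set.subset_union_left, h₁, he, hf₁⟩
  obtain ⟨g, hg₁, hg₂⟩ := hne
  have common : ∀ {D₁ D₂ : Set α}, M.IsCircuit D₁ → M.IsCircuit D₂ → e ∈ D₁ → f ∈ D₂ →
      (D₁ ∩ D₂).Nonempty → D₁ ∪ D₂ ⊂ C₁ ∪ C₂ → ∃ C ⊆ C₁ ∪ C₂, M.IsCircuit C ∧ e ∈ C ∧ f ∈ C := by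
    intro D₁ D₂ d₁ d₂ hd₁ hd₂ hd hss
    obtain ⟨C, hC, h⟩ := ih _ (hn ▸ Set.ncard_lt_ncard hss (Set.toFinite _)) d₁ d₂ hd₁ hd₂ hd rfl
    exact ⟨C, hC.trans hss.subset, h⟩
  obtain ⟨C₃, hs₃, h₃, he₃⟩ := h₁.strong_elimination h₂ hg₁ hg₂ he he₂
  obtain ⟨C₄, hs₄, h₄, hf₄⟩ := h₂.strong_elimination h₁ hg₂ hg₁ hf hf₁
  rw [Set.union_comm C₂] at hs₄
  have m₃ : ∃ u ∈ C₃, u ∈ C₂ ∧ u ∉ C₁ := by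
    by_contra! hcon
    have : C₃ ⊆ C₁ := fun u hu => by
      rcases (hs₃ hu).1 with h | h
      · exact h
      · exact hcon u hu h
    have := h₃.eq_of_subset_isCircuit h₁ this
    exact (hs₃ (this ▸ hg₁)).2 rfl
  have m₄ : ∃ u ∈ C₄, u ∈ C₁ ∧ u ∉ C₂ := by
    by_contra! hcon
    have : C₄ ⊆ C₂ := fun u hu => by
      rcases (hs₄ hu).1 with h | h
      · exact hcon u hu h
      · exact h
    have := h₄.eq_of_subset_isCircuit h₂ this
    exact (hs₄ (this ▸ hg₂)).2 rfl
  obtain ⟨u, hu₃, hu₂, hu₁⟩ := m₃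
  obtain ⟨w, hw₄, hw₁, hw₂⟩ := m₄
  by_cases hu₄ : u ∈ C₄
  · refine common h₃ h₄ he₃ hf₄ ⟨u, hu₃, hu₄⟩ ⟨Set.union_subset (hs₃.trans Set.sdiff_subset)
      (hs₄.trans Set.sdiff_subset), fun h => ?_⟩
    rcases h (Or.inl hg₁) with h | h
    · exact (hs₃ h).2 rfl
    · exact (hs₄ h).2 rfl
  · refine common h₁ h₄ he hf₄ ⟨w, hw₁, hw₄⟩ ⟨Set.union_subset Set.subset_union_left
      (hs₄.trans Set.sdiff_subset), fun h => ?_⟩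
    rcases h (Or.inr hu₂) with h | h
    · exact hu₁ h
    · exact hu₄ h

/-- Any two elements of `F` lie on a common circuit contained in `F`. -/
def MConn (M : Matroid α) (F : Set α) : Prop :=
  F.Nonempty ∧ ∀ e ∈ F, ∀ f ∈ F, ∃ C ⊆ F, M.IsCircuit C ∧ e ∈ C ∧ f ∈ C

lemma MConn.subset_ground {F : Set α} (h : MConn M F) : F ⊆ M.E := fun e he => by
  obtain ⟨C, -, hC, heC, -⟩ := h.2 e he e he
  exact hC.subset_ground heC

lemma Matroid.IsCircuit.mConn {C : Set α} (hC : M.IsCircuit C) : MConn M C :=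
  ⟨hC.nonempty, fun _ he _ hf => ⟨C, subset_rfl, hC, he, hf⟩⟩

lemma exists_isCircuit_trans [Finite α] {F C₁ C₂ : Set α} {e f g : α} (h₁ : M.IsCircuit C₁)
    (h₂ : M.IsCircuit C₂) (s₁ : C₁ ⊆ F) (s₂ : C₂ ⊆ F) (he : e ∈ C₁) (hg₁ : g ∈ C₁) (hg₂ : g ∈ C₂)
    (hf : f ∈ C₂) : ∃ C ⊆ F, M.IsCircuit C ∧ e ∈ C ∧ f ∈ C := by
  obtain ⟨C, hC, h⟩ := h₁.exists_isCircuit_mem_mem h₂ he hf ⟨g, hg₁, hg₂⟩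
  exact ⟨C, hC.trans (Set.union_subset s₁ s₂), h⟩

lemma mConn_of_forall [Finite α] {F : Set α} {e : α} (he : e ∈ F)
    (h : ∀ f ∈ F, ∃ C ⊆ F, M.IsCircuit C ∧ e ∈ C ∧ f ∈ C) : MConn M F := by
  refine ⟨⟨e, he⟩, fun f hf g hg => ?_⟩
  obtain ⟨C₁, s₁, h₁, he₁, hf₁⟩ := h f hf
  obtain ⟨C₂, s₂, h₂, he₂, hg₂⟩ := h g hg
  exact exists_isCircuit_trans h₁ h₂ s₁ s₂ hf₁ he₁ he₂ hg₂

lemma MConn.union_circuit [Finite α] {F C : Set α} (hF : MConn M F) (hC : M.IsCircuit C)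
    (hne : (F ∩ C).Nonempty) : MConn M (F ∪ C) := by
  obtain ⟨e, heF, heC⟩ := hne
  refine mConn_of_forall (Or.inl heF) fun f hf => ?_
  rcases hf with hf | hf
  · obtain ⟨D, hD, h⟩ := hF.2 e heF f hf
    exact ⟨D, hD.trans Set.subset_union_left, h⟩
  · exact ⟨C, Set.subset_union_right, hC, heC, hf⟩

end MatroidConnectivity

/-! ### Connected sets of the rigidity matroid -/

section RigidConnected

variable {V : Type*} [Fintype V] [DecidableEq V]

local notation "𝓜" => rigidityMatroid V

lemma MConn.exists_isCircuit_verts {F : Set (Sym2 V)} (h : MConn 𝓜 F) {u w : V} (hu : u ∈ verts F)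
    (hw : w ∈ verts F) : ∃ C ⊆ F, (𝓜).IsCircuit C ∧ u ∈ verts C ∧ w ∈ verts C := by
  obtain ⟨e, he, hue⟩ := hu
  obtain ⟨f, hf, hwf⟩ := hw
  obtain ⟨C, hCF, hC, heC, hfC⟩ := h.2 e he f hf
  exact ⟨C, hCF, hC, ⟨e, heC, hue⟩, ⟨f, hfC, hwf⟩⟩

lemma MConn.rigid {F : Set (Sym2 V)} (h : MConn 𝓜 F) : edgesOn (verts F) ⊆ (𝓜).closure F := by
  intro e he
  induction e with | _ u w =>
  rw [mk_mem_edgesOn] at he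
  obtain ⟨C, hCF, hC, hu, hw⟩ := h.exists_isCircuit_verts he.2.1 he.2.2
  exact (𝓜).closure_subset_closure hCF
    (edgesOn_subset_closure_of_isCircuit hC (mk_mem_edgesOn.2 ⟨he.1, hu, hw⟩))

lemma ncard_starAt_mono {F F' : Set (Sym2 V)} (h : F ⊆ F') (v : V) :
    (starAt F v).ncard ≤ (starAt F' v).ncard := Set.ncard_le_ncard fun _ he => ⟨h he.1, he.2⟩

lemma MConn.three_le_degree {F : Set (Sym2 V)} (h : MConn 𝓜 F) {v : V} (hv : v ∈ verts F) :
    3 ≤ (starAt F v).ncard := by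
  obtain ⟨C, hCF, hC, hv, -⟩ := h.exists_isCircuit_verts hv hv
  exact (three_le_degree_of_isCircuit hC hv).trans (ncard_starAt_mono hCF v)

lemma exists_ne_mem_of_isCircuit {C : Set (Sym2 V)} (hC : (𝓜).IsCircuit C) (e : Sym2 V) :
    ∃ f ∈ C, f ≠ e := by
  obtain ⟨f, hf⟩ := hC.nonempty
  obtain ⟨v, hv⟩ := exists_degree_three hC
  by_contra! h
  have : starAt C v ⊆ {e} := fun g hg => h g hg.1
  have := Set.ncard_le_ncard this
  rw [Set.ncard_singleton] at this
  omega

lemma MConn.insert_edge {F : Set (Sym2 V)} (h : MConn 𝓜 F) {u w : V} (huw : u ≠ w)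
    (hu : u ∈ verts F)
    (hw : w ∈ verts F) : MConn 𝓜 (insert s(u, w) F) := by
  by_cases he : s(u, w) ∈ F
  · rwa [Set.insert_eq_of_mem he]
  obtain ⟨D, hDs, hD, heD⟩ := Matroid.exists_isCircuit_of_mem_closure
    (h.rigid (mk_mem_edgesOn.2 ⟨huw, hu, hw⟩)) he
  obtain ⟨f, hf, hfe⟩ := exists_ne_mem_of_isCircuit hD s(u, w)
  have := h.union_circuit hD ⟨f, (hDs hf).resolve_left hfe, hf⟩
  convert this using 1
  refine Set.Subset.antisymm (Set.insert_subset (Or.inr heD) Set.subset_union_left) ?_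
  exact Set.union_subset (Set.subset_insert _ _) hDs

lemma mem_incident_of_mem_verts {F : Set (Sym2 V)} {Z : Set V} {z : V} (hz : z ∈ Z)
    (h : z ∈ verts F) : (incident F Z).Nonempty := by
  obtain ⟨e, he, hze⟩ := h
  exact ⟨e, he, z, hz, hze⟩

/-- Connected sets of the rigidity matroid are two-connected graphs. -/
lemma MConn.two_le_of_separates {F : Set (Sym2 V)} (hF : MConn 𝓜 F) {Z S W : Set V}
    (h : Separates F Z S W) (hZ : (incident F Z).Nonempty) (hW : (incident F W).Nonempty) :
    2 ≤ S.ncard := by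
  by_contra hS
  obtain ⟨e, he, z, hz, hze⟩ := hZ
  obtain ⟨f, hf, w, hw, hwf⟩ := hW
  obtain ⟨C, hCF, hC, heC, hfC⟩ := hF.2 e he f hf
  have := (ncard_of_separates hC (h.mono hCF) (by omega) ⟨e, heC, z, hz, hze⟩
    ⟨f, hfC, w, hw, hwf⟩).2.1
  omega

/-- In a connected set in which almost all degrees are at least four, some element other than a
prescribed one can be deleted. -/
theorem exists_removable {L : Set (Sym2 V)} (hL : MConn 𝓜 L) {x y z : V} (hxy : s(x, y) ∈ L)
    (hz : z ∈ verts L)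
    (hdeg : ∀ v ∈ verts L, v ≠ x → v ≠ y → v ≠ z → 4 ≤ (starAt L v).ncard) :
    ∃ f ∈ L, f ≠ s(x, y) ∧ MConn 𝓜 (L \ {f}) := by
  classical
  have hd := hL.subset_ground
  obtain ⟨g, hg, hzg⟩ := hz
  obtain ⟨C₁, hs₁, hC₁, hx₁, hg₁⟩ := hL.2 _ hxy g hg
  have hzC : z ∈ verts C₁ := ⟨g, hg₁, hzg⟩
  have hne : C₁ ≠ L := by
    rintro rfl
    have h1 := ncard_of_isCircuit hC₁
    have h3 := sum_degree_le hd (verts C₁).toFinset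
    have h6 : {e ∈ C₁ | ∃ z ∈ (verts C₁).toFinset, z ∈ e}.ncard ≤ C₁.ncard :=
      Set.ncard_le_ncard (fun e he => he.1)
    have h7 : (C₁ ∩ edgesOn ((verts C₁).toFinset : Set V)).ncard ≤ C₁.ncard :=
      Set.ncard_le_ncard Set.inter_subset_left
    have h8 : ∑ v ∈ (verts C₁).toFinset, 4 ≤ ∑ v ∈ (verts C₁).toFinset,
        ((starAt C₁ v).ncard + if v ∈ ({x, y, z} : Finset V) then 1 else 0) := by
      refine Finset.sum_le_sum fun v hv => ?_
      have hv' := Set.mem_toFinset.1 hv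
      split_ifs with h
      · have := three_le_degree_of_isCircuit hC₁ hv'
        omega
      · simp only [Finset.mem_insert, Finset.mem_singleton, not_or] at h
        exact hdeg v hv' h.1 h.2.1 h.2.2
    rw [Finset.sum_add_distrib, ← Finset.card_filter, Finset.sum_const, smul_eq_mul,
      ← Set.ncard_eq_toFinset_card'] at h8
    have h9 : ((verts C₁).toFinset.filter (fun v => v ∈ ({x, y, z} : Finset V))).card ≤ 3 :=
      (Finset.card_le_card (t := {x, y, z}) fun v hv => (Finset.mem_filter.1 hv).2).trans
        Finset.card_le_three
    omega
  obtain ⟨D, ⟨hD₁, hDL, hDc⟩, hDmax⟩ := Set.exists_max_image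
    {D : Set (Sym2 V) | C₁ ⊆ D ∧ D ⊂ L ∧ MConn 𝓜 D} Set.ncard (Set.toFinite _)
    ⟨C₁, subset_rfl, ⟨hs₁, fun h => hne (hs₁.antisymm h)⟩, hC₁.mConn⟩
  obtain ⟨g', hg'L, hg'D⟩ := Set.exists_of_ssubset hDL
  obtain ⟨C', hC's, hC', hxC', hg'C'⟩ := hL.2 _ hxy g' hg'L
  obtain ⟨C, ⟨hCL, hC, hCm, hCn⟩, hCmin⟩ := Set.exists_min_image
    {C : Set (Sym2 V) | C ⊆ L ∧ (𝓜).IsCircuit C ∧ (D ∩ C).Nonempty ∧ (C \ D).Nonempty}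
    (fun C => (C \ D).ncard) (Set.toFinite _)
    ⟨C', hC's, hC', ⟨_, hD₁ hx₁, hxC'⟩, ⟨g', hg'C', hg'D⟩⟩
  have hDC : D ∪ C = L := by
    by_contra hcon
    have hlt : D ⊂ D ∪ C := by
      obtain ⟨u, hu⟩ := hCn
      exact ⟨Set.subset_union_left, fun h => hu.2 (h (Or.inr hu.1))⟩
    have h1 := hDmax (D ∪ C) ⟨hD₁.trans Set.subset_union_left,
      (Set.union_subset hDL.subset hCL).ssubset_of_ne hcon, hDc.union_circuit hC hCm⟩
    exact absurd (Set.ncard_lt_ncard hlt) (by omega)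
  obtain ⟨e, heC, heD⟩ := hCn
  obtain ⟨I, hI⟩ := (𝓜).exists_isBasis D hDc.subset_ground
  have hJi : (𝓜).Indep (I ∪ (C \ D) \ {e}) := by
    by_contra hdep
    have hsub : I ∪ (C \ D) \ {e} ⊆ L := Set.union_subset (hI.subset.trans hDL.subset)
      (Set.sdiff_subset.trans (Set.sdiff_subset.trans hCL))
    obtain ⟨B, hBs, hB⟩ := (show (𝓜).Dep (I ∪ (C \ D) \ {e}) from
      ⟨hdep, hsub.trans hd⟩).exists_isCircuit_subset
    have hBD : (B \ D).Nonempty := by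
      by_contra h
      rw [Set.not_nonempty_iff_eq_empty, Set.sdiff_eq_empty] at h
      refine hB.not_indep (hI.indep.subset fun u hu => ?_)
      rcases hBs hu with h' | h'
      · exact h'
      · exact (h'.1.2 (h hu)).elim
    have hlt : B \ D ⊂ C \ D := by
      refine ⟨fun u hu => ?_, fun h => ?_⟩
      · rcases hBs hu.1 with h' | h'
        · exact (hu.2 (hI.subset h')).elim
        · exact h'.1
      · rcases hBs (h ⟨heC, heD⟩).1 with h' | h'
        · exact heD (hI.subset h')
        · exact h'.2 rfl
    by_cases hBm : (D ∩ B).Nonempty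
    · have := hCmin B ⟨hBs.trans hsub, hB, hBm, hBD⟩
      exact absurd (Set.ncard_lt_ncard hlt) (by omega)
    · have hBC : B ⊆ C \ D := fun u hu => by
        have : u ∉ D := fun h => hBm ⟨u, h, hu⟩
        exact hlt.subset ⟨hu, this⟩
      have := hB.eq_of_subset_isCircuit hC (hBC.trans Set.sdiff_subset)
      obtain ⟨u, hu⟩ := hCm
      exact (hBC (this ▸ hu.2)).2 hu.1
  have hspan : L ⊆ (𝓜).closure (I ∪ (C \ D) \ {e}) := by
    have hE : I ∪ (C \ D) \ {e} ⊆ (𝓜).E := hJi.subset_ground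
    have hDcl : D ⊆ (𝓜).closure (I ∪ (C \ D) \ {e}) :=
      hI.subset_closure.trans ((𝓜).closure_subset_closure Set.subset_union_left)
    rw [← hDC]
    refine Set.union_subset hDcl ?_
    refine (hC.subset_closure_sdiff_singleton e).trans
      ((𝓜).closure_subset_closure_of_subset_closure fun u hu => ?_)
    by_cases hud : u ∈ D
    · exact hDcl hud
    · exact (𝓜).mem_closure_of_mem (Or.inr ⟨⟨hu.1, hud⟩, hu.2⟩) hE
  have hJb : (𝓜).IsBasis (I ∪ (C \ D) \ {e}) L := by
    refine hJi.isBasis_of_subset_of_subset_closure ?_ hspan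
    exact Set.union_subset (hI.subset.trans hDL.subset)
      (Set.sdiff_subset.trans (Set.sdiff_subset.trans hCL))
  have hL2 := two_le_ncard_verts hd hL.1
  have hD2 := two_le_ncard_verts hDc.subset_ground hDc.1
  have c1 := isBasis_ncard hJb (subset_edgesOn_verts hd) hL2 hL.rigid
  have c2 := isBasis_ncard hI (subset_edgesOn_verts hDc.subset_ground) hD2 hDc.rigid
  have c3 : (I ∪ (C \ D) \ {e}).ncard = I.ncard + ((C \ D) \ {e}).ncard :=
    Set.ncard_union_eq (Set.disjoint_left.2 fun u hu hu' => hu'.1.2 (hI.subset hu))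
  have c4 : ((C \ D) \ {e}).ncard + 1 = (C \ D).ncard :=
    Set.ncard_sdiff_singleton_add_one ⟨heC, heD⟩
  set Y := verts L \ verts D with hY
  have c5 : Y.ncard + (verts D).ncard = (verts L).ncard :=
    Set.ncard_sdiff_add_ncard_of_subset (verts_mono hDL.subset)
  have hedge : ∀ f ∈ L, ∀ v ∈ Y, v ∈ f → f ∈ C \ D := by
    intro f hf v hv hvf
    have hfD : f ∉ D := fun h => hv.2 ⟨f, h, hvf⟩
    rw [← hDC] at hf
    exact ⟨hf.resolve_left hfD, hfD⟩
  by_cases hY0 : Y.ncard = 0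
  · have : (C \ D).ncard = 1 := by omega
    obtain ⟨f, hf⟩ := Set.ncard_eq_one.1 this
    have hfC : f ∈ C \ D := by rw [hf]; rfl
    refine ⟨f, hCL hfC.1, fun h => hfC.2 (h ▸ hD₁ hx₁), ?_⟩
    convert hDc using 1
    rw [← hDC]
    ext u
    constructor
    · rintro ⟨h | h, hu⟩
      · exact h
      · by_contra h'
        have : u ∈ C \ D := ⟨h, h'⟩
        rw [hf] at this
        exact hu this
    · intro hu
      refine ⟨Or.inl hu, ?_⟩
      rintro rfl
      exact hfC.2 hu
  · exfalso
    have hsum := sum_degree_le hd Y.toFinset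
    have h1 : {e ∈ L | ∃ z ∈ Y.toFinset, z ∈ e}.ncard ≤ (C \ D).ncard :=
      Set.ncard_le_ncard fun f ⟨hf, v, hv, hvf⟩ => hedge f hf v (Set.mem_toFinset.1 hv) hvf
    have hdis4 : ∀ v ∈ Y.toFinset, 4 ≤ (starAt L v).ncard := by
      intro v hv
      have hv := Set.mem_toFinset.1 hv
      refine hdeg v hv.1 ?_ ?_ ?_
      · rintro rfl; exact hv.2 (verts_mono hD₁ (left_mem_verts hx₁))
      · rintro rfl; exact hv.2 (verts_mono hD₁ (right_mem_verts hx₁))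
      · rintro rfl; exact hv.2 (verts_mono hD₁ hzC)
    have h2 := Finset.card_nsmul_le_sum _ _ _ hdis4
    rw [← Set.ncard_eq_toFinset_card', smul_eq_mul] at h2
    have h3 : (L ∩ edgesOn (Y.toFinset : Set V)).ncard + 2 ≤ 2 * Y.ncard := by
      have hsub : L ∩ edgesOn (Y.toFinset : Set V) ⊆ C \ D := by
        rintro f ⟨hf, hfY⟩
        induction f with | _ u w =>
        have := (mk_mem_edgesOn.1 hfY).2.1
        exact hedge _ hf u (by simpa using this) (by simp)
      have hi : (𝓜).Indep (L ∩ edgesOn (Y.toFinset : Set V)) := by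
        refine hC.ssubset_indep ⟨hsub.trans Set.sdiff_subset, fun h => ?_⟩
        obtain ⟨u, hu⟩ := hCm
        exact (hsub (h hu.2)).2 hu.1
      by_cases hYb : 2 ≤ Y.ncard
      · have := ncard_add_three_le hi (X := Y) (by
          rintro f ⟨-, hf⟩; simpa using hf) hYb
        omega
      · have : L ∩ edgesOn (Y.toFinset : Set V) = ∅ := by
          rw [Set.eq_empty_iff_forall_notMem]
          rintro f ⟨hf, hfY⟩
          induction f with | _ u w =>
          rw [mk_mem_edgesOn] at hfY
          apply hYb
          exact (Set.one_lt_ncard (Set.toFinite Y)).2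
            ⟨u, by simpa using hfY.2.1, w, by simpa using hfY.2.2, hfY.1⟩
        rw [this, Set.ncard_empty]
        omega
    omega

/-! ### Sides of two-separations of connected sets -/

lemma MConn.side {F : Set (Sym2 V)} (hF : MConn 𝓜 F) {Z W : Set V} {x y : V} (hxy : x ≠ y)
    (h : Separates F Z {x, y} W) (hZ : (incident F Z).Nonempty) (hW : (incident F W).Nonempty) :
    MConn 𝓜 (insert s(x, y) (incident F Z)) := by
  have key : ∀ f ∈ incident F Z, ∃ C ⊆ insert s(x, y) (incident F Z), (𝓜).IsCircuit C ∧
      s(x, y) ∈ C ∧ f ∈ C := by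
    intro f hf
    obtain ⟨g, hg⟩ := hW
    obtain ⟨C, hCF, hC, hfC, hgC⟩ := hF.2 f hf.1 g hg.1
    have := (isCircuit_side hC hxy (h.mono hCF) ⟨f, hfC, hf.2⟩ ⟨g, hgC, hg.2⟩).2
    exact ⟨_, Set.insert_subset_insert fun e he => ⟨hCF he.1, he.2⟩, this, Set.mem_insert _ _,
      Or.inr ⟨hfC, hf.2⟩⟩
  refine mConn_of_forall (Set.mem_insert _ _) fun f hf => ?_
  rcases hf with rfl | hf
  · obtain ⟨f, hf⟩ := hZ
    obtain ⟨C, h1, h2, h3, -⟩ := key f hf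
    exact ⟨C, h1, h2, h3, h3⟩
  · exact key f hf

lemma MConn.of_sides {F : Set (Sym2 V)} {Z W : Set V} {x y : V}
    (h : Separates F Z {x, y} W) (hZ : (incident F Z).Nonempty) (hW : (incident F W).Nonempty)
    (h₁ : MConn 𝓜 (insert s(x, y) (incident F Z)))
    (h₂ : MConn 𝓜 (insert s(x, y) (incident F W))) : MConn 𝓜 F := by
  have hxy : x ≠ y := fun h => h₁.subset_ground (Set.mem_insert _ _) (by simp [h])
  have hsv : ∀ {Z W : Set V} {C : Set (Sym2 V)}, Separates F Z {x, y} W →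
      C ⊆ insert s(x, y) (incident F Z) → verts C ⊆ Z ∪ {x, y} := fun h hC =>
    verts_subset (hC.trans (Set.insert_subset (mk_mem_edgesOn.2 ⟨hxy, by simp, by simp⟩)
      h.incident_subset))
  have cross : ∀ f ∈ incident F Z, ∀ g ∈ incident F W, ∃ C ⊆ F, (𝓜).IsCircuit C ∧ f ∈ C ∧
      g ∈ C := by
    intro f hf g hg
    obtain ⟨C₁, s₁, c₁, x₁, f₁⟩ := h₁.2 _ (Set.mem_insert _ _) f (Or.inr hf)
    obtain ⟨C₂, s₂, c₂, x₂, g₂⟩ := h₂.2 _ (Set.mem_insert _ _) g (Or.inr hg)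
    have hfx : f ≠ s(x, y) := by
      rintro rfl
      obtain ⟨-, z, hz, hze⟩ := hf
      exact Set.disjoint_left.1 h.disj_ZS hz (by simpa using hze)
    have hgx : g ≠ s(x, y) := by
      rintro rfl
      obtain ⟨-, z, hz, hze⟩ := hg
      exact Set.disjoint_left.1 h.disj_WS hz (by simpa using hze)
    refine ⟨_, ?_, isCircuit_two_sum c₁ c₂ x₁ x₂ fun u hu => ?_, Or.inl ⟨f₁, hfx⟩,
      Or.inr ⟨g₂, hgx⟩⟩
    · rintro e (he | he)
      · exact ((s₁ he.1).resolve_left he.2).1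
      · exact ((s₂ he.1).resolve_left he.2).1
    · rcases hsv h s₁ hu.1 with h1 | h1
      · rcases hsv h.symm s₂ hu.2 with h2 | h2
        · exact (Set.disjoint_left.1 h.disj h1 h2).elim
        · exact h2
      · exact h1
  obtain ⟨f₀, hf₀⟩ := hZ
  obtain ⟨g₀, hg₀⟩ := hW
  refine mConn_of_forall hf₀.1 fun e he => ?_
  rw [h.eq_union] at he
  rcases he with he | he | he
  · obtain ⟨C₁, s₁, c₁, m₁, m₁'⟩ := cross f₀ hf₀ g₀ hg₀
    obtain ⟨C₂, s₂, c₂, m₂, m₂'⟩ := cross e he g₀ hg₀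
    exact exists_isCircuit_trans c₁ c₂ s₁ s₂ m₁ m₁' m₂' m₂
  · exact cross f₀ hf₀ e he
  · have : e = s(x, y) := by
      have := he.2; rw [edgesOn_pair hxy] at this; exact this
    subst this
    obtain ⟨C₁, s₁, c₁, x₁, f₁⟩ := h₁.2 _ (Set.mem_insert _ _) f₀ (Or.inr hf₀)
    exact ⟨C₁, s₁.trans (Set.insert_subset he.1 (incident_subset _ _)), c₁, f₁, x₁⟩

end RigidConnected

/-! ### Deleting an edge of a three-connected graph -/

section ThreeConnected

variable {V : Type*} [Fintype V] [DecidableEq V]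

local notation "𝓜" => rigidityMatroid V

/-- The graph with vertex set `X` and edge set `F` is three-connected. -/
def Conn3 (F : Set (Sym2 V)) (X : Set V) : Prop :=
  F ⊆ edgesOn X ∧ 4 ≤ X.ncard ∧ ∀ Z S W, Separates F Z S W → Z ∪ S ∪ W = X → S.ncard ≤ 2 →
    Z.Nonempty → W.Nonempty → False

lemma Separates.cross {F : Set (Sym2 V)} {X Z T W A T' A' : Set V} (h : Separates F Z T W)
    (h' : Separates F A T' A') (hX : Z ∪ T ∪ W = X) (hX' : A ∪ T' ∪ A' = X) :
    Separates F (Z ∩ A) (Z ∩ T' ∪ T ∩ A ∪ T ∩ T') (W ∪ A') ∧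
      (Z ∩ A) ∪ (Z ∩ T' ∪ T ∩ A ∪ T ∩ T') ∪ (W ∪ A') = X := by
  have hc : (Z ∩ A) ∪ (Z ∩ T' ∪ T ∩ A ∪ T ∩ T') ∪ (W ∪ A') = X := by
    ext x
    have h1 : x ∈ Z ∪ T ∪ W ↔ x ∈ X := by rw [hX]
    have h2 : x ∈ A ∪ T' ∪ A' ↔ x ∈ X := by rw [hX']
    simp only [Set.mem_union, Set.mem_inter_iff] at h1 h2 ⊢
    tauto
  have d1 : ∀ x ∈ Z, x ∉ T := fun _ hx => Set.disjoint_left.1 h.disj_ZS hx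
  have d2 : ∀ x ∈ W, x ∉ T := fun _ hx => Set.disjoint_left.1 h.disj_WS hx
  have d3 : ∀ x ∈ Z, x ∉ W := fun _ hx => Set.disjoint_left.1 h.disj hx
  have d1' : ∀ x ∈ A, x ∉ T' := fun _ hx => Set.disjoint_left.1 h'.disj_ZS hx
  have d2' : ∀ x ∈ A', x ∉ T' := fun _ hx => Set.disjoint_left.1 h'.disj_WS hx
  have d3' : ∀ x ∈ A, x ∉ A' := fun _ hx => Set.disjoint_left.1 h'.disj hx
  refine ⟨⟨?_, ?_, ?_, ?_, ?_⟩, hc⟩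
  · rw [hc, ← hX]; exact h.subset
  · rw [Set.disjoint_left]; intro x
    have := d1 x; have := d1' x
    simp only [Set.mem_union, Set.mem_inter_iff]; tauto
  · rw [Set.disjoint_left]; intro x
    have := d2 x; have := d2' x; have := d3 x; have := d3' x; have := d1 x; have := d1' x
    simp only [Set.mem_union, Set.mem_inter_iff]; tauto
  · rw [Set.disjoint_left]; intro x
    have := d3 x; have := d3' x
    simp only [Set.mem_union, Set.mem_inter_iff]; tauto
  · rintro z ⟨hz, ha⟩ w (hw | hw)
    · exact h.notMem z hz w hw
    · exact h'.notMem z ha w hw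

lemma ncard_cross_le (Z T A T' : Set V) :
    (Z ∩ T' ∪ T ∩ A ∪ T ∩ T').ncard ≤ (Z ∩ T').ncard + (T ∩ A).ncard + (T ∩ T').ncard :=
  (Set.ncard_union_le _ _).trans (Nat.add_le_add_right (Set.ncard_union_le _ _) _)

lemma Separates.insert_edge {F : Set (Sym2 V)} {P S Q X : Set V} (h : Separates F P S Q)
    (hX : P ∪ S ∪ Q = X) {u w : V} (huw : s(u, w) ∈ edgesOn X) (hu : u ∉ P) (hw : w ∉ P) :
    Separates (insert s(u, w) F) P S Q := by
  refine ⟨Set.insert_subset (hX ▸ huw) h.subset, h.disj_ZS, h.disj_WS, h.disj, ?_⟩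
  rintro z hz w' hw' (he | he)
  · rcases Sym2.eq_iff.1 he with ⟨rfl, rfl⟩ | ⟨rfl, rfl⟩
    · exact hu hz
    · exact hw hz
  · exact h.notMem z hz w' hw' he

lemma ncard_partition {F : Set (Sym2 V)} {X A T A' P : Set V} (h : Separates F A T A')
    (hX : A ∪ T ∪ A' = X) (hP : P ⊆ X) :
    P.ncard = (P ∩ A).ncard + (P ∩ T).ncard + (P ∩ A').ncard := by
  rw [← Set.ncard_union_eq (h.disj_ZS.mono Set.inter_subset_right Set.inter_subset_right),
    ← Set.ncard_union_eq, ← Set.inter_union_distrib_left, ← Set.inter_union_distrib_left, hX,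
    Set.inter_eq_left.2 hP]
  exact Set.disjoint_union_left.2 ⟨h.disj.mono Set.inter_subset_right Set.inter_subset_right,
    h.disj_WS.symm.mono Set.inter_subset_right Set.inter_subset_right⟩

lemma insert_sdiff_pair {F : Set (Sym2 V)} {e f : Sym2 V} (he : e ∈ F) (hef : e ≠ f) :
    insert e (F \ {e, f}) = F \ {f} := by
  ext g
  simp only [Set.mem_insert_iff, Set.mem_sdiff, Set.mem_singleton_iff, not_or]
  constructor
  · rintro (rfl | h)
    · exact ⟨he, hef⟩
    · exact ⟨h.1, h.2.2⟩
  · intro h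
    by_cases hg : g = e
    · exact Or.inl hg
    · exact Or.inr ⟨h.1, hg, h.2⟩

/-- Uncrossing of two separations obtained by deleting the edges `zw` and `st`, where the first
separation has a smallest possible side `Z`. -/
lemma uncross {G : Set (Sym2 V)} {X Z T W A T' A' : Set V} {z w s t : V}
    (hZ : Separates (G \ {s(z, w)}) Z T W) (hA : Separates (G \ {s(s, t)}) A T' A')
    (cZ : Z ∪ T ∪ W = X) (cA : A ∪ T' ∪ A' = X) (hT : T.ncard = 2) (hT' : T'.ncard = 2)
    (he : s(z, w) ∈ G) (hf : s(s, t) ∈ G) (hef : s(z, w) ≠ s(s, t)) (hG : G ⊆ edgesOn X)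
    (hz : z ∈ Z) (hw : w ∈ W) (hs : s ∈ Z) (hsA : s ∈ A) (htA : t ∈ A') (htW : t ∉ W) (hzA : z ∉ A)
    (hβ : ∀ P S Q, Separates (G \ {s(z, w)}) P S Q → P ∪ S ∪ Q = X → P.Nonempty → Q.Nonempty →
      2 ≤ S.ncard)
    (hγ : ∀ P S Q, Separates (G \ {s(s, t)}) P S Q → P ∪ S ∪ Q = X → S.ncard ≤ 2 → P.Nonempty →
      Q.Nonempty → Z.ncard ≤ P.ncard) : False := by
  have hZ' := hZ.mono (F' := G \ {s(z, w), s(s, t)}) fun e he => ⟨he.1, fun h => he.2 (Or.inl h)⟩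
  have hA' := hA.mono (F' := G \ {s(z, w), s(s, t)}) fun e he => ⟨he.1, fun h => he.2 (Or.inr h)⟩
  have hwZ : w ∉ Z := fun h => Set.disjoint_left.1 hZ.disj h hw
  have hsW : s ∉ W := fun h => Set.disjoint_left.1 hZ.disj hs h
  have hTX : T ⊆ X := by rw [← cZ]; intro x hx; exact Or.inl (Or.inr hx)
  have hT'X : T' ⊆ X := by rw [← cA]; intro x hx; exact Or.inl (Or.inr hx)
  have hZX : Z ⊆ X := by rw [← cZ]; intro x hx; exact Or.inl (Or.inl hx)
  have hA'X : A' ⊆ X := by rw [← cA]; intro x hx; exact Or.inr hx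
  have n1 := ncard_partition hA cA hTX
  have n2 := ncard_partition hZ cZ hT'X
  have n3 := ncard_partition hA cA hZX
  have n4 := ncard_partition hZ cZ hA'X
  rw [Set.inter_comm T' Z, Set.inter_comm T' T, Set.inter_comm T' W] at n2
  rw [Set.inter_comm A' Z, Set.inter_comm A' T, Set.inter_comm A' W] at n4
  have hZAs : 0 < (Z ∩ A).ncard := (Set.ncard_pos).2 ⟨s, hs, hsA⟩
  have c1 : 3 ≤ (Z ∩ T').ncard + (T ∩ A).ncard + (T ∩ T').ncard := by
    by_contra hlt
    obtain ⟨hc, hcc⟩ := hZ'.cross hA' cZ cA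
    have h1 := hc.insert_edge hcc (hG he) (fun h => hzA h.2) (fun h => hwZ h.1)
    rw [insert_sdiff_pair he hef] at h1
    have h2 := hγ _ _ _ h1 hcc ((ncard_cross_le _ _ _ _).trans (by omega)) ⟨s, hs, hsA⟩
      ⟨w, Or.inl hw⟩
    have h3 : (Z ∩ A).ncard < Z.ncard :=
      Set.ncard_lt_ncard ⟨Set.inter_subset_left, fun h => hzA (h hz).2⟩
    omega
  have c2 : (W ∩ A').ncard = 0 := by
    by_contra hne
    obtain ⟨hc, hcc⟩ := hZ'.symm.cross hA'.symm (X := X)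
      (by rw [← cZ]; ext x; simp only [Set.mem_union]; tauto)
      (by rw [← cA]; ext x; simp only [Set.mem_union]; tauto)
    have h1 := hc.insert_edge hcc (hG hf) (fun h => hsW h.1) (fun h => htW h.1)
    rw [Set.pair_comm, insert_sdiff_pair hf hef.symm] at h1
    have h2 := hβ _ _ _ h1 hcc ((Set.ncard_pos).1 (Nat.pos_of_ne_zero hne)) ⟨s, Or.inl hs⟩
    have h3 := ncard_cross_le W T A' T'
    omega
  have h4 := hγ A' T' A hA.symm (by rw [← cA]; ext x; simp only [Set.mem_union]; tauto) hT'.le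
    ⟨t, htA⟩ ⟨s, hsA⟩
  omega

lemma uncross_inner {G : Set (Sym2 V)} {X Z T W A T' A' : Set V} {z w s t : V}
    (hZ : Separates (G \ {s(z, w)}) Z T W) (hA : Separates (G \ {s(s, t)}) A T' A')
    (cZ : Z ∪ T ∪ W = X) (cA : A ∪ T' ∪ A' = X) (hT : T.ncard = 2) (hT' : T'.ncard = 2)
    (he : s(z, w) ∈ G) (hf : s(s, t) ∈ G) (hef : s(z, w) ≠ s(s, t)) (hG : G ⊆ edgesOn X)
    (hw : w ∈ W) (hs : s ∈ Z) (hsA : s ∈ A) (htA : t ∈ A') (htT : t ∈ T) (hzA : z ∈ A)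
    (hα : ∀ P S Q, Separates G P S Q → P ∪ S ∪ Q = X → P.Nonempty → Q.Nonempty → 3 ≤ S.ncard)
    (hβ : ∀ P S Q, Separates (G \ {s(z, w)}) P S Q → P ∪ S ∪ Q = X → P.Nonempty → Q.Nonempty →
      2 ≤ S.ncard)
    (hγ : ∀ P S Q, Separates (G \ {s(s, t)}) P S Q → P ∪ S ∪ Q = X → S.ncard ≤ 2 → P.Nonempty →
      Q.Nonempty → Z.ncard ≤ P.ncard)
    (hN : ∃ u₁ ∈ Z, ∃ u₂ ∈ Z, u₁ ≠ u₂ ∧ s(u₁, t) ∈ G \ {s(s, t)} ∧ s(u₂, t) ∈ G \ {s(s, t)}) :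
    False := by
  have hZ' := hZ.mono (F' := G \ {s(z, w), s(s, t)}) fun e he => ⟨he.1, fun h => he.2 (Or.inl h)⟩
  have hA' := hA.mono (F' := G \ {s(z, w), s(s, t)}) fun e he => ⟨he.1, fun h => he.2 (Or.inr h)⟩
  have cZ' : W ∪ T ∪ Z = X := by rw [← cZ]; ext x; simp only [Set.mem_union]; tauto
  have cA' : A' ∪ T' ∪ A = X := by rw [← cA]; ext x; simp only [Set.mem_union]; tauto
  have hwZ : w ∉ Z := fun h => Set.disjoint_left.1 hZ.disj h hw
  have hsW : s ∉ W := fun h => Set.disjoint_left.1 hZ.disj hs h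
  have htZ : t ∉ Z := fun h => Set.disjoint_left.1 hZ.disj_ZS h htT
  have htW : t ∉ W := fun h => Set.disjoint_left.1 hZ.disj_WS h htT
  have hzA' : z ∉ A' := fun h => Set.disjoint_left.1 hA.disj hzA h
  have hsA' : s ∉ A' := fun h => Set.disjoint_left.1 hA.disj hsA h
  have hTX : T ⊆ X := by rw [← cZ]; intro x hx; exact Or.inl (Or.inr hx)
  have hT'X : T' ⊆ X := by rw [← cA]; intro x hx; exact Or.inl (Or.inr hx)
  have hZX : Z ⊆ X := by rw [← cZ]; intro x hx; exact Or.inl (Or.inl hx)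
  have hA'X : A' ⊆ X := by rw [← cA]; intro x hx; exact Or.inr hx
  have hAX : A ⊆ X := by rw [← cA]; intro x hx; exact Or.inl (Or.inl hx)
  have n1 := ncard_partition hA cA hTX
  have n2 := ncard_partition hZ cZ hT'X
  have n3 := ncard_partition hA cA hZX
  have n4 := ncard_partition hZ cZ hA'X
  have n5 := ncard_partition hZ cZ hAX
  rw [Set.inter_comm T' Z, Set.inter_comm T' T, Set.inter_comm T' W] at n2
  rw [Set.inter_comm A' Z, Set.inter_comm A' T, Set.inter_comm A' W] at n4
  rw [Set.inter_comm A Z, Set.inter_comm A T, Set.inter_comm A W] at n5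
  have hZAs : 0 < (Z ∩ A).ncard := (Set.ncard_pos).2 ⟨s, hs, hsA⟩
  have hTA' : 0 < (T ∩ A').ncard := (Set.ncard_pos).2 ⟨t, htT, htA⟩
  have m1 := hγ A T' A' hA cA hT'.le ⟨s, hsA⟩ ⟨t, htA⟩
  have m2 := hγ A' T' A hA.symm cA' hT'.le ⟨t, htA⟩ ⟨s, hsA⟩
  have k1 : (W ∩ A).ncard ≠ 0 → 2 ≤ (W ∩ T').ncard + (T ∩ A).ncard + (T ∩ T').ncard := by
    intro hne
    obtain ⟨hc, hcc⟩ := hZ'.symm.cross hA' cZ' cA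
    have h1 := hc.insert_edge hcc (hG hf) (fun h => hsW h.1) (fun h => htW h.1)
    rw [Set.pair_comm, insert_sdiff_pair hf hef.symm] at h1
    exact (hβ _ _ _ h1 hcc ((Set.ncard_pos).1 (Nat.pos_of_ne_zero hne)) ⟨s, Or.inl hs⟩).trans
      (ncard_cross_le W T A T')
  have k2 : (W ∩ A').ncard ≠ 0 → 2 ≤ (W ∩ T').ncard + (T ∩ A').ncard + (T ∩ T').ncard := by
    intro hne
    obtain ⟨hc, hcc⟩ := hZ'.symm.cross hA'.symm cZ' cA'
    have h1 := hc.insert_edge hcc (hG hf) (fun h => hsW h.1) (fun h => htW h.1)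
    rw [Set.pair_comm, insert_sdiff_pair hf hef.symm] at h1
    exact (hβ _ _ _ h1 hcc ((Set.ncard_pos).1 (Nat.pos_of_ne_zero hne)) ⟨s, Or.inl hs⟩).trans
      (ncard_cross_le W T A' T')
  by_cases hZA' : (Z ∩ A').ncard = 0
  · have h2 : 2 ≤ (Z ∩ T').ncard := by
      obtain ⟨u₁, hu₁, u₂, hu₂, hne, e₁, e₂⟩ := hN
      have key : ∀ u ∈ Z, s(u, t) ∈ G \ {s(s, t)} → u ∈ Z ∩ T' := by
        intro u hu hut
        refine ⟨hu, ?_⟩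
        have := hZX hu
        rw [← cA] at this
        rcases this with (h | h) | h
        · exact (hA.notMem u h t htA hut).elim
        · exact h
        · rw [Set.ncard_eq_zero] at hZA'
          have : u ∈ Z ∩ A' := ⟨hu, h⟩
          rw [hZA'] at this; exact this.elim
      exact (Set.one_lt_ncard (Set.toFinite _)).2 ⟨u₁, key u₁ hu₁ e₁, u₂, key u₂ hu₂ e₂, hne⟩
    by_cases hWA' : (W ∩ A').ncard = 0
    · omega
    · have := k2 hWA'
      by_cases hWA : (W ∩ A).ncard = 0
      · omega
      · have := k1 hWA
        omega
  · obtain ⟨hc, hcc⟩ := hZ'.cross hA'.symm cZ cA'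
    have h1 := hc.insert_edge hcc (hG he) (fun h => hzA' h.2) (fun h => hwZ h.1)
    rw [insert_sdiff_pair he hef] at h1
    have h2 := h1.insert_edge hcc (hG hf) (fun h => hsA' h.2) (fun h => htZ h.1)
    rw [Set.insert_sdiff_self_of_mem hf] at h2
    have h3 := (hα _ _ _ h2 hcc ((Set.ncard_pos).1 (Nat.pos_of_ne_zero hZA')) ⟨w, Or.inl hw⟩).trans
      (ncard_cross_le Z T A' T')
    by_cases hWA : (W ∩ A).ncard = 0
    · omega
    · have := k1 hWA
      omega

lemma mem_verts_of_degree {F : Set (Sym2 V)} {v : V} (h : 0 < (starAt F v).ncard) :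
    v ∈ verts F := by
  obtain ⟨e, he, hv⟩ := (Set.ncard_pos).1 h
  exact ⟨e, he, hv⟩

lemma ncard_starAt_sdiff_le (F : Set (Sym2 V)) (v : V) (e : Sym2 V) :
    (starAt F v).ncard ≤ (starAt (F \ {e}) v).ncard + 1 := by
  have h : starAt F v ⊆ insert e (starAt (F \ {e}) v) := fun f hf => by
    by_cases h : f = e
    · exact Or.inl h
    · exact Or.inr ⟨⟨hf.1, h⟩, hf.2⟩
  exact (Set.ncard_le_ncard h).trans (Set.ncard_insert_le _ _)

/-- A three-connected, matroid-connected graph of minimum degree four stays so after the deletion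
of a suitable edge. -/
theorem exists_deletion {G : Set (Sym2 V)} {X : Set V} (hM : MConn 𝓜 G) (h3 : Conn3 G X)
    (hdeg : ∀ v ∈ X, 4 ≤ (starAt G v).ncard) :
    ∃ e ∈ G, MConn 𝓜 (G \ {e}) ∧ Conn3 (G \ {e}) X := by
  by_contra! hcon
  have hGX := h3.1
  have hV1 : ∀ e, verts (G \ {e}) = X := fun e => by
    refine Set.Subset.antisymm (verts_subset (Set.sdiff_subset.trans hGX)) fun v hv => ?_
    have h1 := ncard_starAt_sdiff_le G v e
    have h2 := hdeg v hv
    exact mem_verts_of_degree (by omega)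
  have hα : ∀ P S Q, Separates G P S Q → P ∪ S ∪ Q = X → P.Nonempty → Q.Nonempty →
      3 ≤ S.ncard := by
    intro P S Q h hX hP hQ
    by_contra hlt
    exact h3.2.2 P S Q h hX (by omega) hP hQ
  have hβ : ∀ e, MConn 𝓜 (G \ {e}) → ∀ P S Q, Separates (G \ {e}) P S Q → P ∪ S ∪ Q = X →
      P.Nonempty → Q.Nonempty → 2 ≤ S.ncard := by
    rintro e hM P S Q h hX ⟨u, hu⟩ ⟨w, hw⟩
    refine hM.two_le_of_separates h (mem_incident_of_mem_verts hu ?_)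
      (mem_incident_of_mem_verts hw ?_)
    · rw [hV1, ← hX]; exact Or.inl (Or.inl hu)
    · rw [hV1, ← hX]; exact Or.inr hw
  have hex : ∀ e ∈ G, MConn 𝓜 (G \ {e}) → ∃ Z T W, Separates (G \ {e}) Z T W ∧ Z ∪ T ∪ W = X ∧
      T.ncard ≤ 2 ∧ Z.Nonempty ∧ W.Nonempty := by
    intro e he hMe
    have := hcon e he hMe
    by_contra! h
    exact this ⟨Set.sdiff_subset.trans hGX, h3.2.1, fun Z S W h1 h2 h4 h5 h6 => by
      have := h Z S W h1 h2 h4 h5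
      rw [this] at h6
      exact Set.not_nonempty_empty h6⟩
  have hcross : ∀ e ∈ G, MConn 𝓜 (G \ {e}) → ∀ Z T W, Separates (G \ {e}) Z T W →
      Z ∪ T ∪ W = X → T.ncard ≤ 2 → Z.Nonempty → W.Nonempty →
      T.ncard = 2 ∧ ∃ z ∈ Z, ∃ w ∈ W, e = s(z, w) := by
    intro e he hMe Z T W h hX hT hZ hW
    have h2 := hβ e hMe Z T W h hX hZ hW
    refine ⟨by omega, ?_⟩
    by_contra! hno
    refine h3.2.2 Z T W ⟨by rw [hX]; exact hGX, h.disj_ZS, h.disj_WS, h.disj,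
      fun z hz w hw hzw => h.notMem z hz w hw ⟨hzw, fun h => hno z hz w hw h.symm⟩⟩ hX hT hZ hW
  obtain ⟨e₀, he₀, hMe₀⟩ : ∃ e ∈ G, MConn 𝓜 (G \ {e}) := by
    obtain ⟨g, hg⟩ := hM.1
    induction g with | _ a b =>
    obtain ⟨f, hf, -, h⟩ := exists_removable hM hg (left_mem_verts hg)
      (fun v hv _ _ _ => hdeg v (verts_subset hGX hv))
    exact ⟨f, hf, h⟩
  obtain ⟨Z, ⟨e, T, W, he, hMe, hZ, cZ, hT, hZn, hWn⟩, hmin⟩ := Set.exists_min_image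
    {Z : Set V | ∃ e T W, e ∈ G ∧ MConn 𝓜 (G \ {e}) ∧ Separates (G \ {e}) Z T W ∧
      Z ∪ T ∪ W = X ∧ T.ncard ≤ 2 ∧ Z.Nonempty ∧ W.Nonempty} Set.ncard (Set.toFinite _) (by
    obtain ⟨Z, T, W, h⟩ := hex e₀ he₀ hMe₀
    exact ⟨Z, e₀, T, W, he₀, hMe₀, h⟩)
  obtain ⟨hT2, z, hz, w, hw, rfl⟩ := hcross e he hMe Z T W hZ cZ hT hZn hWn
  obtain ⟨x, y, hxy, rfl⟩ := Set.ncard_eq_two.1 hT2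
  have hinZ : (incident (G \ {s(z, w)}) Z).Nonempty := mem_incident_of_mem_verts hz (by
    rw [hV1, ← cZ]; exact Or.inl (Or.inl hz))
  have hinW : (incident (G \ {s(z, w)}) W).Nonempty := mem_incident_of_mem_verts hw (by
    rw [hV1, ← cZ]; exact Or.inr hw)
  have hL := hMe.side hxy hZ hinZ hinW
  have hLW := hMe.side hxy hZ.symm hinW hinZ
  have hwZ : w ∉ Z := fun h => Set.disjoint_left.1 hZ.disj h hw
  obtain ⟨f, hfL, hfxy, hLf⟩ := exists_removable hL (Set.mem_insert _ _) (z := z) (by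
      obtain ⟨g, hg, hzg⟩ : z ∈ verts (G \ {s(z, w)}) := by
        rw [hV1, ← cZ]; exact Or.inl (Or.inl hz)
      exact ⟨g, Or.inr ⟨hg, z, hz, hzg⟩, hzg⟩) (by
    intro v hv hvx hvy hvz
    have hvZ : v ∈ Z := by
      have := verts_subset (Set.insert_subset (mk_mem_edgesOn.2 ⟨hxy, by simp, by simp⟩)
        hZ.incident_subset) hv
      rcases this with h | h | h
      · exact h
      · exact (hvx h).elim
      · exact (hvy h).elim
    refine (hdeg v (by rw [← cZ]; exact Or.inl (Or.inl hvZ))).trans (Set.ncard_le_ncard ?_)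
    rintro g ⟨hg, hvg⟩
    refine ⟨Or.inr ⟨⟨hg, ?_⟩, v, hvZ, hvg⟩, hvg⟩
    rintro rfl
    rcases Sym2.mem_iff.1 hvg with h | h
    · exact hvz h
    · exact hwZ (h ▸ hvZ))
  have hfi : f ∈ incident (G \ {s(z, w)}) Z := hfL.resolve_left hfxy
  have hfG : f ∈ G := hfi.1.1
  have hfe : f ≠ s(z, w) := hfi.1.2
  have hMf : MConn 𝓜 (G \ {f}) := by
    have hs' := hZ.mono (F' := G \ {s(z, w), f}) fun g hg => ⟨hg.1, fun h => hg.2 (Or.inl h)⟩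
    have e₁ : insert s(x, y) (incident (G \ {s(z, w)}) Z) \ {f}
        = insert s(x, y) (incident (G \ {s(z, w), f}) Z) := by
      ext g
      constructor
      · rintro ⟨h | h, hgf⟩
        · exact Or.inl h
        · refine Or.inr ⟨⟨h.1.1, ?_⟩, h.2⟩
          rintro (h' | h')
          · exact h.1.2 h'
          · exact hgf h'
      · rintro (h | h)
        · exact ⟨Or.inl h, fun h' => hfxy (by rw [← h, ← Set.mem_singleton_iff.1 h'])⟩
        · exact ⟨Or.inr ⟨⟨h.1.1, fun h' => h.1.2 (Or.inl h')⟩, h.2⟩, fun h' => h.1.2 (Or.inr h')⟩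
    have e₂ : incident (G \ {s(z, w)}) W = incident (G \ {s(z, w), f}) W := by
      ext g
      constructor
      · intro h
        refine ⟨⟨h.1.1, ?_⟩, h.2⟩
        rintro (h' | h')
        · exact h.1.2 h'
        · rw [Set.mem_singleton_iff] at h'
          subst h'
          exact Set.disjoint_left.1 hZ.disjoint_incident hfi h
      · exact fun h => ⟨⟨h.1.1, fun h' => h.1.2 (Or.inl h')⟩, h.2⟩
    rw [e₁] at hLf
    rw [e₂] at hLW hinW
    have hn : (incident (G \ {s(z, w), f}) Z).Nonempty := by
      obtain ⟨C, hCs, hC, -, -⟩ := hLf.2 _ (Set.mem_insert _ _) _ (Set.mem_insert _ _)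
      obtain ⟨g, hg, hgx⟩ := exists_ne_mem_of_isCircuit hC s(x, y)
      exact ⟨g, (hCs hg).resolve_left hgx⟩
    have h1 := MConn.of_sides hs' hn hinW hLf hLW
    have hv : ∀ v ∈ X, v ∈ verts (G \ {s(z, w), f}) := by
      intro v hv
      have h1 := ncard_starAt_sdiff_le G v s(z, w)
      have h2 := ncard_starAt_sdiff_le (G \ {s(z, w)}) v f
      have h3 := hdeg v hv
      rw [Set.sdiff_sdiff, Set.singleton_union] at h2
      exact mem_verts_of_degree (by omega)
    have hzw := mk_mem_edgesOn.1 (hGX he)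
    have h2 := h1.insert_edge hzw.1 (hv z hzw.2.1) (hv w hzw.2.2)
    rwa [insert_sdiff_pair he hfe.symm] at h2
  obtain ⟨-, s, hs, hsf⟩ := id hfi
  obtain ⟨t, rfl⟩ := eq_mk_of_mem hsf
  have hst := mk_mem_edgesOn.1 (hZ.incident_subset hfi)
  obtain ⟨A, T', A', hA, cA, hT', hsA, htA⟩ : ∃ A T' A', Separates (G \ {s(s, t)}) A T' A' ∧
      A ∪ T' ∪ A' = X ∧ T'.ncard = 2 ∧ s ∈ A ∧ t ∈ A' := by
    obtain ⟨A, T', A', hA, cA, hT', hAn, hA'n⟩ := hex _ hfG hMf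
    obtain ⟨h2, u, hu, u', hu', h⟩ := hcross _ hfG hMf A T' A' hA cA hT' hAn hA'n
    rcases Sym2.eq_iff.1 h with ⟨rfl, rfl⟩ | ⟨rfl, rfl⟩
    · exact ⟨A, T', A', hA, cA, h2, hu, hu'⟩
    · exact ⟨A', T', A, hA.symm, by rw [← cA]; ext x; simp only [Set.mem_union]; tauto, h2, hu', hu⟩
  have hγ : ∀ P S Q, Separates (G \ {s(s, t)}) P S Q → P ∪ S ∪ Q = X → S.ncard ≤ 2 →
      P.Nonempty → Q.Nonempty → Z.ncard ≤ P.ncard := fun P S Q h1 h2 h4 h5 h6 =>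
    hmin P ⟨_, S, Q, hfG, hMf, h1, h2, h4, h5, h6⟩
  have htW : t ∉ W := fun h => by
    rcases hst.2.2 with h' | h'
    · exact Set.disjoint_left.1 hZ.disj h' h
    · exact Set.disjoint_left.1 hZ.disj_WS h h'
  by_cases hzA : z ∈ A
  · rcases hst.2.2 with htZ | htT
    · have hzA' : z ∉ A' := fun h => Set.disjoint_left.1 hA.disj hzA h
      have hsW : s ∉ W := fun h => Set.disjoint_left.1 hZ.disj hs h
      have hts : s(s, t) = s(t, s) := Sym2.eq_swap
      rw [hts] at hA hfG hfe hγ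
      exact uncross hZ hA.symm cZ (by rw [← cA]; ext x; simp only [Set.mem_union]; tauto) hT2 hT' he
        hfG hfe.symm hGX hz hw htZ htA hsA hsW hzA' (hβ _ hMe) hγ
    · refine uncross_inner hZ hA cZ cA hT2 hT' he hfG hfe.symm hGX hw hs hsA htA htT hzA hα
        (hβ _ hMe) hγ ?_
      have htZ : t ∉ Z := fun h => Set.disjoint_left.1 hZ.disj_ZS h htT
      have htv : t ∈ verts (insert s(x, y) (incident (G \ {s(z, w)}) Z) \ {s(s, t)}) :=
        ⟨s(x, y), ⟨Set.mem_insert _ _, fun h => hfxy h.symm⟩, by simpa using htT⟩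
      have hd := hLf.three_le_degree htv
      have hd' := ncard_starAt_sdiff_le (insert s(x, y) (incident (G \ {s(z, w)}) Z) \ {s(s, t)})
        t s(x, y)
      obtain ⟨g₁, hg₁, g₂, hg₂, hne⟩ := (Set.one_lt_ncard (Set.toFinite _)).1
        (show 1 < (starAt ((insert s(x, y) (incident (G \ {s(z, w)}) Z) \ {s(s, t)}) \ {s(x, y)})
          t).ncard by omega)
      have key : ∀ g ∈ starAt ((insert s(x, y) (incident (G \ {s(z, w)}) Z) \ {s(s, t)}) \
          {s(x, y)}) t, ∃ u ∈ Z, g = s(u, t) ∧ s(u, t) ∈ G \ {s(s, t)} := by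
        rintro g ⟨⟨⟨hg, hgf⟩, hgx⟩, htg⟩
        have hg := hg.resolve_left hgx
        obtain ⟨u, rfl⟩ := eq_mk_of_mem htg
        obtain ⟨v, hv, hvg⟩ := hg.2
        refine ⟨u, ?_, Sym2.eq_swap, ?_⟩
        · rcases Sym2.mem_iff.1 hvg with rfl | rfl
          · exact (htZ hv).elim
          · exact hv
        · have hut : s(u, t) = s(t, u) := Sym2.eq_swap
          rw [hut]; exact ⟨hg.1.1, hgf⟩
      obtain ⟨u₁, hu₁, rfl, k₁⟩ := key g₁ hg₁
      obtain ⟨u₂, hu₂, rfl, k₂⟩ := key g₂ hg₂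
      exact ⟨u₁, hu₁, u₂, hu₂, fun h => hne (by rw [h]), k₁, k₂⟩
  · exact uncross hZ hA cZ cA hT2 hT' he hfG hfe.symm hGX hz hw hs hsA htA htW hzA (hβ _ hMe) hγ

end ThreeConnected

/-! ### Replacing a degree-three vertex by a triangle -/

section YDelta

variable {V : Type*} [Fintype V] [DecidableEq V]

local notation "𝓜" => rigidityMatroid V

lemma IsGeneric.exists_stress {p : V → Fin 3 → ℝ} (hp : IsGeneric p) {C : Set (Sym2 V)}
    (hC : (𝓜).IsCircuit C) {i j : V} (hij : s(i, j) ∈ C) : ∃ K ∈ stressSpace p C, K i j ≠ 0 := by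
  by_contra! h
  refine hC.not_indep ⟨hC.subset_ground, p, (Submodule.eq_bot_iff _).2 fun K hK => ?_⟩
  have hK' : K ∈ stressSpace p (C \ {s(i, j)}) := by
    refine mem_stressSpace_of_eq_zero hK fun k l _ hm hn => ?_
    have : s(k, l) = s(i, j) := by
      by_contra h'
      exact hn ⟨hm, h'⟩
    rcases Sym2.eq_iff.1 this with ⟨rfl, rfl⟩ | ⟨rfl, rfl⟩
    · exact h K hK
    · rw [hK.1.1]; exact h K hK
  rw [hp.2 _ (hC.sdiff_singleton_indep hij).2] at hK'
  simpa using hK'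

lemma IsGeneric.exists_isCircuit {p : V → Fin 3 → ℝ} (hp : IsGeneric p) {F : Set (Sym2 V)}
    (hF : ∀ e ∈ F, ¬ e.IsDiag) {K : Matrix V V ℝ} (hK : K ∈ stressSpace p F) {i j : V} (hij : i ≠ j)
    (h0 : K i j ≠ 0) : ∃ C ⊆ F, (𝓜).IsCircuit C ∧ s(i, j) ∈ C := by
  have he : s(i, j) ∈ F := by
    by_contra h
    exact h0 (hK.1.2 i j hij h)
  obtain ⟨I, hI⟩ := (𝓜).exists_isBasis (F \ {s(i, j)})
    (Set.sdiff_subset.trans (subset_ground_iff.2 hF))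
  have heI : s(i, j) ∉ I := fun h => (hI.subset h).2 rfl
  have hcl : s(i, j) ∈ (𝓜).closure I := by
    by_contra hcl
    have hins := ((hI.indep.notMem_closure_iff (hF _ he)).1 hcl).1
    have hmap := map_stressMap_le (p := p) (I := I) (Set.toFinite (F \ {s(i, j)}))
      (fun e he => hF e he.1) (fun e he heI => by
        by_contra! h2
        refine hI.indep.mem_closure_iff.1 (hI.subset_closure he) |>.elim (fun hd => hd.not_indep
          ⟨?_, p, (Submodule.eq_bot_iff _).2 fun K hK => ?_⟩) heI
        · rintro f (rfl | hf)
          · exact hF _ he.1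
          · exact hI.indep.1 f hf
        · have h3 : K ∈ stressSpace p I := ⟨h2 K hK, hK.2⟩
          rw [hp.2 I hI.indep.2] at h3
          simpa using h3)
    have hK1 : K ∈ patternSpace (insert s(i, j) (F \ {s(i, j)})) := by
      rw [Set.insert_sdiff_self_of_mem he]; exact hK.1
    obtain ⟨K', hK', hf⟩ := hmap _ (sub_smul_edgeMat_mem hK1)
    have hmem : K' + K i j • edgeMat s(i, j) ∈ stressSpace p (insert s(i, j) I) := by
      refine ⟨add_mem (patternSpace_mono (Set.subset_insert _ _) hK')
        (Submodule.smul_mem _ _ (edgeMat_mem (Set.mem_insert _ _))), fun k => ?_⟩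
      have := hf k
      rw [sum_sub_row, hK.2, zero_sub] at this
      rw [sum_add_row, ← this, neg_add_cancel]
    rw [hp.2 _ hins.2, Submodule.mem_bot] at hmem
    have := congrFun (congrFun hmem i) j
    simp [edgeMat_apply, hK'.2 i j hij heI] at this
    exact h0 this
  obtain ⟨C, hCs, hC, heC⟩ := Matroid.exists_isCircuit_of_mem_closure hcl heI
  exact ⟨C, hCs.trans (Set.insert_subset he (hI.subset.trans Set.sdiff_subset)), hC, heC⟩

lemma GenPos.exists_coords {p : V → Fin 3 → ℝ} (hp : GenPos p) {a b c : V} (hab : a ≠ b)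
    (hac : a ≠ c) (hbc : b ≠ c) (w : Fin 3 → ℝ) :
    ∃ α β γ : ℝ, w = α • p a + β • p b + γ • p c := by
  obtain ⟨x, hx⟩ := (LinearMap.injective_iff_surjective (f := tripleMap a b c p)).1
    (tripleMap_injective_iff.2 (hp a b c hab hac hbc)) w
  exact ⟨x 0, x 1, x 2, hx.symm⟩

lemma Conn3.three_le_degree {F : Set (Sym2 V)} {X : Set V} (h : Conn3 F X) {v : V} (hv : v ∈ X) :
    3 ≤ (starAt F v).ncard := by
  by_contra hlt
  let N : Set V := {u | s(v, u) ∈ F}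
  have hvN : v ∉ N := fun hm => (h.1 hm).1 (by simp)
  have hNX : N ⊆ X := fun u hu => (mk_mem_edgesOn.1 (h.1 hu)).2.2
  have hN : N.ncard ≤ (starAt F v).ncard := by
    refine Set.ncard_le_ncard_of_injOn (fun u => s(v, u)) (fun u hu => ⟨hu, by simp⟩) ?_
    intro u _ u' _ huu
    exact Sym2.congr_right.1 huu
  have hcov : {v} ∪ N ∪ (X \ ({v} ∪ N)) = X :=
    Set.union_sdiff_cancel (Set.union_subset (by simpa using hv) hNX)
  refine h.2.2 {v} N (X \ ({v} ∪ N)) ⟨by rw [hcov]; exact h.1, by simpa using hvN,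
    Set.disjoint_left.2 fun u hu hu' => hu.2 (Or.inr hu'),
    Set.disjoint_left.2 fun u hu hu' => hu'.2 (Or.inl hu), ?_⟩ hcov (by omega) (by simp) ?_
  · rintro z rfl w hw hm
    exact hw.2 (Or.inr hm)
  · by_contra hne
    rw [Set.not_nonempty_iff_eq_empty, Set.sdiff_eq_empty] at hne
    have h1 := Set.ncard_le_ncard hne
    have h2 := Set.ncard_union_le {v} N
    rw [Set.ncard_singleton] at h2
    have := h.2.1
    omega

lemma Conn3.verts_eq {F : Set (Sym2 V)} {X : Set V} (h : Conn3 F X) : verts F = X :=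
  Set.Subset.antisymm (verts_subset h.1) fun v hv => mem_verts_of_degree
    (lt_of_lt_of_le (by norm_num) (h.three_le_degree hv))

/-- The graph obtained from `F` by replacing the degree-three vertex `v` by a triangle. -/
def yDelta (F : Set (Sym2 V)) (v a b c : V) : Set (Sym2 V) := (F \ starAt F v) ∪ tri a b c

lemma IsClawAt.tri_subset {F : Set (Sym2 V)} {X : Set V} {v a b c : V} (h : IsClawAt F v a b c)
    (hF : F ⊆ edgesOn X) : tri a b c ⊆ edgesOn (X \ {v}) := by
  have ha := (mk_mem_edgesOn.1 (hF (h.claw_subset (Or.inl rfl)))).2.2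
  have hb := (mk_mem_edgesOn.1 (hF (h.claw_subset (Or.inr (Or.inl rfl))))).2.2
  have hc := (mk_mem_edgesOn.1 (hF (h.claw_subset (Or.inr (Or.inr rfl))))).2.2
  rintro e (rfl | rfl | rfl) <;> rw [mk_mem_edgesOn]
  · exact ⟨h.ab, ⟨ha, h.va.symm⟩, hb, h.vb.symm⟩
  · exact ⟨h.bc, ⟨hb, h.vb.symm⟩, hc, h.vc.symm⟩
  · exact ⟨h.ac, ⟨ha, h.va.symm⟩, hc, h.vc.symm⟩

lemma sdiff_starAt_subset {F : Set (Sym2 V)} {X : Set V} (hF : F ⊆ edgesOn X) (v : V) :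
    F \ starAt F v ⊆ edgesOn (X \ {v}) := fun e he => ⟨(hF he.1).1, fun x hx =>
  ⟨(hF he.1).2 x hx, by rintro rfl; exact he.2 ⟨he.1, hx⟩⟩⟩

lemma IsClawAt.yDelta_subset {F : Set (Sym2 V)} {X : Set V} {v a b c : V} (h : IsClawAt F v a b c)
    (hF : F ⊆ edgesOn X) : yDelta F v a b c ⊆ edgesOn (X \ {v}) :=
  Set.union_subset (sdiff_starAt_subset hF v) (h.tri_subset hF)

lemma Conn3.yDelta {F : Set (Sym2 V)} {X : Set V} (h3 : Conn3 F X) {v a b c : V}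
    (h : IsClawAt F v a b c) (hX : 5 ≤ X.ncard) : Conn3 (yDelta F v a b c) (X \ {v}) := by
  have hvX : v ∈ X := (mk_mem_edgesOn.1 (h3.1 (h.claw_subset (Or.inl rfl)))).2.1
  have hc : (X \ {v}).ncard + 1 = X.ncard := Set.ncard_sdiff_singleton_add_one hvX
  refine ⟨h.yDelta_subset h3.1, by omega, ?_⟩
  have key : ∀ Z S W, Separates (_root_.yDelta F v a b c) Z S W → Z ∪ S ∪ W = X \ {v} →
      S.ncard ≤ 2 → Z.Nonempty → W.Nonempty → a ∉ W → b ∉ W → c ∉ W → False := by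
    intro Z S W hs hc hS hZ hW ha hb hc'
    have hv : v ∉ Z ∪ S ∪ W := by rw [hc]; simp
    simp only [Set.mem_union, not_or] at hv
    have hcov : insert v Z ∪ S ∪ W = X := by
      rw [Set.insert_union, Set.insert_union, hc, Set.insert_sdiff_self_of_mem hvX]
    refine h3.2.2 (insert v Z) S W ⟨by rw [hcov]; exact h3.1, ?_, hs.disj_WS, ?_, ?_⟩ hcov hS
      (Set.insert_nonempty _ _) hW
    · exact Set.disjoint_insert_left.2 ⟨hv.1.2, hs.disj_ZS⟩
    · exact Set.disjoint_insert_left.2 ⟨hv.2, hs.disj⟩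
    · rintro z (rfl | hz) w hw hm
      · rcases h.mem_iff.1 hm with rfl | rfl | rfl
        · exact ha hw
        · exact hb hw
        · exact hc' hw
      · refine hs.notMem z hz w hw (Or.inl ⟨hm, fun hst => ?_⟩)
        rcases Sym2.mem_iff.1 hst.2 with rfl | rfl
        · exact hv.1.1 hz
        · exact hv.2 hw
  intro Z S W hs hc hS hZ hW
  have t1 : s(a, b) ∈ _root_.yDelta F v a b c := Or.inr (Or.inl rfl)
  have t2 : s(b, c) ∈ _root_.yDelta F v a b c := Or.inr (Or.inr (Or.inl rfl))
  have t3 : s(a, c) ∈ _root_.yDelta F v a b c := Or.inr (Or.inr (Or.inr rfl))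
  have t1' : s(b, a) ∈ _root_.yDelta F v a b c := by rw [Sym2.eq_swap]; exact t1
  have t2' : s(c, b) ∈ _root_.yDelta F v a b c := by rw [Sym2.eq_swap]; exact t2
  have t3' : s(c, a) ∈ _root_.yDelta F v a b c := by rw [Sym2.eq_swap]; exact t3
  have hd := fun x (hx : x ∈ Z) => Set.disjoint_left.1 hs.disj hx
  by_cases hcase : a ∈ Z ∨ b ∈ Z ∨ c ∈ Z
  · refine key Z S W hs hc hS hZ hW ?_ ?_ ?_
    · intro hw
      rcases hcase with h | h | h
      · exact hd a h hw
      · exact hs.notMem b h a hw t1'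
      · exact hs.notMem c h a hw t3'
    · intro hw
      rcases hcase with h | h | h
      · exact hs.notMem a h b hw t1
      · exact hd b h hw
      · exact hs.notMem c h b hw t2'
    · intro hw
      rcases hcase with h | h | h
      · exact hs.notMem a h c hw t3
      · exact hs.notMem b h c hw t2
      · exact hd c h hw
  · push Not at hcase
    exact key W S Z hs.symm (by rw [← hc]; ext x; simp only [Set.mem_union]; tauto) hS hW hZ
      hcase.1 hcase.2.1 hcase.2.2

lemma IsClawAt.of_isCircuit {F C : Set (Sym2 V)} {v a b c : V} (h : IsClawAt F v a b c)
    (hC : (𝓜).IsCircuit C) (hCF : C ⊆ F) (hv : v ∈ verts C) : IsClawAt C v a b c := by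
  refine ⟨h.va, h.vb, h.vc, h.ab, h.ac, h.bc, ?_⟩
  rw [← h.star]
  refine Set.eq_of_subset_of_ncard_le (fun e he => ⟨hCF he.1, he.2⟩) ?_
  rw [h.ncard]
  exact three_le_degree_of_isCircuit hC hv

lemma MConn.exists_isCircuit_tri {F : Set (Sym2 V)} (hF : MConn 𝓜 F) {v a b c : V}
    (h : IsClawAt F v a b c) {f : Sym2 V} (hf : f ∈ yDelta F v a b c) (hft : f ∉ tri a b c) :
    ∃ D ⊆ yDelta F v a b c, (𝓜).IsCircuit D ∧ f ∈ D ∧ ∃ g ∈ tri a b c, g ∈ D := by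
  have hfF := hf.resolve_right hft
  obtain ⟨C, hCF, hC, hfC, hvC⟩ := hF.2 f hfF.1 _ (h.claw_subset (Or.inl rfl))
  have hcl := h.of_isCircuit hC hCF (left_mem_verts hvC)
  induction f with | _ i j =>
  obtain ⟨p, hp⟩ := exists_isGeneric (V := V)
  obtain ⟨K, hK, hK0⟩ := hp.exists_stress hC hfC
  obtain ⟨α, β, γ, hpv⟩ := hp.1.exists_coords h.ab h.ac h.bc (p v)
  have h1 := (hcl.sub_mem (hp.1 a b c h.ab h.ac h.bc) hpv hK).1
  have hij : i ≠ j := fun hij => hC.subset_ground hfC (by simp [hij])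
  have h2 : (vecMulVec (starVec v a b c α β γ) (starVec v a b c α β γ)) i j = 0 :=
    (vecMulVec_starVec_mem α β γ).2 i j hij (by
      rintro (hm | hm)
      · rw [← h.star] at hm; exact hfF.2 hm
      · exact hft hm)
  have hd : ∀ e ∈ (C \ starAt C v) ∪ tri a b c, ¬ e.IsDiag := by
    rintro e (he | he)
    · exact hC.subset_ground he.1
    · rcases he with rfl | rfl | rfl
      · simpa using h.ab
      · simpa using h.bc
      · simpa using h.ac
  obtain ⟨D, hDs, hD, hfD⟩ := hp.exists_isCircuit hd h1 hij (by simpa [h2] using hK0)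
  refine ⟨D, fun e he => ?_, hD, hfD, ?_⟩
  · rcases hDs he with he | he
    · exact Or.inl ⟨hCF he.1, fun hs => he.2 ⟨he.1, hs.2⟩⟩
    · exact Or.inr he
  · by_contra! hno
    have hDC : D ⊆ C := fun e he => ((hDs he).resolve_right fun ht => hno e ht he).1
    have := hD.eq_of_subset_isCircuit hC hDC
    rw [this] at hDs
    exact (hDs hvC).elim (fun hm => hm.2 ⟨hvC, by simp⟩) fun ht => hno _ ht (this ▸ hvC)

/-- `f` and `g` agree or lie on a common circuit contained in `F`. -/
def CircuitRel (F : Set (Sym2 V)) (f g : Sym2 V) : Prop :=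
  f = g ∨ ∃ D ⊆ F, (𝓜).IsCircuit D ∧ f ∈ D ∧ g ∈ D

lemma CircuitRel.symm {F : Set (Sym2 V)} {f g : Sym2 V} (h : CircuitRel F f g) :
    CircuitRel F g f :=
  h.imp Eq.symm fun ⟨D, h1, h2, h3, h4⟩ => ⟨D, h1, h2, h4, h3⟩

lemma CircuitRel.trans {F : Set (Sym2 V)} {f g k : Sym2 V} (h : CircuitRel F f g)
    (h' : CircuitRel F g k) : CircuitRel F f k := by
  rcases h with rfl | ⟨D, h1, h2, h3, h4⟩
  · exact h'
  · rcases h' with rfl | ⟨D', h1', h2', h3', hkD⟩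
    · exact Or.inr ⟨D, h1, h2, h3, h4⟩
    · exact Or.inr (exists_isCircuit_trans h2 h2' h1 h1' h3 h4 h3' hkD)

/-- The elements of `F` related to `g`. -/
def circuitClass (F : Set (Sym2 V)) (g : Sym2 V) : Set (Sym2 V) := {f ∈ F | CircuitRel F f g}

lemma circuitClass_rigid {F : Set (Sym2 V)} (hF : ∀ e ∈ F, ¬ e.IsDiag) {g : Sym2 V} (hg : g ∈ F) :
    edgesOn (verts (circuitClass F g)) ⊆ (𝓜).closure (circuitClass F g) := by
  by_cases hone : circuitClass F g = {g}
  · rw [hone]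
    induction g with | _ a b =>
    have : verts {s(a, b)} = {a, b} := by
      ext x; simp [verts]
    have hab : a ≠ b := by simpa using hF _ hg
    rw [this, edgesOn_pair hab]
    exact (𝓜).subset_closure _ (by simpa [rigidityMatroid_ground] using hab)
  · have hgm : g ∈ circuitClass F g := ⟨hg, Or.inl rfl⟩
    obtain ⟨f, hf, hfg⟩ : ∃ f ∈ circuitClass F g, f ≠ g := by
      by_contra! h
      exact hone (Set.Subset.antisymm (fun f hf => h f hf) (by simpa using hgm))
    have hsub : ∀ D ⊆ F, (𝓜).IsCircuit D → g ∈ D → D ⊆ circuitClass F g := fun D h1 h2 h3 e he =>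
      ⟨h1 he, Or.inr ⟨D, h1, h2, he, h3⟩⟩
    refine (mConn_of_forall hgm fun k hk => ?_ : MConn 𝓜 (circuitClass F g)).rigid
    rcases hk.2 with rfl | ⟨D, h1, h2, h3, h4⟩
    · obtain ⟨D, h1, h2, h3, h4⟩ := hf.2.resolve_left hfg
      exact ⟨D, hsub D h1 h2 h4, h2, h4, h4⟩
    · exact ⟨D, hsub D h1 h2 h4, h2, h4, h3⟩

lemma circuitRel_of_common_verts {F : Set (Sym2 V)} (hF : ∀ e ∈ F, ¬ e.IsDiag) {g g' : Sym2 V}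
    (hg : g ∈ F) (hg' : g' ∈ F) {u w : V} (huw : u ≠ w) (hu : u ∈ verts (circuitClass F g))
    (hw : w ∈ verts (circuitClass F g)) (hu' : u ∈ verts (circuitClass F g'))
    (hw' : w ∈ verts (circuitClass F g')) : CircuitRel F g g' := by
  have link : ∀ {f f' g g'}, f ∈ circuitClass F g → f' ∈ circuitClass F g' → CircuitRel F f f' →
      CircuitRel F g g' := fun hf hf' h => (hf.2.symm.trans h).trans hf'.2
  have hcl := circuitClass_rigid hF hg (mk_mem_edgesOn.2 ⟨huw, hu, hw⟩)
  have hcl' := circuitClass_rigid hF hg' (mk_mem_edgesOn.2 ⟨huw, hu', hw'⟩)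
  have one : ∀ {g g'}, s(u, w) ∈ circuitClass F g → s(u, w) ∈ (𝓜).closure (circuitClass F g') →
      CircuitRel F g g' := by
    intro g g' hm hcl
    by_cases hm' : s(u, w) ∈ circuitClass F g'
    · exact link hm hm' (Or.inl rfl)
    · obtain ⟨D, hDs, hD, heD⟩ := Matroid.exists_isCircuit_of_mem_closure hcl hm'
      obtain ⟨f, hf, hfe⟩ := exists_ne_mem_of_isCircuit hD s(u, w)
      exact link hm ((hDs hf).resolve_left hfe) (Or.inr ⟨D, hDs.trans (Set.insert_subset hm.1
        fun e he => he.1), hD, heD, hf⟩)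
  by_cases hm : s(u, w) ∈ circuitClass F g
  · exact one hm hcl'
  by_cases hm' : s(u, w) ∈ circuitClass F g'
  · exact (one hm' hcl).symm
  obtain ⟨D₁, s₁, c₁, e₁⟩ := Matroid.exists_isCircuit_of_mem_closure hcl hm
  obtain ⟨D₂, s₂, c₂, e₂⟩ := Matroid.exists_isCircuit_of_mem_closure hcl' hm'
  obtain ⟨f, hf, hfe⟩ := exists_ne_mem_of_isCircuit c₁ s(u, w)
  have hfg := (s₁ hf).resolve_left hfe
  by_cases hf₂ : f ∈ D₂
  · exact link hfg ((s₂ hf₂).resolve_left hfe) (Or.inl rfl)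
  obtain ⟨D, hDs, hD, hfD⟩ := c₁.strong_elimination c₂ e₁ e₂ hf hf₂
  have hDF : D ⊆ F := fun e he => by
    rcases (hDs he).1 with h | h
    · exact ((s₁ h).resolve_left (hDs he).2).1
    · exact ((s₂ h).resolve_left (hDs he).2).1
  obtain ⟨k, hk, hk₁⟩ : ∃ k ∈ D, k ∉ D₁ := by
    by_contra! hcon
    have := hD.eq_of_subset_isCircuit c₁ hcon
    exact (hDs (this ▸ e₁)).2 rfl
  exact link hfg ((s₂ ((hDs hk).1.resolve_left hk₁)).resolve_left (hDs hk).2)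
    (Or.inr ⟨D, hDF, hD, hfD, hk⟩)

lemma tri_rotate (a b c : V) : tri b c a = tri a b c := by
  ext e
  have h1 : s(c, a) = s(a, c) := Sym2.eq_swap
  have h2 : s(b, a) = s(a, b) := Sym2.eq_swap
  simp only [tri, Set.mem_insert_iff, Set.mem_singleton_iff, h1, h2]
  tauto

theorem MConn.yDelta {F : Set (Sym2 V)} (hF : MConn 𝓜 F) {v a b c : V} (h : IsClawAt F v a b c)
    {X : Set V} (h3 : Conn3 (yDelta F v a b c) X) : MConn 𝓜 (yDelta F v a b c) := by
  set F' := _root_.yDelta F v a b c with hF'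
  have hd : ∀ e ∈ F', ¬ e.IsDiag := fun e he => (h3.1 he).1
  have htri : tri a b c ⊆ F' := Set.subset_union_right
  have h1 : ∀ f ∈ F', ∃ g ∈ tri a b c, CircuitRel F' f g := by
    intro f hf
    by_cases hft : f ∈ tri a b c
    · exact ⟨f, hft, Or.inl rfl⟩
    · obtain ⟨D, s, c, m, g, hg, hgD⟩ := hF.exists_isCircuit_tri h hf hft
      exact ⟨g, hg, Or.inr ⟨D, s, c, m, hgD⟩⟩
  by_cases hcase : ∃ g ∈ tri a b c, ∃ g' ∈ tri a b c, g ≠ g' ∧ CircuitRel F' g g'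
  · obtain ⟨g, hg, g', hg', hne, hrel⟩ := hcase
    obtain ⟨D, hDs, hD, hgD, hgD'⟩ := hrel.resolve_left hne
    have hv : a ∈ verts D ∧ b ∈ verts D ∧ c ∈ verts D := by
      have hv1 : ∀ x ∈ g, x ∈ verts D := fun x hx => ⟨g, hgD, hx⟩
      have hv2 : ∀ x ∈ g', x ∈ verts D := fun x hx => ⟨g', hgD', hx⟩
      rcases hg with rfl | rfl | rfl <;> rcases hg' with rfl | rfl | rfl <;>
        first | exact absurd rfl hne | (refine ⟨?_, ?_, ?_⟩ <;>
          first | exact hv1 _ (Sym2.mem_mk_left _ _) | exact hv1 _ (Sym2.mem_mk_right _ _) |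
            exact hv2 _ (Sym2.mem_mk_left _ _) | exact hv2 _ (Sym2.mem_mk_right _ _))
    have m1 := hD.mConn.insert_edge h.ab hv.1 hv.2.1
    have m2 := m1.insert_edge h.bc (verts_mono (Set.subset_insert _ _) hv.2.1)
      (verts_mono (Set.subset_insert _ _) hv.2.2)
    have m3 := m2.insert_edge h.ac
      (verts_mono ((Set.subset_insert _ _).trans (Set.subset_insert _ _)) hv.1)
      (verts_mono ((Set.subset_insert _ _).trans (Set.subset_insert _ _)) hv.2.2)
    set D' := insert s(a, c) (insert s(b, c) (insert s(a, b) D)) with hD'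
    have hD'F : D' ⊆ F' := Set.insert_subset (htri (by simp [tri])) (Set.insert_subset
      (htri (by simp [tri])) (Set.insert_subset (htri (by simp [tri])) hDs))
    have htD : ∀ g ∈ tri a b c, g ∈ D' := by
      rintro g (rfl | rfl | rfl) <;> simp [hD']
    refine mConn_of_forall (htri (Or.inl rfl)) fun f hf => ?_
    obtain ⟨k, hk, hfk⟩ := h1 f hf
    obtain ⟨E, hE, hE2, hE3, hE4⟩ := m3.2 _ (htD _ (Or.inl rfl)) _ (htD k hk)
    rcases hfk with rfl | ⟨B, hB, hB2, hB3, hB4⟩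
    · exact ⟨E, hE.trans hD'F, hE2, hE3, hE4⟩
    · exact exists_isCircuit_trans hE2 hB2 (hE.trans hD'F) hB hE3 hE4 hB4 hB3
  · exfalso
    push Not at hcase
    have hsmall : ∀ a b c, a ≠ b → a ≠ c → b ≠ c → tri a b c ⊆ F' →
        (∀ f ∈ F', ∃ g ∈ tri a b c, CircuitRel F' f g) →
        (∀ g ∈ tri a b c, ∀ g' ∈ tri a b c, g ≠ g' → ¬ CircuitRel F' g g') →
        verts (circuitClass F' s(a, b)) ⊆ {a, b} := by
      intro a b c hab hac hbc htri h1 hcase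
      have t1 : s(a, b) ∈ tri a b c := Or.inl rfl
      have t2 : s(b, c) ∈ tri a b c := Or.inr (Or.inl rfl)
      have t3 : s(a, c) ∈ tri a b c := Or.inr (Or.inr rfl)
      have self : ∀ g ∈ tri a b c, g ∈ circuitClass F' g := fun g hg => ⟨htri hg, Or.inl rfl⟩
      have n12 : s(a, b) ≠ s(b, c) := by simp [hab, hac]
      have n13 : s(a, b) ≠ s(a, c) := by simp [hbc, hab.symm]
      have sh12 : ∀ u, u ∈ verts (circuitClass F' s(a, b)) →
          u ∈ verts (circuitClass F' s(b, c)) → u = b := by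
        intro u hu hu'
        by_contra hub
        exact hcase _ t1 _ t2 n12 (circuitRel_of_common_verts hd (htri t1) (htri t2) hub hu
          (right_mem_verts (self _ t1)) hu' (left_mem_verts (self _ t2)))
      have sh13 : ∀ u, u ∈ verts (circuitClass F' s(a, b)) →
          u ∈ verts (circuitClass F' s(a, c)) → u = a := by
        intro u hu hu'
        by_contra hua
        exact hcase _ t1 _ t3 n13 (circuitRel_of_common_verts hd (htri t1) (htri t3) hua hu
          (left_mem_verts (self _ t1)) hu' (left_mem_verts (self _ t3)))
      have hVX : verts (circuitClass F' s(a, b)) ⊆ X :=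
        verts_subset (fun e he => h3.1 he.1)
      have hav : a ∈ verts (circuitClass F' s(a, b)) := left_mem_verts (self _ t1)
      have hbv : b ∈ verts (circuitClass F' s(a, b)) := right_mem_verts (self _ t1)
      have hcv : c ∉ verts (circuitClass F' s(a, b)) := fun hc =>
        hbc (sh12 c hc (right_mem_verts (self _ t2))).symm
      have hcX : c ∈ X := (mk_mem_edgesOn.1 (h3.1 (htri t2))).2.2
      by_contra hns
      obtain ⟨u, hu, huab⟩ := Set.not_subset.1 hns
      have hpair : {a, b} ⊆ verts (circuitClass F' s(a, b)) := by
        rintro x (rfl | rfl) <;> assumption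
      have hcov : verts (circuitClass F' s(a, b)) \ {a, b} ∪ {a, b} ∪
          (X \ verts (circuitClass F' s(a, b))) = X := by
        rw [Set.sdiff_union_of_subset hpair, Set.union_sdiff_cancel hVX]
      refine h3.2.2 _ {a, b} _ ⟨by rw [hcov]; exact h3.1, Set.disjoint_sdiff_left,
        Set.disjoint_left.2 fun x hx hx' => hx.2 (hpair hx'),
        Set.disjoint_left.2 fun x hx hx' => hx'.2 hx.1, ?_⟩ hcov (Set.ncard_pair hab).le
        ⟨u, hu, huab⟩ ⟨c, hcX, hcv⟩
      intro z hz w hw hzw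
      obtain ⟨g, hg, hrel⟩ := h1 _ hzw
      have hm : s(z, w) ∈ circuitClass F' g := ⟨hzw, hrel⟩
      rcases hg with rfl | rfl | rfl
      · exact hw.2 (right_mem_verts hm)
      · exact hz.2 (Or.inr (sh12 z hz.1 (left_mem_verts hm)))
      · exact hz.2 (Or.inl (sh13 z hz.1 (left_mem_verts hm)))
    have v1 := hsmall a b c h.ab h.ac h.bc htri h1 hcase
    have v2 := hsmall b c a h.bc h.ab.symm h.ac.symm (by rwa [tri_rotate]) (by rwa [tri_rotate])
      (by rwa [tri_rotate])
    have v3 := hsmall c a b h.ac.symm h.bc.symm h.ab (by rwa [tri_rotate, tri_rotate])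
      (by rwa [tri_rotate, tri_rotate]) (by rwa [tri_rotate, tri_rotate])
    have hsub : X ⊆ {a, b, c} := by
      intro x hx
      rw [← h3.verts_eq] at hx
      obtain ⟨f, hf, hxf⟩ := hx
      obtain ⟨g, hg, hrel⟩ := h1 f hf
      have hm : x ∈ verts (circuitClass F' g) := ⟨f, ⟨hf, hrel⟩, hxf⟩
      rcases hg with rfl | rfl | rfl
      · rcases v1 hm with rfl | rfl <;> simp
      · rcases v2 hm with rfl | rfl <;> simp
      · have hca : s(a, c) = s(c, a) := Sym2.eq_swap
        rw [hca] at hm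
        rcases v3 hm with rfl | rfl <;> simp
    have hle := Set.ncard_le_ncard hsub
    have h4 := h3.2.1
    have : ({a, b, c} : Set V).ncard ≤ 3 := by
      rw [Set.ncard_eq_toFinset_card']
      simpa using Finset.card_le_three (a := a) (b := b) (c := c)
    omega

end YDelta

/-! ### Pinned stress matrices and the dimension of the stress space -/

section Pinned

open Topology Filter

variable {V : Type*} [Fintype V] [DecidableEq V]

local notation "𝓜" => rigidityMatroid V

open scoped Classical in
/-- The matrix that agrees with `K` on `Y` and with the identity elsewhere. -/
noncomputable def pin (K : Matrix V V ℝ) (Y : Set V) : Matrix V V ℝ :=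
  Matrix.of fun i j => if i ∈ Y ∧ j ∈ Y then K i j else if i = j then 1 else 0

lemma pin_mulVec_of_notMem (K : Matrix V V ℝ) {Y : Set V} (g : V → ℝ) {i : V} (hi : i ∉ Y) :
    (pin K Y *ᵥ g) i = g i := by
  simp only [mulVec, dotProduct, pin, of_apply]
  rw [Finset.sum_eq_single i]
  · simp [hi]
  · intro j _ hj; simp [hi, hj.symm]
  · simp

open scoped Classical in
lemma pin_mulVec_of_mem (K : Matrix V V ℝ) {Y : Set V} (g : V → ℝ) {i : V} (hi : i ∈ Y) :
    (pin K Y *ᵥ g) i = ∑ j, K i j * if j ∈ Y then g j else 0 := by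
  simp only [mulVec, dotProduct, pin, of_apply]
  refine Finset.sum_congr rfl fun j _ => ?_
  by_cases hj : j ∈ Y
  · simp [hi, hj]
  · have : i ≠ j := fun h => hj (h ▸ hi)
    simp [hj, this]

/-- The principal submatrix of `K` on `Y` is invertible. -/
def PinnedInjective (K : Matrix V V ℝ) (Y : Set V) : Prop :=
  ∀ g : V → ℝ, (∀ i ∉ Y, g i = 0) → (∀ i ∈ Y, (K *ᵥ g) i = 0) → g = 0

lemma pin_mulVec_eq {K : Matrix V V ℝ} {Y : Set V} {g : V → ℝ} (hg : ∀ i ∉ Y, g i = 0) {i : V}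
    (hi : i ∈ Y) : (pin K Y *ᵥ g) i = (K *ᵥ g) i := by
  classical
  rw [pin_mulVec_of_mem K g hi]
  simp only [mulVec, dotProduct]
  refine Finset.sum_congr rfl fun j _ => ?_
  by_cases hj : j ∈ Y
  · simp [hj]
  · simp [hj, hg j hj]

lemma pinnedInjective_iff_det {K : Matrix V V ℝ} {Y : Set V} :
    PinnedInjective K Y ↔ (pin K Y).det ≠ 0 := by
  rw [Ne, ← Matrix.exists_mulVec_eq_zero_iff]
  constructor
  · rintro h ⟨g, hg, h0⟩
    have h1 : ∀ i ∉ Y, g i = 0 := fun i hi => by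
      rw [← pin_mulVec_of_notMem K g hi, h0]; rfl
    exact hg (h g h1 fun i hi => by rw [← pin_mulVec_eq h1 hi, h0]; rfl)
  · intro h g h1 h2
    by_contra hg
    refine h ⟨g, hg, ?_⟩
    funext i
    by_cases hi : i ∈ Y
    · rw [pin_mulVec_eq h1 hi, h2 i hi]; rfl
    · rw [pin_mulVec_of_notMem K g hi, h1 i hi]; rfl

lemma continuous_pin (Y : Set V) : Continuous fun K : Matrix V V ℝ => pin K Y := by
  refine continuous_matrix fun i j => ?_
  simp only [pin, of_apply]
  split_ifs
  · exact continuous_id.matrix_elem i j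
  · exact continuous_const
  · exact continuous_const

lemma PinnedInjective.eventually {K : Matrix V V ℝ} {Y : Set V} (h : PinnedInjective K Y) :
    ∀ᶠ K' in 𝓝 K, PinnedInjective K' Y := by
  have h1 := ((continuous_pin Y).matrix_det.continuousAt (x := K)).eventually_ne
    (pinnedInjective_iff_det.1 h)
  exact h1.mono fun K' hK' => pinnedInjective_iff_det.2 hK'

lemma GenPos.ne_zero {p : V → Fin 3 → ℝ} (hp : GenPos p) {a b c : V} (hab : a ≠ b) (hac : a ≠ c)
    (hbc : b ≠ c) (i : V) : p i ≠ 0 := by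
  intro h0
  have key : ∀ j k, i ≠ j → i ≠ k → j ≠ k → False := fun j k h1 h2 h3 => by
    have := hp i j k h1 h2 h3 1 0 0 (by simp [h0])
    simp at this
  by_cases h1 : i = a
  · subst h1; exact key b c hab hac hbc
  by_cases h2 : i = b
  · subst h2; exact key a c hab.symm hbc hac
  exact key a b h1 h2 hab

lemma stress_row_eq_zero {d : ℕ} {p : V → Fin d → ℝ} {F : Set (Sym2 V)} {X : Set V}
    (hF : F ⊆ edgesOn X) {K : Matrix V V ℝ} (hK : K ∈ stressSpace p F) {i : V} (hi : i ∉ X)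
    (hpi : p i ≠ 0) (j : V) : K i j = 0 := by
  have hoff : ∀ j, j ≠ i → K i j = 0 := fun j hj => hK.1.2 i j hj.symm fun h =>
    hi (mk_mem_edgesOn.1 (hF h)).2.1
  by_cases h : j = i
  · subst h
    have := hK.2 j
    rw [Finset.sum_eq_single j (fun k _ hk => by rw [hoff k hk, zero_smul]) (by simp)] at this
    exact (smul_eq_zero.1 this).resolve_right hpi
  · exact hoff j h

lemma sum_mulVec_smul {d : ℕ} {p : V → Fin d → ℝ} {F : Set (Sym2 V)} {K : Matrix V V ℝ}
    (hK : K ∈ stressSpace p F) (g : V → ℝ) : ∑ i, (K *ᵥ g) i • p i = 0 := by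
  simp only [mulVec, dotProduct, Finset.sum_smul]
  rw [Finset.sum_comm]
  refine Finset.sum_eq_zero fun j _ => ?_
  have := congrArg (fun x => g j • x) (hK.2 j)
  simp only [Finset.smul_sum, smul_zero] at this
  rw [← this]
  refine Finset.sum_congr rfl fun i _ => ?_
  rw [smul_smul, hK.1.1 j i, mul_comm]

lemma mulVec_dot_eq_zero {d : ℕ} {p : V → Fin d → ℝ} {F : Set (Sym2 V)} {K : Matrix V V ℝ}
    (hK : K ∈ stressSpace p F) (l : Fin d → ℝ) : (K *ᵥ fun i => p i ⬝ᵥ l) = 0 := by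
  funext i
  simp only [mulVec, dotProduct, Pi.zero_apply]
  have h1 := hK.2 i
  have : (∑ j, K i j • p j) ⬝ᵥ l = 0 := by rw [h1]; simp
  rw [sum_dotProduct] at this
  rw [← this]
  refine Finset.sum_congr rfl fun j _ => ?_
  rw [smul_dotProduct, smul_eq_mul]
  rfl

lemma sum_eq_three {M : Type*} [AddCommMonoid M] {f : V → M} {a b c : V} (hab : a ≠ b) (hac : a ≠ c)
    (hbc : b ≠ c) (h : ∀ i, i ≠ a → i ≠ b → i ≠ c → f i = 0) : ∑ i, f i = f a + f b + f c := by
  rw [← Finset.sum_subset (Finset.subset_univ {a, b, c})]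
  · rw [Finset.sum_insert (by simp [hab, hac]), Finset.sum_pair hbc, add_assoc]
  · intro j _ hj
    simp only [Finset.mem_insert, Finset.mem_singleton, not_or] at hj
    exact h j hj.1 hj.2.1 hj.2.2

/-- There is a linear functional with prescribed values on three vectors in general position. -/
lemma GenPos.exists_functional {p : V → Fin 3 → ℝ} (hp : GenPos p) {a b c : V} (hab : a ≠ b)
    (hac : a ≠ c) (hbc : b ≠ c) (x y z : ℝ) :
    ∃ l : Fin 3 → ℝ, p a ⬝ᵥ l = x ∧ p b ⬝ᵥ l = y ∧ p c ⬝ᵥ l = z := by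
  let N : Matrix (Fin 3) (Fin 3) ℝ := Matrix.of ![p a, p b, p c]
  have hN : N.det ≠ 0 := by
    intro h0
    obtain ⟨w, hw, h⟩ := Matrix.exists_vecMul_eq_zero_iff.2 h0
    have h1 : w 0 • p a + w 1 • p b + w 2 • p c = 0 := by
      rw [← h]
      funext k
      simp [N, vecMul, dotProduct, Fin.sum_univ_three]
    obtain ⟨h2, h3, h4⟩ := hp a b c hab hac hbc _ _ _ h1
    apply hw
    funext k; fin_cases k <;> assumption
  refine ⟨N⁻¹ *ᵥ ![x, y, z], ?_⟩
  have : N *ᵥ (N⁻¹ *ᵥ ![x, y, z]) = ![x, y, z] := by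
    rw [mulVec_mulVec, Matrix.mul_nonsing_inv _ (isUnit_iff_ne_zero.2 hN), one_mulVec]
  exact ⟨congrFun this 0, congrFun this 1, congrFun this 2⟩

lemma GenPos.eq_zero_of_dot {p : V → Fin 3 → ℝ} (hp : GenPos p) {a b c : V} (hab : a ≠ b)
    (hac : a ≠ c) (hbc : b ≠ c) {l : Fin 3 → ℝ} (ha : p a ⬝ᵥ l = 0) (hb : p b ⬝ᵥ l = 0)
    (hc : p c ⬝ᵥ l = 0) : l = 0 := by
  obtain ⟨α, β, γ, h⟩ := hp.exists_coords hab hac hbc l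
  have : l ⬝ᵥ l = 0 := by
    nth_rw 1 [h]
    rw [add_dotProduct, add_dotProduct, smul_dotProduct, smul_dotProduct, smul_dotProduct, ha, hb,
      hc]
    simp
  simpa using this

/-- Invertibility of a pinned stress matrix does not depend on the choice of the three pins. -/
lemma PinnedInjective.change_pins {p : V → Fin 3 → ℝ} (hp : GenPos p) {F : Set (Sym2 V)}
    {X : Set V} (hF : F ⊆ edgesOn X) {K : Matrix V V ℝ} (hK : K ∈ stressSpace p F) {a b c : V}
    (hab : a ≠ b) (hac : a ≠ c) (hbc : b ≠ c)
    (h : PinnedInjective K (X \ {a, b, c})) {a' b' c' : V} (hab' : a' ≠ b') (hac' : a' ≠ c')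
    (hbc' : b' ≠ c') (ha' : a' ∈ X) (hb' : b' ∈ X) (hc' : c' ∈ X) :
    PinnedInjective K (X \ {a', b', c'}) := by
  classical
  intro g hg h0
  have hrow : ∀ i ∉ X, ∀ j, K i j = 0 := fun i hi =>
    stress_row_eq_zero hF hK hi (hp.ne_zero hab hac hbc i)
  have hKg : K *ᵥ g = 0 := by
    have hz : ∀ i, i ≠ a' → i ≠ b' → i ≠ c' → (K *ᵥ g) i = 0 := fun i h1 h2 h3 => by
      by_cases hi : i ∈ X
      · exact h0 i ⟨hi, by simp [h1, h2, h3]⟩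
      · simp [mulVec, dotProduct, hrow i hi]
    have hs := sum_mulVec_smul hK g
    rw [sum_eq_three hab' hac' hbc' (fun i h1 h2 h3 => by rw [hz i h1 h2 h3, zero_smul])] at hs
    obtain ⟨e1, e2, e3⟩ := hp a' b' c' hab' hac' hbc' _ _ _ hs
    funext i
    by_cases h1 : i = a'
    · rw [h1]; exact e1
    by_cases h2 : i = b'
    · rw [h2]; exact e2
    by_cases h3 : i = c'
    · rw [h3]; exact e3
    exact hz i h1 h2 h3
  obtain ⟨l, la, lb, lc⟩ := hp.exists_functional hab hac hbc (g a) (g b) (g c)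
  let f : V → ℝ := fun i => if i ∈ X then g i - p i ⬝ᵥ l else 0
  have hKf : K *ᵥ f = 0 := by
    have h1 : K *ᵥ f = K *ᵥ g - K *ᵥ fun i => p i ⬝ᵥ l := by
      rw [← mulVec_sub]
      funext i
      simp only [mulVec, dotProduct]
      refine Finset.sum_congr rfl fun j _ => ?_
      by_cases hj : j ∈ X
      · simp [f, hj, dotProduct]
      · rw [hK.1.1 j i, hrow j hj i]; simp
    rw [h1, hKg, mulVec_dot_eq_zero hK l, sub_zero]
  have hf0 : f = 0 := by
    refine h f (fun i hi => ?_) fun i _ => by rw [hKf]; rfl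
    by_cases hiX : i ∈ X
    · have : i ∈ ({a, b, c} : Set V) := by
        by_contra hn; exact hi ⟨hiX, hn⟩
      rcases this with rfl | rfl | rfl
      · simp [f, la]
      · simp [f, lb]
      · simp [f, lc]
    · simp [f, hiX]
  have hgl : ∀ i ∈ X, g i = p i ⬝ᵥ l := fun i hi => by
    have := congrFun hf0 i
    simp only [f, if_pos hi, Pi.zero_apply] at this
    linarith
  have l0 : l = 0 := by
    refine hp.eq_zero_of_dot hab' hac' hbc' ?_ ?_ ?_
    · rw [← hgl a' ha']; exact hg a' (by simp)
    · rw [← hgl b' hb']; exact hg b' (by simp)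
    · rw [← hgl c' hc']; exact hg c' (by simp)
  funext i
  by_cases hi : i ∈ X
  · rw [hgl i hi, l0]; simp
  · exact hg i fun h => hi h.1

/-! ### Generic dimension of the stress space -/

lemma eventually_finrank_ker_le {P L N : Type*} [AddCommGroup P] [Module ℝ P] [AddCommGroup L]
    [Module ℝ L] [AddCommGroup N] [Module ℝ N] [TopologicalSpace P] [IsTopologicalAddGroup P]
    [ContinuousSMul ℝ P] [T2Space P] [FiniteDimensional ℝ P] [FiniteDimensional ℝ L]
    (A : P →ₗ[ℝ] L →ₗ[ℝ] N) (p₀ : P) : ∀ᶠ p in 𝓝 p₀,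
      Module.finrank ℝ (LinearMap.ker (A p)) ≤ Module.finrank ℝ (LinearMap.ker (A p₀)) := by
  obtain ⟨W, hW⟩ := Submodule.exists_isCompl (LinearMap.ker (A p₀))
  have hker : ∀ p, Function.Injective (A p ∘ₗ W.subtype) ↔ LinearMap.ker (A p) ⊓ W = ⊥ := by
    intro p
    rw [← LinearMap.ker_eq_bot, LinearMap.ker_comp, Submodule.eq_bot_iff, Submodule.eq_bot_iff]
    constructor
    · intro h x hx
      exact congrArg Subtype.val (h ⟨x, hx.2⟩ hx.1)
    · intro h x hx
      exact Subtype.ext (h x ⟨hx, x.2⟩)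
  let B : P →ₗ[ℝ] W →ₗ[ℝ] N := (LinearMap.lcomp ℝ N W.subtype) ∘ₗ A
  have hB : Function.Injective (B p₀) := (hker p₀).2 hW.inf_eq_bot
  filter_upwards [eventually_injective B hB] with p hp
  have h1 := Submodule.finrank_sup_add_finrank_inf_eq (LinearMap.ker (A p)) W
  rw [(hker p).1 hp, finrank_bot] at h1
  have h2 := Submodule.finrank_add_eq_of_isCompl hW
  have h3 := Submodule.finrank_le (LinearMap.ker (A p) ⊔ W)
  omega

lemma IsGeneric.finrank_stressSpace {p : V → Fin 3 → ℝ} (hp : IsGeneric p) {F I : Set (Sym2 V)}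
    (hI : (𝓜).IsBasis I F) : Module.finrank ℝ (stressSpace p F) + I.ncard = F.ncard := by
  have hF : ∀ e ∈ F, ¬ e.IsDiag := hI.subset_ground
  have hmap := map_stressMap_le (p := p) (I := I) (Set.toFinite F) hF (fun e he heI => by
    by_contra! h2
    refine hI.indep.mem_closure_iff.1 (hI.subset_closure he) |>.elim (fun hd => hd.not_indep
      ⟨?_, p, (Submodule.eq_bot_iff _).2 fun K hK => ?_⟩) heI
    · rintro f (rfl | hf)
      · exact hF _ he
      · exact hI.indep.1 f hf
    · have h3 : K ∈ stressSpace p I := ⟨h2 K hK, hK.2⟩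
      rw [hp.2 I hI.indep.2] at h3
      simpa using h3)
  have hrange : LinearMap.range (stressMap 3 F p) = LinearMap.range (stressMap 3 I p) := by
    refine le_antisymm ?_ ?_
    · rintro _ ⟨K, rfl⟩
      obtain ⟨K', hK', h⟩ := hmap K K.2
      exact ⟨⟨K', hK'⟩, funext fun i => (h i).symm⟩
    · rintro _ ⟨K, rfl⟩
      exact ⟨⟨K, patternSpace_mono hI.subset K.2⟩, rfl⟩
  have h1 := LinearMap.finrank_range_add_finrank_ker (stressMap 3 F p)
  rw [hrange, LinearMap.finrank_range_of_inj (stressMap_injective_iff.2 (hp.2 I hI.indep.2)),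
    finrank_ker_stressMap, finrank_patternSpace hF, finrank_patternSpace hI.indep.1] at h1
  omega

lemma IsGeneric.finrank_le {p : V → Fin 3 → ℝ} (hp : IsGeneric p) {F : Set (Sym2 V)}
    (hF : ∀ e ∈ F, ¬ e.IsDiag) (q : V → Fin 3 → ℝ) :
    Module.finrank ℝ (stressSpace p F) ≤ Module.finrank ℝ (stressSpace q F) := by
  obtain ⟨I, hI⟩ := (𝓜).exists_isBasis F (subset_ground_iff.2 hF)
  have h1 := eventually_finrank_ker_le (stressMap 3 F) q
  obtain ⟨U, hU, hUo, hqU⟩ := eventually_nhds_iff.1 h1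
  obtain ⟨r, hrU, hr⟩ := (dense_isGeneric (V := V)).inter_open_nonempty U hUo ⟨q, hqU⟩
  have h2 := hU r hrU
  rw [finrank_ker_stressMap, finrank_ker_stressMap] at h2
  have h3 := hp.finrank_stressSpace hI
  have h4 := IsGeneric.finrank_stressSpace hr hI
  omega

end Pinned

/-! ### Stresses of maximal rank -/

section FullStress

open Topology Filter

variable {V : Type*} [Fintype V] [DecidableEq V]

local notation "𝓜" => rigidityMatroid V

lemma IsClawAt.finrank_le {F : Set (Sym2 V)} {v a b c : V} (h : IsClawAt F v a b c)
    {p q : V → Fin 3 → ℝ} (hpq : ∀ i, i ≠ v → q i = p i) (hp : GenPos p) :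
    Module.finrank ℝ (stressSpace q F) ≤ Module.finrank ℝ (stressSpace p (F \ starAt F v)) + 1 := by
  let φ : stressSpace q F →ₗ[ℝ] ℝ :=
    { toFun := fun K => (K : Matrix V V ℝ) v v
      map_add' := fun _ _ => rfl
      map_smul' := fun _ _ => rfl }
  have h1 := LinearMap.finrank_range_add_finrank_ker φ
  have h2 : Module.finrank ℝ (LinearMap.range φ) ≤ 1 :=
    (Submodule.finrank_le _).trans (by simp)
  have h3 : (LinearMap.ker φ).map (stressSpace q F).subtype ≤ stressSpace p (F \ starAt F v) := by
    rintro _ ⟨K, hK, rfl⟩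
    have hKv : (K : Matrix V V ℝ) v v = 0 := hK
    obtain ⟨α, β, γ, hqv⟩ := hp.exists_coords h.ab h.ac h.bc (q v)
    rw [← hpq a h.va.symm, ← hpq b h.vb.symm, ← hpq c h.vc.symm] at hqv
    have hrow := (h.sub_mem (p := q) (by
      rw [hpq a h.va.symm, hpq b h.vb.symm, hpq c h.vc.symm]
      exact hp a b c h.ab h.ac h.bc) hqv K.2).2
    rw [hKv, zero_smul, sub_zero] at hrow
    refine mem_stressSpace_congr hpq (v := v)
      (fun i => (K.2.1.1 v i).trans (hrow i)) (mem_stressSpace_of_eq_zero K.2 ?_)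
    intro i j _ hF hn
    have hv : v ∈ s(i, j) := by
      by_contra hv
      exact hn ⟨hF, fun hs => hv hs.2⟩
    rcases Sym2.mem_iff.1 hv with rfl | rfl
    · exact hrow j
    · exact (K.2.1.1 v i).trans (hrow i)
  have h4 := Submodule.finrank_mono h3
  rw [LinearEquiv.finrank_eq (Submodule.equivMapOfInjective _
    (Submodule.injective_subtype _) (LinearMap.ker φ)).symm] at h4
  omega

/-- A stress of a connected graph with a degree-three vertex in special position extends
continuously to nearby configurations. -/
lemma IsClawAt.exists_continuous_stress {F : Set (Sym2 V)} (hM : MConn 𝓜 F) {v a b c : V}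
    (h : IsClawAt F v a b c) {p q : V → Fin 3 → ℝ} (hpq : ∀ i, i ≠ v → q i = p i)
    (hp : IsGeneric p) {K : Matrix V V ℝ} (hK : K ∈ stressSpace q F) :
    ∃ (U : Set (V → Fin 3 → ℝ)) (k : (V → Fin 3 → ℝ) → Matrix V V ℝ), IsOpen U ∧ q ∈ U ∧
      ContinuousOn k U ∧ k q = K ∧ ∀ r ∈ U, k r ∈ stressSpace r F := by
  have hva : s(v, a) ∈ F := h.claw_subset (Or.inl rfl)
  have hlt : stressSpace p (F \ starAt F v) < stressSpace p F := by
    refine lt_of_le_of_ne (stressSpace_mono p Set.sdiff_subset) fun heq => ?_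
    obtain ⟨C, hCF, hC, hvC, -⟩ := hM.2 _ hva _ hva
    obtain ⟨K, hK, hK0⟩ := hp.exists_stress hC hvC
    have := stressSpace_mono p hCF hK
    rw [← heq] at this
    exact hK0 (this.1.2 v a h.va fun hm => hm.2 ⟨hm.1, by simp⟩)
  have h1 := Submodule.finrank_lt_finrank_of_lt hlt
  have h2 := h.finrank_le hpq hp.1
  obtain ⟨U, k, hU, hqU, hk, hkq, hkU⟩ := exists_continuous_kernel (stressMap 3 F) (p₀ := q)
    (k₀ := ⟨K, hK.1⟩) (by funext i; exact hK.2 i) (Filter.Eventually.of_forall fun r => by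
      rw [finrank_ker_stressMap, finrank_ker_stressMap]
      have := hp.finrank_le hM.subset_ground r
      omega)
  refine ⟨U, fun r => k r, hU, hqU, continuous_subtype_val.comp_continuousOn hk, by simp [hkq],
    fun r hr => ⟨(k r).2, fun i => congrFun (hkU r hr) i⟩⟩

lemma MConn.mem_closure_claw {F : Set (Sym2 V)} (hM : MConn 𝓜 F) {v a b c : V}
    (h : IsClawAt F v a b c) : s(a, b) ∈ (𝓜).closure (F \ starAt F v) := by
  have hva : s(v, a) ∈ F := h.claw_subset (Or.inl rfl)
  obtain ⟨C, hCF, hC, hvC, -⟩ := hM.2 _ hva _ hva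
  refine (𝓜).closure_subset_closure ?_
    (mem_closure_of_claw hC (h.of_isCircuit hC hCF (left_mem_verts hvC)))
  exact fun e he => ⟨hCF he.1, fun hs => he.2 ⟨he.1, hs.2⟩⟩

lemma MConn.exists_stress_missing {F : Set (Sym2 V)} (hM : MConn 𝓜 F) {v a b c : V}
    (h : IsClawAt F v a b c) {p : V → Fin 3 → ℝ} (hp : IsGeneric p) :
    ∃ ω ∈ stressSpace p (insert s(a, b) (F \ starAt F v)), s(a, b) ∉ F → ω a b ≠ 0 := by
  by_cases hab : s(a, b) ∈ F
  · exact ⟨0, zero_mem _, fun h => (h hab).elim⟩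
  · obtain ⟨D, hDs, hD, heD⟩ := Matroid.exists_isCircuit_of_mem_closure (hM.mem_closure_claw h)
      (fun h => hab h.1)
    obtain ⟨ω, hω, h0⟩ := hp.exists_stress hD heD
    exact ⟨ω, stressSpace_mono p hDs hω, fun _ => h0⟩

lemma eventually_add_mul_ne (k w : ℝ) (hw : w ≠ 0) : ∀ᶠ s in 𝓝[≠] (0 : ℝ), k + s * w ≠ 0 := by
  by_cases hk : k = 0
  · filter_upwards [self_mem_nhdsWithin] with s hs
    simpa [hk, hw] using hs
  · have : ContinuousAt (fun s : ℝ => k + s * w) 0 := by fun_prop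
    exact (this.eventually_ne (by simpa using hk)).filter_mono nhdsWithin_le_nhds

lemma IsClawAt.row_yDelta {F : Set (Sym2 V)} {X : Set V} {v a b c : V} (h : IsClawAt F v a b c)
    (hF : F ⊆ edgesOn X) {p : V → Fin 3 → ℝ} (hp : GenPos p) {K : Matrix V V ℝ}
    (hK : K ∈ stressSpace p (yDelta F v a b c)) (j : V) : K v j = 0 :=
  stress_row_eq_zero (h.yDelta_subset hF) hK (by simp) (hp.ne_zero h.ab h.ac h.bc v) j

/-- Undoing the replacement of a degree-three vertex: a stress of the reduced graph plus a multiple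
of the rank-one stress of the claw is a stress of the original graph, provided the entries at the
missing edges cancel. -/
lemma IsClawAt.add_mem {F : Set (Sym2 V)} {X : Set V} {v a b c : V} (h : IsClawAt F v a b c)
    (hF : F ⊆ edgesOn X) {p q : V → Fin 3 → ℝ} (hpq : ∀ i, i ≠ v → q i = p i) (hp : GenPos p)
    {K : Matrix V V ℝ} (hK : K ∈ stressSpace p (yDelta F v a b c)) {α β γ t : ℝ}
    (hq : q v = α • p a + β • p b + γ • p c) (hab : s(a, b) ∉ F → K a b + t * (α * β) = 0)
    (hbc : s(b, c) ∉ F → K b c + t * (β * γ) = 0) (hac : s(a, c) ∉ F → K a c + t * (α * γ) = 0) :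
    K + t • vecMulVec (starVec v a b c α β γ) (starVec v a b c α β γ) ∈ stressSpace q F := by
  have hcol : ∀ i, K i v = 0 := fun i => by rw [hK.1.1 v i]; exact h.row_yDelta hF hp hK i
  have hKq : K ∈ stressSpace q (yDelta F v a b c) :=
    mem_stressSpace_congr (fun i hi => (hpq i hi).symm) hcol hK
  rw [← hpq a h.va.symm, ← hpq b h.vb.symm, ← hpq c h.vc.symm] at hq
  have hL := vecMulVec_starVec_mem_stressSpace α β γ h.va h.vb h.vc h.ab h.ac h.bc hq
  have hmem : K + t • vecMulVec (starVec v a b c α β γ) (starVec v a b c α β γ) ∈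
      stressSpace q (yDelta F v a b c ∪ (claw v a b c ∪ tri a b c)) :=
    Submodule.add_mem _ (stressSpace_mono q Set.subset_union_left hKq)
      (Submodule.smul_mem _ _ (stressSpace_mono q Set.subset_union_right hL))
  refine mem_stressSpace_of_eq_zero hmem fun i j _ hm hn => ?_
  have htri : s(i, j) ∈ tri a b c := by
    rcases hm with (hm | hm) | hm | hm
    · exact (hn hm.1).elim
    · exact hm
    · exact (hn (h.claw_subset hm)).elim
    · exact hm
  have key : ∀ x y, s(i, j) = s(x, y) →
      (K + t • vecMulVec (starVec v a b c α β γ) (starVec v a b c α β γ)) x y = 0 →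
      (K + t • vecMulVec (starVec v a b c α β γ) (starVec v a b c α β γ)) i j = 0 := by
    intro x y hxy h0
    rcases Sym2.eq_iff.1 hxy with ⟨rfl, rfl⟩ | ⟨rfl, rfl⟩
    · exact h0
    · rw [hmem.1.1]; exact h0
  have ea := starVec_apply_fst (b := b) (c := c) α β γ h.va
  have eb := starVec_apply_snd (c := c) α β γ h.vb h.ab
  have ec := starVec_apply_trd α β γ h.vc h.ac h.bc
  rcases htri with he | he | he
  · refine key a b he ?_
    rw [he] at hn
    simpa [vecMulVec_apply, ea, eb] using hab hn
  · refine key b c he ?_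
    rw [he] at hn
    simpa [vecMulVec_apply, eb, ec] using hbc hn
  · refine key a c he ?_
    rw [he] at hn
    simpa [vecMulVec_apply, ea, ec] using hac hn

lemma starVec_dot {v a b c : V} (α β γ : ℝ) {g : V → ℝ} (ha : g a = 0) (hb : g b = 0)
    (hc : g c = 0) : starVec v a b c α β γ ⬝ᵥ g = g v := by
  rw [dotProduct, Finset.sum_eq_single v]
  · simp [starVec_apply_self]
  · intro j _ hj
    by_cases h1 : j = a
    · rw [h1, ha, mul_zero]
    by_cases h2 : j = b
    · rw [h2, hb, mul_zero]
    by_cases h3 : j = c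
    · rw [h3, hc, mul_zero]
    rw [starVec_apply_of_ne _ _ _ hj h1 h2 h3, zero_mul]
  · simp

lemma add_smul_vecMulVec_mulVec (K : Matrix V V ℝ) (t : ℝ) (u g : V → ℝ) (i : V) :
    ((K + t • vecMulVec u u) *ᵥ g) i = (K *ᵥ g) i + t * (u ⬝ᵥ g) * u i := by
  rw [add_mulVec, smul_mulVec, Pi.add_apply, Pi.smul_apply, vecMulVec_mulVec]
  simp
  ring

lemma IsClawAt.pinnedInjective {F : Set (Sym2 V)} {X : Set V} {v a b c : V}
    (h : IsClawAt F v a b c) (hF : F ⊆ edgesOn X) {p : V → Fin 3 → ℝ} (hp : GenPos p)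
    {K : Matrix V V ℝ} (hK : K ∈ stressSpace p (yDelta F v a b c))
    (hpin : PinnedInjective K ((X \ {v}) \ {a, b, c})) (α β γ : ℝ) {t : ℝ} (ht : t ≠ 0) :
    PinnedInjective (K + t • vecMulVec (starVec v a b c α β γ) (starVec v a b c α β γ))
      (X \ {a, b, c}) := by
  intro g hg h0
  have hvX : v ∈ X := (mk_mem_edgesOn.1 (hF (h.claw_subset (Or.inl rfl)))).2.1
  have ga : g a = 0 := hg a (by simp)
  have gb : g b = 0 := hg b (by simp)
  have gc : g c = 0 := hg c (by simp)
  simp only [add_smul_vecMulVec_mulVec, starVec_dot α β γ ga gb gc] at h0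
  have gv : g v = 0 := by
    have h1 := h0 v ⟨hvX, by simp [h.va, h.vb, h.vc]⟩
    have h2 : (K *ᵥ g) v = 0 := by
      simp [mulVec, dotProduct, h.row_yDelta hF hp hK]
    rw [h2, starVec_apply_self] at h1
    simpa [ht] using h1
  refine hpin g (fun i hi => ?_) fun i hi => ?_
  · by_cases hiv : i = v
    · rw [hiv, gv]
    · exact hg i fun hi' => hi ⟨⟨hi'.1, hiv⟩, hi'.2⟩
  · have := h0 i ⟨hi.1.1, hi.2⟩
    simpa [gv] using this

lemma exists_cancel {k₁ k₂ k₃ : ℝ} (h₁ : k₁ ≠ 0) (h₂ : k₂ ≠ 0) (h₃ : k₃ ≠ 0) :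
    ∃ α β γ t : ℝ, t ≠ 0 ∧ k₁ + t * (α * β) = 0 ∧ k₂ + t * (β * γ) = 0 ∧
      k₃ + t * (α * γ) = 0 := by
  refine ⟨1, k₂ / k₃, k₂ / k₁, -(k₁ * k₃ / k₂), by simp [h₁, h₂, h₃], ?_, ?_, ?_⟩ <;>
    field_simp <;> ring

/-- A maximal-rank stress at a generic configuration. -/
def HasFullStress (F : Set (Sym2 V)) (X : Set V) : Prop :=
  ∃ p, IsGeneric p ∧ ∃ K ∈ stressSpace p F, ∃ a b c, a ≠ b ∧ a ≠ c ∧ b ≠ c ∧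
    PinnedInjective K (X \ {a, b, c})

lemma IsClawAt.hasFullStress {F : Set (Sym2 V)} {X : Set V} (hM : MConn 𝓜 F) {v a b c : V}
    (h : IsClawAt F v a b c) (hF : F ⊆ edgesOn X) {p : V → Fin 3 → ℝ} (hp : IsGeneric p)
    {K : Matrix V V ℝ} (hK : K ∈ stressSpace p (yDelta F v a b c))
    (hpin : PinnedInjective K ((X \ {v}) \ {a, b, c})) : HasFullStress F X := by
  obtain ⟨ω₁, hω₁, n₁⟩ := hM.exists_stress_missing h hp
  obtain ⟨ω₂, hω₂, n₂⟩ := hM.exists_stress_missing h.rotate hp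
  obtain ⟨ω₃, hω₃, n₃⟩ := hM.exists_stress_missing h.rotate.rotate hp
  have hca : s(c, a) = s(a, c) := Sym2.eq_swap
  rw [hca] at hω₃ n₃
  have n₃' : s(a, c) ∉ F → ω₃ a c ≠ 0 := fun hm => by rw [hω₃.1.1 c a]; exact n₃ hm
  have htri : ∀ e ∈ tri a b c, insert e (F \ starAt F v) ⊆ yDelta F v a b c := fun e he =>
    Set.insert_subset (Or.inr he) Set.subset_union_left
  let ω := ω₁ + ω₂ + ω₃
  have hω : ω ∈ stressSpace p (yDelta F v a b c) := Submodule.add_mem _ (Submodule.add_mem _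
    (stressSpace_mono p (htri _ (by simp [tri])) hω₁)
    (stressSpace_mono p (htri _ (by simp [tri])) hω₂))
    (stressSpace_mono p (htri _ (by simp [tri])) hω₃)
  have d12 : s(a, b) ≠ s(b, c) := by simp [h.ab, h.ac]
  have d13 : s(a, b) ≠ s(a, c) := by simp [h.bc, h.ab.symm]
  have d23 : s(b, c) ≠ s(a, c) := by simp [h.bc, h.ab.symm]
  have z : ∀ {ω : Matrix V V ℝ} {e : Sym2 V} {x y : V},
      ω ∈ stressSpace p (insert e (F \ starAt F v)) → x ≠ y → s(x, y) ≠ e → s(x, y) ∉ F →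
      ω x y = 0 := by
    intro ω e x y hω hxy hne hn
    refine hω.1.2 x y hxy ?_
    rintro (hm | hm)
    · exact hne hm
    · exact hn hm.1
  have w₁ : s(a, b) ∉ F → ω a b ≠ 0 := fun hm => by
    simp only [ω, Matrix.add_apply, z hω₂ h.ab d12 hm, z hω₃ h.ab d13 hm, add_zero]; exact n₁ hm
  have w₂ : s(b, c) ∉ F → ω b c ≠ 0 := fun hm => by
    simp only [ω, Matrix.add_apply, z hω₁ h.bc d12.symm hm, z hω₃ h.bc d23 hm, add_zero, zero_add]
    exact n₂ hm
  have w₃ : s(a, c) ∉ F → ω a c ≠ 0 := fun hm => by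
    simp only [ω, Matrix.add_apply, z hω₁ h.ac d13.symm hm, z hω₂ h.ac d23.symm hm, zero_add]
    exact n₃' hm
  have ev : ∀ᶠ s in 𝓝[≠] (0 : ℝ), PinnedInjective (K + s • ω) ((X \ {v}) \ {a, b, c}) := by
    have hc : Filter.Tendsto (fun s : ℝ => K + s • ω) (𝓝 0) (𝓝 K) := by
      have : Continuous fun s : ℝ => K + s • ω := by fun_prop
      simpa using this.tendsto 0
    exact (hc.eventually hpin.eventually).filter_mono nhdsWithin_le_nhds
  have ev' : ∀ x y, (s(x, y) ∉ F → ω x y ≠ 0) →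
      ∀ᶠ s in 𝓝[≠] (0 : ℝ), s(x, y) ∉ F → (K + s • ω) x y ≠ 0 := by
    intro x y hw
    by_cases hm : s(x, y) ∈ F
    · exact Filter.Eventually.of_forall fun s h => (h hm).elim
    · filter_upwards [eventually_add_mul_ne (K x y) (ω x y) (hw hm)] with s hs _
      simpa using hs
  obtain ⟨s, hs, e₁, e₂, e₃⟩ := (ev.and ((ev' a b w₁).and ((ev' b c w₂).and (ev' a c w₃)))).exists
  set K' := K + s • ω with hK'
  have hK'm : K' ∈ stressSpace p (yDelta F v a b c) :=
    Submodule.add_mem _ hK (Submodule.smul_mem _ _ hω)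
  have hne : ∀ x y, (s(x, y) ∉ F → K' x y ≠ 0) → ∃ k : ℝ, k ≠ 0 ∧ (s(x, y) ∉ F → k = K' x y) := by
    intro x y hxy
    by_cases hm : s(x, y) ∈ F
    · exact ⟨1, one_ne_zero, fun h => (h hm).elim⟩
    · exact ⟨K' x y, hxy hm, fun _ => rfl⟩
  obtain ⟨k₁, m₁, f₁⟩ := hne a b e₁
  obtain ⟨k₂, m₂, f₂⟩ := hne b c e₂
  obtain ⟨k₃, m₃, f₃⟩ := hne a c e₃
  obtain ⟨α, β, γ, t, ht, g₁, g₂, g₃⟩ := exists_cancel m₁ m₂ m₃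
  let q : V → Fin 3 → ℝ := Function.update p v (α • p a + β • p b + γ • p c)
  have hpq : ∀ i, i ≠ v → q i = p i := fun i hi => Function.update_of_ne hi _ _
  have hG := h.add_mem hF hpq hp.1 hK'm (α := α) (β := β) (γ := γ) (t := t) (by simp [q])
    (fun hm => by rw [← f₁ hm]; exact g₁) (fun hm => by rw [← f₂ hm]; exact g₂)
    (fun hm => by rw [← f₃ hm]; exact g₃)
  have hGp := h.pinnedInjective hF hp.1 hK'm hs α β γ ht
  obtain ⟨U, k, hU, hqU, hk, hkq, hkU⟩ := h.exists_continuous_stress hM hpq hp hG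
  have hev : ∀ᶠ r in 𝓝 q, PinnedInjective (k r) (X \ {a, b, c}) := by
    have := (hk.continuousAt (hU.mem_nhds hqU))
    rw [ContinuousAt, hkq] at this
    exact this.eventually hGp.eventually
  obtain ⟨W, hW, hWo, hqW⟩ := eventually_nhds_iff.1 hev
  obtain ⟨r, hrW, hr⟩ := (dense_isGeneric (V := V)).inter_open_nonempty (U ∩ W) (hU.inter hWo)
    ⟨q, hqU, hqW⟩
  exact ⟨r, hr, k r, hkU r hrW.1, a, b, c, h.ab, h.ac, h.bc, hW r hrW.2⟩

lemma IsClawAt.exists_reduced {F : Set (Sym2 V)} {X : Set V} (h3 : Conn3 F X) {v a b c : V}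
    (h : IsClawAt F v a b c)
    (hT : 5 ≤ X.ncard → HasFullStress (yDelta F v a b c) (X \ {v})) :
    ∃ p, IsGeneric p ∧ ∃ K ∈ stressSpace p (yDelta F v a b c),
      PinnedInjective K ((X \ {v}) \ {a, b, c}) := by
  have hm : ∀ j, s(v, j) ∈ F → j ∈ X \ {v} := fun j hj => by
    have := mk_mem_edgesOn.1 (h3.1 hj)
    exact ⟨this.2.2, this.1.symm⟩
  have ha := hm a (h.claw_subset (Or.inl rfl))
  have hb := hm b (h.claw_subset (Or.inr (Or.inl rfl)))
  have hc := hm c (h.claw_subset (Or.inr (Or.inr rfl)))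
  by_cases h5 : 5 ≤ X.ncard
  · obtain ⟨p, hp, K, hK, a', b', c', hab, hac, hbc, hpin⟩ := hT h5
    exact ⟨p, hp, K, hK, hpin.change_pins hp.1 (h.yDelta_subset h3.1) hK hab hac hbc h.ab h.ac h.bc
      ha hb hc⟩
  · obtain ⟨p, hp⟩ := exists_isGeneric (V := V)
    refine ⟨p, hp, 0, zero_mem _, ?_⟩
    have hvX : v ∈ X := (mk_mem_edgesOn.1 (h3.1 (h.claw_subset (Or.inl rfl)))).2.1
    have h1 : (X \ {v}).ncard + 1 = X.ncard := Set.ncard_sdiff_singleton_add_one hvX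
    have h2 : ({a, b, c} : Set V) = X \ {v} := by
      refine Set.eq_of_subset_of_ncard_le ?_ ?_
      · rintro x (rfl | rfl | rfl) <;> assumption
      · rw [Set.ncard_eq_three.2 ⟨a, b, c, h.ab, h.ac, h.bc, rfl⟩]; omega
    intro g hg _
    funext i
    exact hg i (by rw [h2]; simp)

theorem hasFullStress_of_conn3 {F : Set (Sym2 V)} {X : Set V} (hM : MConn 𝓜 F) (h3 : Conn3 F X) :
    HasFullStress F X := by
  induction hn : X.ncard + F.ncard using Nat.strong_induction_on generalizing F X with
  | _ n ih =>
  by_cases hdeg : ∃ v ∈ X, (starAt F v).ncard = 3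
  · obtain ⟨v, hvX, hv⟩ := hdeg
    obtain ⟨a, b, c, h⟩ := exists_isClawAt (fun e he => (h3.1 he).1) hv
    obtain ⟨p, hp, K, hK, hpin⟩ := h.exists_reduced h3 fun h5 => by
      have h3' := h3.yDelta h h5
      refine ih _ ?_ (hM.yDelta h h3') h3' rfl
      have h1 : (X \ {v}).ncard + 1 = X.ncard := Set.ncard_sdiff_singleton_add_one hvX
      have h2 : (F \ starAt F v).ncard + (starAt F v).ncard = F.ncard :=
        Set.ncard_sdiff_add_ncard_of_subset fun e he => he.1
      have h4 : (yDelta F v a b c).ncard ≤ (F \ starAt F v).ncard + 3 := by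
        refine (Set.ncard_union_le _ _).trans (Nat.add_le_add_left ?_ _)
        rw [tri]
        refine (Set.ncard_insert_le _ _).trans ?_
        have := Set.ncard_insert_le s(b, c) {s(a, c)}
        rw [Set.ncard_singleton] at this
        omega
      omega
    exact h.hasFullStress hM h3.1 hp hK hpin
  · push Not at hdeg
    obtain ⟨e, he, hMe, h3e⟩ := exists_deletion hM h3 fun v hv => by
      have := h3.three_le_degree hv
      have := hdeg v hv
      omega
    have h1 : (F \ {e}).ncard + 1 = F.ncard := Set.ncard_sdiff_singleton_add_one he
    obtain ⟨p, hp, K, hK, h⟩ := ih _ (by omega) hMe h3e rfl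
    exact ⟨p, hp, K, stressSpace_mono p Set.sdiff_subset hK, h⟩

end FullStress

/-! ### Positivity of pinned stress matrices -/

section Positivity

open Topology Filter

variable {V : Type*} [Fintype V] [DecidableEq V]

/-- The principal submatrix of `K` on `Y` is positive definite. -/
def PinnedPos (K : Matrix V V ℝ) (Y : Set V) : Prop :=
  ∀ g : V → ℝ, (∀ i ∉ Y, g i = 0) → g ≠ 0 → 0 < g ⬝ᵥ (K *ᵥ g)

lemma PinnedPos.pinnedInjective {K : Matrix V V ℝ} {Y : Set V} (h : PinnedPos K Y) :
    PinnedInjective K Y := by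
  intro g hg h0
  by_contra hne
  refine (h g hg hne).ne' (Finset.sum_eq_zero fun i _ => ?_)
  by_cases hi : i ∈ Y
  · rw [h0 i hi, mul_zero]
  · rw [hg i hi, zero_mul]

lemma PinnedPos.eventually {K : Matrix V V ℝ} {Y : Set V} (h : PinnedPos K Y) :
    ∀ᶠ K' in 𝓝 K, PinnedPos K' Y := by
  let S : Set (V → ℝ) := Metric.sphere 0 1 ∩ {g | ∀ i ∉ Y, g i = 0}
  have hScl : IsClosed {g : V → ℝ | ∀ i ∉ Y, g i = 0} := by
    have : {g : V → ℝ | ∀ i ∉ Y, g i = 0} = ⋂ i ∈ Yᶜ, {g | g i = 0} := by ext g; simp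
    rw [this]
    exact isClosed_biInter fun i _ => isClosed_eq (continuous_apply i) continuous_const
  have hS : IsCompact S := (isCompact_sphere 0 1).inter_right hScl
  have hcont : Continuous fun x : Matrix V V ℝ × (V → ℝ) => x.2 ⬝ᵥ (x.1 *ᵥ x.2) := by
    fun_prop
  have key : ∀ᶠ K' in 𝓝 K, ∀ g ∈ S, 0 < g ⬝ᵥ (K' *ᵥ g) := by
    refine hS.eventually_forall_of_forall_eventually fun g hg => ?_
    have hne : g ≠ 0 := by
      rintro rfl
      simpa using hg.1
    exact hcont.continuousAt.eventually (lt_mem_nhds (h g hg.2 hne))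
  filter_upwards [key] with K' hK' g hg hne
  have hn : 0 < ‖g‖ := norm_pos_iff.2 hne
  have h1 := hK' (‖g‖⁻¹ • g) ⟨by simp [norm_smul, hn.ne'], fun i hi => by simp [hg i hi]⟩
  rw [mulVec_smul, smul_dotProduct, dotProduct_smul, smul_eq_mul, smul_eq_mul] at h1
  have h2 : 0 < ‖g‖⁻¹ := inv_pos.2 hn
  exact (mul_pos_iff_of_pos_left h2).1 ((mul_pos_iff_of_pos_left h2).1 h1)

/-- A stress matrix with a positive definite pinned block is positive semidefinite. -/
lemma PinnedPos.posSemidef {p : V → Fin 3 → ℝ} (hp : GenPos p) {F : Set (Sym2 V)} {X : Set V}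
    (hF : F ⊆ edgesOn X) {K : Matrix V V ℝ} (hK : K ∈ stressSpace p F) {a b c : V}
    (hab : a ≠ b) (hac : a ≠ c) (hbc : b ≠ c) (h : PinnedPos K (X \ {a, b, c})) :
    K.PosSemidef := by
  classical
  have hsymm : K.IsHermitian := by
    ext i j
    simp [hK.1.1 i j]
  refine Matrix.PosSemidef.of_dotProduct_mulVec_nonneg hsymm fun x => ?_
  have hrow : ∀ i ∉ X, ∀ j, K i j = 0 := fun i hi =>
    stress_row_eq_zero hF hK hi (hp.ne_zero hab hac hbc i)
  obtain ⟨l, la, lb, lc⟩ := hp.exists_functional hab hac hbc (x a) (x b) (x c)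
  let f : V → ℝ := fun i => if i ∈ X then x i - p i ⬝ᵥ l else 0
  have hKf : K *ᵥ f = K *ᵥ x := by
    have h1 : K *ᵥ f = K *ᵥ x - K *ᵥ fun i => p i ⬝ᵥ l := by
      rw [← mulVec_sub]
      funext i
      simp only [mulVec, dotProduct]
      refine Finset.sum_congr rfl fun j _ => ?_
      by_cases hj : j ∈ X
      · simp [f, hj, dotProduct]
      · rw [hK.1.1 j i, hrow j hj i]; simp
    rw [h1, mulVec_dot_eq_zero hK l, sub_zero]
  have hxf : x ⬝ᵥ (K *ᵥ x) = f ⬝ᵥ (K *ᵥ f) := by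
    have hsw : ∀ u w : V → ℝ, u ⬝ᵥ (K *ᵥ w) = w ⬝ᵥ (K *ᵥ u) := by
      intro u w
      simp only [dotProduct, mulVec, Finset.mul_sum]
      rw [Finset.sum_comm]
      refine Finset.sum_congr rfl fun i _ => Finset.sum_congr rfl fun j _ => ?_
      rw [hK.1.1 i j]; ring
    rw [← hKf, hsw, ← hKf]
  have hstar : star x ⬝ᵥ (K *ᵥ x) = f ⬝ᵥ (K *ᵥ f) := by rw [← hxf]; simp
  rw [hstar]
  by_cases hf : f = 0
  · simp [hf]
  · refine (h f (fun i hi => ?_) hf).le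
    by_cases hiX : i ∈ X
    · have : i ∈ ({a, b, c} : Set V) := by
        by_contra hn; exact hi ⟨hiX, hn⟩
      rcases this with rfl | rfl | rfl
      · simp [f, la]
      · simp [f, lb]
      · simp [f, lc]
    · simp [f, hiX]

/-! ### Generic points on polynomial curves -/

lemma IsGeneric.smul {p : V → Fin 3 → ℝ} (hp : IsGeneric p) {t : ℝ} (ht : t ≠ 0) :
    IsGeneric (t • p) := by
  constructor
  · intro i j k hij hik hjk x y z h
    refine hp.1 i j k hij hik hjk x y z ?_
    have : t • (x • p i + y • p j + z • p k) = 0 := by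
      rw [← h]; simp only [Pi.smul_apply]; module
    exact (smul_eq_zero.1 this).resolve_left ht
  · intro F hF
    rw [Submodule.eq_bot_iff]
    intro K hK
    have : K ∈ stressSpace p F := ⟨hK.1, fun i => by
      have h1 := hK.2 i
      have h2 : t • ∑ j, K i j • p j = 0 := by
        rw [← h1, Finset.smul_sum]
        exact Finset.sum_congr rfl fun j _ => smul_comm _ _ _
      exact (smul_eq_zero.1 h2).resolve_left ht⟩
    rw [hp.2 F hF] at this
    simpa using this

lemma finite_not_isGeneric {φ : ℝ → V → Fin 3 → ℝ} (hφ : IsPolyCurve φ) {t₀ : ℝ}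
    (h : IsGeneric (φ t₀)) : {t | ¬ IsGeneric (φ t)}.Finite := by
  classical
  let A : V × V × V → Set ℝ := fun x => if x.1 ≠ x.2.1 ∧ x.1 ≠ x.2.2 ∧ x.2.1 ≠ x.2.2 then
    {t | ¬ Function.Injective (tripleMap x.1 x.2.1 x.2.2 (φ t))} else ∅
  let B : Set (Sym2 V) → Set ℝ := fun F => if GenIndep 3 F then
    {t | stressSpace (φ t) F ≠ ⊥} else ∅
  have hA : ∀ x, (A x).Finite := fun x => by
    simp only [A]
    split_ifs with hx
    · exact finite_setOf_not_injective _ hφ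
        (tripleMap_injective_iff.2 (h.1 _ _ _ hx.1 hx.2.1 hx.2.2))
    · exact Set.finite_empty
  have hB : ∀ F, (B F).Finite := fun F => by
    simp only [B]
    split_ifs with hF
    · exact finite_stressSpace_ne_bot hφ (h.2 F hF)
    · exact Set.finite_empty
  refine ((Set.finite_iUnion hA).union (Set.finite_iUnion hB)).subset fun t ht => ?_
  by_contra hcon
  simp only [Set.mem_union, Set.mem_iUnion, not_or, not_exists] at hcon
  refine ht ⟨fun i j k hij hik hjk => ?_, fun F hF => ?_⟩
  · have := hcon.1 (i, j, k)
    simp only [A, hij, hik, hjk, ne_eq, not_false_eq_true, and_self, if_true] at this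
    exact tripleMap_injective_iff.1 (not_not.1 this)
  · have := hcon.2 F
    simp only [B, hF, if_true] at this
    exact not_not.1 this

lemma exists_poly_adjugate {M : ℝ → Matrix V V ℝ}
    (h : ∀ i j, ∃ Q : Polynomial ℝ, ∀ t, M t i j = Q.eval t) (i j : V) :
    ∃ Q : Polynomial ℝ, ∀ t, (M t).adjugate i j = Q.eval t := by
  simp only [Matrix.adjugate_apply]
  refine exists_poly_det fun k l => ?_
  by_cases hk : k = j
  · subst hk
    exact ⟨Polynomial.C ((Pi.single i (1 : ℝ) : V → ℝ) l), fun t => by simp⟩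
  · obtain ⟨Q, hQ⟩ := h k l
    exact ⟨Q, fun t => by simp [hk, hQ]⟩

open scoped Classical in
/-- The configuration, unique up to scale, that agrees with a multiple of `p` outside `Y` and is in
equilibrium on `Y` with respect to `N`. -/
noncomputable def equilibrate (N : Matrix V V ℝ) (Y : Set V) (p : V → Fin 3 → ℝ) :
    V → Fin 3 → ℝ := fun i k => ((pin N Y).adjugate *ᵥ fun j =>
      if j ∈ Y then - ∑ l, N j l * (if l ∈ Y then 0 else p l k) else p j k) i

lemma pin_mulVec_equilibrate (N : Matrix V V ℝ) (Y : Set V) (p : V → Fin 3 → ℝ) (k : Fin 3) :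
    open scoped Classical in
    (pin N Y *ᵥ fun i => equilibrate N Y p i k) = (pin N Y).det • fun j =>
      if j ∈ Y then - ∑ l, N j l * (if l ∈ Y then 0 else p l k) else p j k := by
  classical
  have : (fun i => equilibrate N Y p i k) = (pin N Y).adjugate *ᵥ fun j =>
      if j ∈ Y then - ∑ l, N j l * (if l ∈ Y then 0 else p l k) else p j k := by
    funext i
    rfl
  rw [this, mulVec_mulVec, mul_adjugate, smul_mulVec, one_mulVec]

lemma equilibrate_of_notMem (N : Matrix V V ℝ) {Y : Set V} (p : V → Fin 3 → ℝ) {i : V}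
    (hi : i ∉ Y) : equilibrate N Y p i = (pin N Y).det • p i := by
  funext k
  have h := congrFun (pin_mulVec_equilibrate N Y p k) i
  rw [pin_mulVec_of_notMem N _ hi] at h
  simpa [hi] using h

lemma sum_equilibrate (N : Matrix V V ℝ) {Y : Set V} (p : V → Fin 3 → ℝ) {i : V} (hi : i ∈ Y) :
    ∑ j, N i j • equilibrate N Y p j = 0 := by
  classical
  funext k
  have h := congrFun (pin_mulVec_equilibrate N Y p k) i
  rw [pin_mulVec_of_mem N _ hi] at h
  simp only [Pi.smul_apply, if_pos hi, smul_eq_mul, mul_neg, Finset.mul_sum] at h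
  rw [eq_neg_iff_add_eq_zero, ← Finset.sum_add_distrib] at h
  simp only [Finset.sum_apply, Pi.smul_apply, smul_eq_mul, Pi.zero_apply]
  rw [← h]
  refine Finset.sum_congr rfl fun j _ => ?_
  by_cases hj : j ∈ Y
  · simp [hj]
  · rw [equilibrate_of_notMem N p hj]
    simp [hj]; ring

lemma equilibrate_eq {N : Matrix V V ℝ} {Y : Set V} {p : V → Fin 3 → ℝ}
    (h : ∀ i ∈ Y, ∑ j, N i j • p j = 0) : equilibrate N Y p = (pin N Y).det • p := by
  classical
  funext i k
  have : (fun j => if j ∈ Y then - ∑ l, N j l * (if l ∈ Y then 0 else p l k) else p j k)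
      = pin N Y *ᵥ fun j => p j k := by
    funext j
    by_cases hj : j ∈ Y
    · rw [pin_mulVec_of_mem N _ hj, if_pos hj, neg_eq_iff_add_eq_zero, ← Finset.sum_add_distrib]
      have h1 := congrFun (h j hj) k
      simp only [Finset.sum_apply, Pi.smul_apply, smul_eq_mul, Pi.zero_apply] at h1
      refine (Finset.sum_congr rfl fun l _ => ?_).trans h1
      by_cases hl : l ∈ Y <;> simp [hl]
    · rw [pin_mulVec_of_notMem N _ hj, if_neg hj]
  simp only [equilibrate]
  rw [this, mulVec_mulVec, adjugate_mul, smul_mulVec, one_mulVec]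
  rfl

lemma isPolyCurve_equilibrate {N : ℝ → Matrix V V ℝ}
    (h : ∀ i j, ∃ Q : Polynomial ℝ, ∀ t, N t i j = Q.eval t) (Y : Set V) (p : V → Fin 3 → ℝ) :
    IsPolyCurve fun t => equilibrate (N t) Y p := by
  classical
  refine IsPolyCurve.of_pi fun i k => ?_
  have hpin : ∀ i j, ∃ Q : Polynomial ℝ, ∀ t, pin (N t) Y i j = Q.eval t := by
    intro i j
    simp only [pin, of_apply]
    split_ifs
    · exact h i j
    · exact ⟨1, by simp⟩
    · exact ⟨0, by simp⟩
  choose Q hQ using exists_poly_adjugate hpin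
  choose R hR using h
  refine ⟨∑ j, Q i j * (if j ∈ Y then - ∑ l, R j l * Polynomial.C (if l ∈ Y then 0 else p l k)
    else Polynomial.C (p j k)), fun t => ?_⟩
  simp only [equilibrate, mulVec, dotProduct, Polynomial.eval_finsetSum, Polynomial.eval_mul, hQ]
  refine Finset.sum_congr rfl fun j _ => ?_
  by_cases hj : j ∈ Y
  · simp [hj, Polynomial.eval_finsetSum, hR]
  · simp [hj]

/-- Moving the blocks of a stress matrix along a line while keeping the configuration generic. -/
lemma exists_generic_near {F : Set (Sym2 V)} {Y : Set V} {p : V → Fin 3 → ℝ} (hp : IsGeneric p)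
    {N₀ N₁ : Matrix V V ℝ} (h₀ : N₀ ∈ patternSpace F) (h₁ : N₁ ∈ patternSpace F)
    (heq : ∀ i ∈ Y, ∑ j, N₀ i j • p j = 0) (hpin : PinnedInjective N₀ Y)
    {O : Matrix V V ℝ → Prop} (hO : ∀ᶠ N in 𝓝 N₁, O N) :
    ∃ q, IsGeneric q ∧ ∃ N ∈ patternSpace F, O N ∧ ∀ i ∈ Y, ∑ j, N i j • q j = 0 := by
  let N : ℝ → Matrix V V ℝ := fun t => N₀ + t • (N₁ - N₀)
  have hpoly : ∀ i j, ∃ Q : Polynomial ℝ, ∀ t, N t i j = Q.eval t := fun i j =>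
    ⟨Polynomial.C (N₀ i j) + Polynomial.X * Polynomial.C (N₁ i j - N₀ i j), fun t => by simp [N]⟩
  have hcurve := isPolyCurve_equilibrate hpoly Y p
  have h0 : IsGeneric (equilibrate (N 0) Y p) := by
    have : N 0 = N₀ := by simp [N]
    rw [this, equilibrate_eq heq]
    exact hp.smul (pinnedInjective_iff_det.1 hpin)
  have hfin := finite_not_isGeneric hcurve h0
  have hc : Tendsto N (𝓝 1) (𝓝 N₁) := by
    have : Continuous N := by fun_prop
    have h2 := this.tendsto 1
    simpa [N] using h2
  have ev1 : ∀ᶠ t in 𝓝[≠] (1 : ℝ), O (N t) := (hc.eventually hO).filter_mono nhdsWithin_le_nhds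
  have ev2 : ∀ᶠ t in 𝓝[≠] (1 : ℝ), IsGeneric (equilibrate (N t) Y p) := by
    have hcl : IsClosed ({t | ¬ IsGeneric (equilibrate (N t) Y p)} \ {1}) :=
      (hfin.subset Set.sdiff_subset).isClosed
    have hm : ({t | ¬ IsGeneric (equilibrate (N t) Y p)} \ {1})ᶜ ∈ 𝓝 (1 : ℝ) :=
      hcl.isOpen_compl.mem_nhds (by simp)
    filter_upwards [nhdsWithin_le_nhds hm, self_mem_nhdsWithin] with t ht ht1
    by_contra hng
    exact ht ⟨hng, ht1⟩
  obtain ⟨t, ht1, ht2⟩ := (ev1.and ev2).exists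
  exact ⟨_, ht2, N t, add_mem h₀ (Submodule.smul_mem _ _ (sub_mem h₁ h₀)), ht1,
    fun i hi => sum_equilibrate _ _ hi⟩

/-! ### Completing a pinned block to a stress matrix -/

open scoped Classical in
/-- The rows of `N` indexed by `Y`. -/
noncomputable def rowsOn (N : Matrix V V ℝ) (Y : Set V) : Matrix V V ℝ :=
  Matrix.of fun i j => if i ∈ Y then N i j else 0

/-- The matrix with the same rows in `Y` as `N` whose rank is that of its pinned block. -/
noncomputable def schur (N : Matrix V V ℝ) (Y : Set V) : Matrix V V ℝ :=
  (rowsOn N Y)ᵀ * (pin N Y)⁻¹ * rowsOn N Y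

lemma pin_symm {N : Matrix V V ℝ} (h : ∀ i j, N j i = N i j) (Y : Set V) :
    (pin N Y)ᵀ = pin N Y := by
  ext i j
  by_cases hi : i ∈ Y <;> by_cases hj : j ∈ Y <;> simp [pin, hi, hj, h i j, eq_comm (a := j)]

lemma schur_symm {N : Matrix V V ℝ} (h : ∀ i j, N j i = N i j) (Y : Set V) (i j : V) :
    schur N Y j i = schur N Y i j := by
  have : (schur N Y)ᵀ = schur N Y := by
    rw [schur, transpose_mul, transpose_mul, transpose_transpose, transpose_nonsing_inv,
      pin_symm h, Matrix.mul_assoc]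
  exact congrFun (congrFun this i) j

lemma schur_of_mem {N : Matrix V V ℝ} (h : ∀ i j, N j i = N i j) {Y : Set V}
    (hpin : PinnedInjective N Y) {i : V} (hi : i ∈ Y) (j : V) : schur N Y i j = N i j := by
  classical
  have hdet := pinnedInjective_iff_det.1 hpin
  have h1 : ∀ k, (rowsOn N Y)ᵀ i k = pin N Y i k := by
    intro k
    simp only [transpose_apply, rowsOn, pin, of_apply, hi, true_and]
    by_cases hk : k ∈ Y
    · simp [hk, h i k]
    · have : i ≠ k := fun h => hk (h ▸ hi)
      simp [hk, this]
  have h2 : ∀ l, ((rowsOn N Y)ᵀ * (pin N Y)⁻¹) i l = (1 : Matrix V V ℝ) i l := by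
    intro l
    rw [← Matrix.mul_nonsing_inv (pin N Y) (isUnit_iff_ne_zero.2 hdet), mul_apply, mul_apply]
    exact Finset.sum_congr rfl fun k _ => by rw [h1]
  rw [schur, mul_apply, Finset.sum_eq_single i]
  · rw [h2]; simp [rowsOn, hi]
  · intro l _ hl; rw [h2, one_apply_ne hl.symm, zero_mul]
  · simp

lemma schur_mem {N : Matrix V V ℝ} {F : Set (Sym2 V)} (hN : N ∈ patternSpace F) {Y : Set V}
    (hpin : PinnedInjective N Y) {X : Set V} (hF : F ⊆ edgesOn X) (hY : Y ⊆ X) {a b c : V}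
    (hXY : X \ Y ⊆ {a, b, c}) (htri : tri a b c ⊆ F) {q : V → Fin 3 → ℝ}
    (hq : ∀ i ∈ Y, ∑ j, N i j • q j = 0) : schur N Y ∈ stressSpace q F := by
  classical
  refine ⟨⟨schur_symm hN.1 Y, fun i j hij hn => ?_⟩, fun i => ?_⟩
  · by_cases hi : i ∈ Y
    · rw [schur_of_mem hN.1 hpin hi]; exact hN.2 i j hij hn
    by_cases hj : j ∈ Y
    · rw [schur_symm hN.1, schur_of_mem hN.1 hpin hj, hN.1]; exact hN.2 i j hij hn
    have hcol : ∀ x ∉ X, ∀ k, rowsOn N Y k x = 0 := by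
      intro x hx k
      simp only [rowsOn, of_apply]
      split_ifs with hk
      · exact hN.2 k x (fun h => hx (h ▸ hY hk)) fun hm => hx (mk_mem_edgesOn.1 (hF hm)).2.2
      · rfl
    by_cases hiX : i ∈ X
    · by_cases hjX : j ∈ X
      · exfalso
        apply hn
        apply htri
        have h1 := hXY ⟨hiX, hi⟩
        have h2 := hXY ⟨hjX, hj⟩
        simp only [Set.mem_insert_iff, Set.mem_singleton_iff] at h1 h2
        simp only [tri, Set.mem_insert_iff, Set.mem_singleton_iff, Sym2.eq_iff]
        rcases h1 with h1 | h1 | h1 <;> rcases h2 with h2 | h2 | h2 <;>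
          simp [h1, h2] <;> exact (hij (h1.trans h2.symm)).elim
      · rw [schur, mul_apply]
        exact Finset.sum_eq_zero fun k _ => by rw [hcol j hjX, mul_zero]
    · rw [schur_symm hN.1, schur, mul_apply]
      exact Finset.sum_eq_zero fun k _ => by rw [hcol i hiX, mul_zero]
  · have h1 : ∀ k, ∑ j, rowsOn N Y k j • q j = 0 := by
      intro k
      by_cases hk : k ∈ Y
      · simp only [rowsOn, of_apply, if_pos hk]; exact hq k hk
      · simp [rowsOn, hk]
    have h2 : ∀ j, schur N Y i j • q j
        = ∑ k, ((rowsOn N Y)ᵀ * (pin N Y)⁻¹) i k • (rowsOn N Y k j • q j) := by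
      intro j
      rw [schur, mul_apply, Finset.sum_smul]
      exact Finset.sum_congr rfl fun k _ => by rw [mul_smul]
    simp only [h2]
    rw [Finset.sum_comm]
    refine Finset.sum_eq_zero fun k _ => ?_
    rw [← Finset.smul_sum, h1, smul_zero]

lemma continuousAt_schur {N : Matrix V V ℝ} {Y : Set V} (hpin : PinnedInjective N Y) :
    ContinuousAt (fun N => schur N Y) N := by
  classical
  have hdet := pinnedInjective_iff_det.1 hpin
  have hr : Continuous fun N : Matrix V V ℝ => rowsOn N Y := by
    refine continuous_matrix fun i j => ?_
    simp only [rowsOn, of_apply]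
    split_ifs
    · exact continuous_id.matrix_elem i j
    · exact continuous_const
  have hinv : ContinuousAt (fun N : Matrix V V ℝ => (pin N Y)⁻¹) N := by
    have h3 : ContinuousAt (fun N => (pin N Y).det⁻¹ • (pin N Y).adjugate) N :=
      ((continuous_pin Y).matrix_det.continuousAt.inv₀ hdet).smul
        (continuous_pin Y).matrix_adjugate.continuousAt
    simpa [Matrix.inv_def] using h3
  exact (hr.matrix_transpose.continuousAt.mul hinv).mul hr.continuousAt

end Positivity

/-! ### Positive semidefinite stresses of 3-connected circuits -/

section OpenPSD

open Topology Filter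

variable {V : Type*} [Fintype V] [DecidableEq V]

local notation "𝓜" => rigidityMatroid V

/-- There is a nonzero positive semidefinite stress of `F` depending continuously on the
configuration in some open set. -/
def HasOpenPSD (d : ℕ) (F : Set (Sym2 V)) : Prop :=
  ∃ (U : Set (V → Fin d → ℝ)) (k : (V → Fin d → ℝ) → Matrix V V ℝ), IsOpen U ∧ U.Nonempty ∧
    ContinuousOn k U ∧ ∀ p ∈ U, k p ∈ stressSpace p F ∧ (k p).PosSemidef ∧ k p ≠ 0

lemma HasOpenPSD.mono {d : ℕ} {F F' : Set (Sym2 V)} (h : HasOpenPSD d F) (hF : F ⊆ F') :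
    HasOpenPSD d F' := by
  obtain ⟨U, k, hU, hne, hk, hP⟩ := h
  exact ⟨U, k, hU, hne, hk, fun p hp => ⟨stressSpace_mono p hF (hP p hp).1, (hP p hp).2⟩⟩

lemma PinnedPos.congr {K L : Matrix V V ℝ} {Y : Set V} (h : PinnedPos K Y)
    (hL : ∀ i ∈ Y, ∀ j ∈ Y, L i j = K i j) : PinnedPos L Y := by
  intro g hg hne
  refine lt_of_lt_of_eq (h g hg hne) ?_
  simp only [dotProduct, mulVec]
  refine Finset.sum_congr rfl fun i _ => ?_
  by_cases hi : i ∈ Y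
  · congr 1
    refine Finset.sum_congr rfl fun j _ => ?_
    by_cases hj : j ∈ Y
    · rw [hL i hi j hj]
    · simp [hg j hj]
  · simp [hg i hi]

/-- A matrix with support in `F` and positive definite block on `Y` which is in equilibrium on `Y`
with the generic configuration `q`. -/
structure IsBalanced (F : Set (Sym2 V)) (Y : Set V) (q : V → Fin 3 → ℝ) (N : Matrix V V ℝ) :
    Prop where
  generic : IsGeneric q
  mem : N ∈ patternSpace F
  pos : PinnedPos N Y
  eq_zero : ∀ i ∈ Y, ∑ j, N i j • q j = 0

lemma exists_isBalanced {F : Set (Sym2 V)} {Y : Set V} {p : V → Fin 3 → ℝ} (hp : IsGeneric p)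
    {K : Matrix V V ℝ} (hK : K ∈ stressSpace p F) (hpin : PinnedInjective K Y) :
    ∃ q N, IsBalanced F Y q N := by
  classical
  let N₁ : Matrix V V ℝ := Matrix.of fun i j => if i ∈ Y ∧ j ∈ Y then (if i = j then 1 else 0)
    else K i j
  have hN₁ : N₁ ∈ patternSpace F := by
    refine ⟨fun i j => ?_, fun i j hij hn => ?_⟩
    · simp only [N₁, of_apply, hK.1.1 i j]
      by_cases hi : i ∈ Y <;> by_cases hj : j ∈ Y <;> simp [hi, hj, eq_comm (a := j)]
    · simp only [N₁, of_apply, if_neg hij, hK.1.2 i j hij hn, ite_self]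
  have hpos : PinnedPos N₁ Y := by
    have h1 : PinnedPos (1 : Matrix V V ℝ) Y := fun g _ hne => by
      rw [one_mulVec]
      exact lt_of_le_of_ne (Finset.sum_nonneg fun i _ => mul_self_nonneg _)
        fun h => hne (dotProduct_self_eq_zero.1 h.symm)
    exact h1.congr fun i hi j hj => by simp [N₁, hi, hj, one_apply]
  obtain ⟨q, hq, N, hN, hO, heq⟩ := exists_generic_near hp hK.1 hN₁ (fun i _ => hK.2 i) hpin
    hpos.eventually
  exact ⟨q, N, hq, hN, hO, heq⟩

/-- Column `b` of the rows in `Y`, solved against the pinned block. -/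
noncomputable def solveCol (N : Matrix V V ℝ) (Y : Set V) (b : V) : V → ℝ :=
  (pin N Y)⁻¹ *ᵥ fun k => rowsOn N Y k b

lemma schur_apply (N : Matrix V V ℝ) (Y : Set V) (a b : V) :
    schur N Y a b = (fun k => rowsOn N Y k a) ⬝ᵥ solveCol N Y b := by
  rw [schur, Matrix.mul_assoc, mul_apply]
  rfl

lemma pin_mulVec_solveCol {N : Matrix V V ℝ} {Y : Set V} (hpin : PinnedInjective N Y) (b : V) :
    pin N Y *ᵥ solveCol N Y b = fun k => rowsOn N Y k b := by
  have hdet := pinnedInjective_iff_det.1 hpin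
  rw [solveCol, mulVec_mulVec, mul_nonsing_inv _ (isUnit_iff_ne_zero.2 hdet), one_mulVec]

lemma solveCol_of_notMem {N : Matrix V V ℝ} {Y : Set V} (hpin : PinnedInjective N Y) (b : V) {i : V}
    (hi : i ∉ Y) : solveCol N Y b i = 0 := by
  have := congrFun (pin_mulVec_solveCol hpin b) i
  rw [pin_mulVec_of_notMem N _ hi] at this
  rw [this]
  simp [rowsOn, hi]

lemma mulVec_solveCol {N : Matrix V V ℝ} {Y : Set V} (hpin : PinnedInjective N Y) (b : V) {i : V}
    (hi : i ∈ Y) : (N *ᵥ solveCol N Y b) i = N i b := by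
  have := congrFun (pin_mulVec_solveCol hpin b) i
  rw [pin_mulVec_eq (fun j hj => solveCol_of_notMem hpin b hj) hi] at this
  rw [this]
  simp [rowsOn, hi]

lemma exists_solve {m₁ m₂ n₁ n₂ : ℝ} (h : ∀ x y : ℝ, x * m₁ + y * n₁ = 0 → x * m₂ + y * n₂ = 0 →
    x = 0 ∧ y = 0) (u w : ℝ) : ∃ δ ε : ℝ, δ * m₁ + ε * m₂ = u ∧ δ * n₁ + ε * n₂ = w := by
  have hD : m₁ * n₂ - m₂ * n₁ ≠ 0 := by
    intro h0
    obtain ⟨h1, h2⟩ := h n₁ (-m₁) (by ring) (by linarith)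
    obtain ⟨h3, h4⟩ := h n₂ (-m₂) (by linarith) (by ring)
    have h5 : m₁ = 0 := by linarith
    have h6 : m₂ = 0 := by linarith
    have := h 1 0 (by rw [h5, h1]; ring) (by rw [h6, h3]; ring)
    exact one_ne_zero this.1
  refine ⟨(u * n₂ - w * m₂) / (m₁ * n₂ - m₂ * n₁), (w * m₁ - u * n₁) / (m₁ * n₂ - m₂ * n₁), ?_, ?_⟩
  · rw [div_mul_eq_mul_div, div_mul_eq_mul_div, ← add_div, div_eq_iff hD]; ring
  · rw [div_mul_eq_mul_div, div_mul_eq_mul_div, ← add_div, div_eq_iff hD]; ring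

lemma rowsOn_add_edgeMat {Y : Set V} {a s : V} (ha : a ∉ Y) (hs : s ∈ Y) (N : Matrix V V ℝ)
    (δ : ℝ) : rowsOn (N + δ • edgeMat s(a, s)) Y = rowsOn N Y + δ • vecMulVec (Pi.single s 1)
      (Pi.single a 1) := by
  ext i j
  simp only [rowsOn, of_apply, Matrix.add_apply, Matrix.smul_apply, edgeMat_apply, vecMulVec_apply,
    smul_eq_mul, Sym2.eq_iff, Pi.single_apply]
  by_cases hi : i ∈ Y
  · have h1 : i ≠ a := fun h => ha (h ▸ hi)
    by_cases h2 : i = s <;> by_cases h3 : j = a <;> simp [hi, h1, h2, h3]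
    all_goals simp_all
  · have h1 : i ≠ s := fun h => hi (h ▸ hs)
    simp [hi, h1]

lemma pin_add_edgeMat {Y : Set V} {a s : V} (ha : a ∉ Y) (N : Matrix V V ℝ)
    (δ : ℝ) : pin (N + δ • edgeMat s(a, s)) Y = pin N Y := by
  ext i j
  simp only [pin, of_apply]
  split_ifs with h
  · have h1 : i ≠ a := fun e => ha (e ▸ h.1)
    have h2 : j ≠ a := fun e => ha (e ▸ h.2)
    simp [edgeMat_apply, h1, h2]
  · rfl
  · rfl

lemma solveCol_add_edgeMat {Y : Set V} {a s b : V} (ha : a ∉ Y) (hs : s ∈ Y) (hb : b ≠ a)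
    (N : Matrix V V ℝ) (δ : ℝ) : solveCol (N + δ • edgeMat s(a, s)) Y b = solveCol N Y b := by
  rw [solveCol, pin_add_edgeMat ha, rowsOn_add_edgeMat ha hs, solveCol]
  congr 1
  funext k
  simp [vecMulVec_apply, hb]

lemma schur_add_edgeMat {Y : Set V} {a s b : V} (ha : a ∉ Y) (hs : s ∈ Y) (hb : b ≠ a)
    (N : Matrix V V ℝ) (δ : ℝ) (i : V) : schur (N + δ • edgeMat s(a, s)) Y i b =
      schur N Y i b + if i = a then δ * solveCol N Y b s else 0 := by
  rw [schur_apply, solveCol_add_edgeMat ha hs hb, schur_apply, rowsOn_add_edgeMat ha hs]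
  have : (fun k => (rowsOn N Y + δ • vecMulVec (Pi.single s 1) (Pi.single a 1) : Matrix V V ℝ) k i)
      = (fun k => rowsOn N Y k i) + Pi.single s (if i = a then δ else 0) := by
    funext k
    simp only [Matrix.add_apply, Matrix.smul_apply, vecMulVec_apply, Pi.single_apply, Pi.add_apply,
      smul_eq_mul]
    by_cases h1 : k = s <;> by_cases h2 : i = a <;> simp [h1, h2]
  rw [this, add_dotProduct, single_dotProduct]
  split_ifs <;> simp

lemma PinnedPos.add_edgeMat {Y : Set V} {a s : V} (ha : a ∉ Y) {N : Matrix V V ℝ}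
    (h : PinnedPos N Y) (δ : ℝ) : PinnedPos (N + δ • edgeMat s(a, s)) Y :=
  h.congr fun i hi j hj => by
    have h1 : i ≠ a := fun e => ha (e ▸ hi)
    have h2 : j ≠ a := fun e => ha (e ▸ hj)
    simp [edgeMat_apply, h1, h2]

/-- The entries of the completed stress at `ab` and `ac` can be prescribed by changing the entries
at two edges from `a` into `Y`. -/
lemma IsBalanced.exists_schur_eq {F : Set (Sym2 V)} {X Y : Set V} {q : V → Fin 3 → ℝ}
    {N : Matrix V V ℝ} (h : IsBalanced F Y q N) (hF : F ⊆ edgesOn X) {a b c : V}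
    (hXY : X \ Y ⊆ {a, b, c}) (ha : a ∉ Y) (hb : b ∉ Y) (hc : c ∉ Y) (hab : a ≠ b) (hac : a ≠ c)
    (hbc : b ≠ c) {s s' : V} (hs : s ∈ Y) (hs' : s' ∈ Y) (hss : s ≠ s') (hsF : s(a, s) ∈ F)
    (hsF' : s(a, s') ∈ F) (u w : ℝ) :
    ∃ N₁ ∈ patternSpace F, PinnedPos N₁ Y ∧ schur N₁ Y a b = u ∧ schur N₁ Y a c = w ∧
      schur N₁ Y b c = schur N Y b c := by
  classical
  have hpin := h.pos.pinnedInjective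
  have key : ∀ x y : ℝ, x * solveCol N Y b s + y * solveCol N Y c s = 0 →
      x * solveCol N Y b s' + y * solveCol N Y c s' = 0 → x = 0 ∧ y = 0 := by
    intro x y h1 h2
    obtain ⟨l, la, lb, lc⟩ := h.generic.1.exists_functional hab hac hbc 0 x y
    let g : V → ℝ := fun i => if i ∈ Y then
      q i ⬝ᵥ l + x * solveCol N Y b i + y * solveCol N Y c i else 0
    have hg : g = 0 := by
      refine hpin g (fun i hi => by simp [g, hi]) fun i hi => ?_
      have e1 : ∑ j, N i j * (q j ⬝ᵥ l) = 0 := by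
        have := congrArg (· ⬝ᵥ l) (h.eq_zero i hi)
        simpa [sum_dotProduct] using this
      have e2 := mulVec_solveCol hpin b hi
      have e3 := mulVec_solveCol hpin c hi
      simp only [mulVec, dotProduct] at e2 e3
      have e4 : ∑ j, N i j * (if j ∈ Y then 0 else q j ⬝ᵥ l) = N i b * x + N i c * y := by
        rw [sum_eq_three hab hac hbc]
        · simp [ha, hb, hc, la, lb, lc]
        · intro j h1 h2 h3
          by_cases hj : j ∈ Y
          · simp [hj]
          · rw [h.mem.2 i j (fun e => hj (e ▸ hi)) fun hm => ?_, zero_mul]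
            have := hXY ⟨(mk_mem_edgesOn.1 (hF hm)).2.2, hj⟩
            simp [h1, h2, h3] at this
      have e5 : (N *ᵥ g) i = ∑ j, N i j * (q j ⬝ᵥ l)
          - ∑ j, N i j * (if j ∈ Y then 0 else q j ⬝ᵥ l)
          + x * ∑ j, N i j * solveCol N Y b j + y * ∑ j, N i j * solveCol N Y c j := by
        change ∑ j, N i j * g j = _
        rw [Finset.mul_sum, Finset.mul_sum, ← Finset.sum_sub_distrib, ← Finset.sum_add_distrib,
          ← Finset.sum_add_distrib]
        refine Finset.sum_congr rfl fun j _ => ?_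
        by_cases hj : j ∈ Y
        · simp only [g, if_pos hj]; ring
        · simp [g, hj, solveCol_of_notMem hpin _ hj]
      rw [e5, e1, e2, e3, e4]; ring
    have z : ∀ i ∈ Y, x * solveCol N Y b i + y * solveCol N Y c i = 0 → q i ⬝ᵥ l = 0 := by
      intro i hi h0
      have := congrFun hg i
      simp only [g, if_pos hi, Pi.zero_apply] at this
      linarith
    have hl := h.generic.1.eq_zero_of_dot (a := a) (b := s) (c := s')
      (fun e => ha (e ▸ hs)) (fun e => ha (e ▸ hs')) hss la
      (z s hs h1) (z s' hs' h2)
    rw [hl] at lb lc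
    simp only [dotProduct_zero] at lb lc
    exact ⟨lb.symm, lc.symm⟩
  obtain ⟨δ, ε, e1, e2⟩ := exists_solve key (u - schur N Y a b) (w - schur N Y a c)
  refine ⟨N + δ • edgeMat s(a, s) + ε • edgeMat s(a, s'), ?_, (h.pos.add_edgeMat ha _).add_edgeMat
    ha _, ?_, ?_, ?_⟩
  · exact Submodule.add_mem _ (Submodule.add_mem _ h.mem (Submodule.smul_mem _ _ (edgeMat_mem hsF)))
      (Submodule.smul_mem _ _ (edgeMat_mem hsF'))
  · rw [schur_add_edgeMat ha hs' hab.symm, schur_add_edgeMat ha hs hab.symm,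
      solveCol_add_edgeMat ha hs hab.symm, if_pos rfl, if_pos rfl]
    linarith
  · rw [schur_add_edgeMat ha hs' hac.symm, schur_add_edgeMat ha hs hac.symm,
      solveCol_add_edgeMat ha hs hac.symm, if_pos rfl, if_pos rfl]
    linarith
  · rw [schur_add_edgeMat ha hs' hac.symm, schur_add_edgeMat ha hs hac.symm,
      if_neg hab.symm, if_neg hab.symm, add_zero, add_zero]

lemma IsBalanced.move {F : Set (Sym2 V)} {Y : Set V} {q : V → Fin 3 → ℝ}
    {N N₁ : Matrix V V ℝ} (h : IsBalanced F Y q N) (h₁ : N₁ ∈ patternSpace F)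
    (hpos : PinnedPos N₁ Y)
    {O : Matrix V V ℝ → Prop} (hO : ∀ᶠ K in 𝓝 (schur N₁ Y), O K) :
    ∃ q' N', IsBalanced F Y q' N' ∧ O (schur N' Y) := by
  have h2 : ∀ᶠ K in 𝓝 N₁, O (schur K Y) := (continuousAt_schur hpos.pinnedInjective).eventually hO
  obtain ⟨q', hq, N', hN, hO', heq⟩ := exists_generic_near h.generic h.mem h₁ h.eq_zero
    h.pos.pinnedInjective (hpos.eventually.and h2)
  exact ⟨q', N', ⟨hq, hN, hO'.1, heq⟩, hO'.2⟩

lemma eventually_pos_entry {K : Matrix V V ℝ} {i j : V} (h : 0 < K i j) :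
    ∀ᶠ L in 𝓝 K, 0 < L i j := by
  have : Continuous fun L : Matrix V V ℝ => L i j := continuous_id.matrix_elem i j
  exact this.continuousAt.eventually (lt_mem_nhds h)

lemma eventually_neg_entry {K : Matrix V V ℝ} {i j : V} (h : K i j < 0) :
    ∀ᶠ L in 𝓝 K, L i j < 0 := by
  have : Continuous fun L : Matrix V V ℝ => L i j := continuous_id.matrix_elem i j
  exact this.continuousAt.eventually (gt_mem_nhds h)

lemma IsBalanced.exists_signs {F : Set (Sym2 V)} {X Y : Set V} {q : V → Fin 3 → ℝ}
    {N : Matrix V V ℝ} (h : IsBalanced F Y q N) (hF : F ⊆ edgesOn X) {a b c : V}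
    (hXY : X \ Y ⊆ {a, b, c}) (ha : a ∉ Y) (hb : b ∉ Y) (hc : c ∉ Y) (hab : a ≠ b) (hac : a ≠ c)
    (hbc : b ≠ c) (hna : ∃ s ∈ Y, ∃ s' ∈ Y, s ≠ s' ∧ s(a, s) ∈ F ∧ s(a, s') ∈ F)
    (hnb : ∃ s ∈ Y, ∃ s' ∈ Y, s ≠ s' ∧ s(b, s) ∈ F ∧ s(b, s') ∈ F) :
    ∃ q' N', IsBalanced F Y q' N' ∧ 0 < schur N' Y a b ∧ schur N' Y a c < 0 ∧
      0 < schur N' Y b c := by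
  obtain ⟨s, hs, s', hs', hss, hsF, hsF'⟩ := hnb
  obtain ⟨N₁, hN₁, hp₁, h1, -, -⟩ := h.exists_schur_eq hF
    (a := b) (b := c) (c := a) (hXY.trans (by rintro x (rfl | rfl | rfl) <;> simp)) hb hc ha hbc
    hab.symm hac.symm hs hs' hss hsF hsF' 1 1
  obtain ⟨q₂, N₂, h2, hbc2⟩ := h.move hN₁ hp₁
    (eventually_pos_entry (i := b) (j := c) (by rw [h1]; norm_num))
  obtain ⟨t, ht, t', ht', htt, htF, htF'⟩ := hna
  obtain ⟨N₃, hN₃, hp₃, h3, h4, h5⟩ := h2.exists_schur_eq hF hXY ha hb hc hab hac hbc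
    ht ht' htt htF htF' 1 (-1)
  exact h2.move hN₃ hp₃ ((eventually_pos_entry (by rw [h3]; norm_num)).and
    ((eventually_neg_entry (by rw [h4]; norm_num)).and
      (eventually_pos_entry (by rw [h5]; exact hbc2))))

lemma exists_cancel_of_pos {k₁ k₂ k₃ : ℝ} (h₁ : 0 < k₁) (h₂ : 0 < k₂) (h₃ : k₃ < 0) :
    ∃ α β γ : ℝ, k₁ + α * β = 0 ∧ k₂ + β * γ = 0 ∧ k₃ + α * γ = 0 := by
  have hx : 0 < -(k₁ * k₃) / k₂ := div_pos (by nlinarith) h₂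
  obtain ⟨r, hr, hr2⟩ : ∃ r : ℝ, 0 < r ∧ r * r = -(k₁ * k₃) / k₂ :=
    ⟨√(-(k₁ * k₃) / k₂), Real.sqrt_pos.2 hx, Real.mul_self_sqrt hx.le⟩
  refine ⟨r, -k₁ / r, -k₃ / r, by field_simp; ring, ?_, by field_simp; ring⟩
  have : -k₁ / r * (-k₃ / r) = k₁ * k₃ / (r * r) := by field_simp
  rw [this, hr2]
  have := h₃.ne
  field_simp
  ring

lemma IsClawAt.exists_two_neighbors {F : Set (Sym2 V)} {X : Set V} {v a b c : V}
    (h : IsClawAt F v a b c) (hF : F ⊆ edgesOn X) (hdeg : 3 ≤ (starAt F a).ncard)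
    (hab : s(a, b) ∉ F) (hac : s(a, c) ∉ F) :
    ∃ s ∈ (X \ {v}) \ {a, b, c}, ∃ s' ∈ (X \ {v}) \ {a, b, c}, s ≠ s' ∧
      s(a, s) ∈ yDelta F v a b c ∧ s(a, s') ∈ yDelta F v a b c := by
  have hva : s(a, v) ∈ starAt F a :=
    ⟨by rw [Sym2.eq_swap]; exact h.claw_subset (Or.inl rfl), by simp⟩
  have h1 : (starAt F a \ {s(a, v)}).ncard + 1 = (starAt F a).ncard :=
    Set.ncard_sdiff_singleton_add_one hva
  obtain ⟨e, f, he, hf, hef⟩ := (Set.one_lt_ncard_iff (s := starAt F a \ {s(a, v)})).1 (by omega)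
  have key : ∀ e ∈ starAt F a \ {s(a, v)}, ∃ s ∈ (X \ {v}) \ {a, b, c}, e = s(a, s) ∧
      s(a, s) ∈ yDelta F v a b c := by
    rintro e ⟨⟨heF, hae⟩, hne⟩
    obtain ⟨s, rfl⟩ := Sym2.mem_iff_exists.1 hae
    have hX := mk_mem_edgesOn.1 (hF heF)
    have hsv : s ≠ v := fun h => hne (by simp [h])
    refine ⟨s, ⟨⟨hX.2.2, hsv⟩, ?_⟩, rfl, Or.inl ⟨heF, fun hm => ?_⟩⟩
    · rintro (rfl | rfl | rfl)
      · exact hX.1 rfl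
      · exact hab heF
      · exact hac heF
    · have := hm.2
      simp [h.va, hsv.symm] at this
  obtain ⟨s, hs, rfl, hsF⟩ := key e he
  obtain ⟨s', hs', rfl, hsF'⟩ := key f hf
  exact ⟨s, hs, s', hs', fun e => hef (by rw [e]), hsF, hsF'⟩

lemma IsClawAt.pinnedPos {F : Set (Sym2 V)} {X : Set V} {v a b c : V}
    (h : IsClawAt F v a b c) (hF : F ⊆ edgesOn X) {p : V → Fin 3 → ℝ} (hp : GenPos p)
    {K : Matrix V V ℝ} (hK : K ∈ stressSpace p (yDelta F v a b c))
    (hpin : PinnedPos K ((X \ {v}) \ {a, b, c})) (α β γ : ℝ) :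
    PinnedPos (K + vecMulVec (starVec v a b c α β γ) (starVec v a b c α β γ)) (X \ {a, b, c}) := by
  intro g hg hne
  have ga : g a = 0 := hg a (by simp)
  have gb : g b = 0 := hg b (by simp)
  have gc : g c = 0 := hg c (by simp)
  have hrow := h.row_yDelta hF hp hK
  have hcol : ∀ i, K i v = 0 := fun i => by rw [hK.1.1 v i]; exact hrow i
  let g' : V → ℝ := Function.update g v 0
  have hg' : ∀ i, i ≠ v → g' i = g i := fun i hi => Function.update_of_ne hi _ _
  have hKg : ∀ i, (K *ᵥ g') i = (K *ᵥ g) i := fun i => by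
    simp only [mulVec, dotProduct]
    refine Finset.sum_congr rfl fun j _ => ?_
    by_cases hj : j = v
    · rw [hj, hcol, zero_mul, zero_mul]
    · rw [hg' j hj]
  have e1 : g' ⬝ᵥ (K *ᵥ g') = g ⬝ᵥ (K *ᵥ g) := by
    refine Finset.sum_congr rfl fun i _ => ?_
    rw [hKg]
    by_cases hi : i = v
    · have : (K *ᵥ g) i = 0 := by
        rw [hi]; exact Finset.sum_eq_zero fun j _ => mul_eq_zero_of_left (hrow j) _
      rw [this, mul_zero, mul_zero]
    · rw [hg' i hi]
  have e2 : g ⬝ᵥ ((K + vecMulVec (starVec v a b c α β γ) (starVec v a b c α β γ)) *ᵥ g)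
      = g' ⬝ᵥ (K *ᵥ g') + g v * g v := by
    rw [e1, add_mulVec, dotProduct_add, vecMulVec_mulVec, starVec_dot α β γ ga gb gc]
    congr 1
    rw [dotProduct_comm]
    simp only [smul_dotProduct, starVec_dot α β γ ga gb gc]
    rfl
  rw [e2]
  by_cases h0 : g' = 0
  · have : g v ≠ 0 := fun hv => hne <| by
      funext i
      by_cases hi : i = v
      · rw [hi, hv]; rfl
      · rw [← hg' i hi, h0]
    rw [h0]
    simpa using mul_self_pos.2 this
  · have := hpin g' (fun i hi => ?_) h0
    · nlinarith [mul_self_nonneg (g v)]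
    · by_cases hv : i = v
      · simp [g', hv]
      · rw [hg' i hv]
        exact hg i fun hm => hi ⟨⟨hm.1, hv⟩, hm.2⟩

/-- A degree-three vertex can be reinstated while keeping the pinned block positive definite. -/
lemma IsClawAt.hasOpenPSD {F : Set (Sym2 V)} {X : Set V} (hM : MConn 𝓜 F) {v a b c : V}
    (h : IsClawAt F v a b c) (hF : F ⊆ edgesOn X) {p : V → Fin 3 → ℝ} (hp : IsGeneric p)
    {K : Matrix V V ℝ} (hK : K ∈ stressSpace p (yDelta F v a b c))
    (hpin : PinnedPos K ((X \ {v}) \ {a, b, c})) {α β γ : ℝ}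
    (hab : s(a, b) ∉ F → K a b + α * β = 0) (hbc : s(b, c) ∉ F → K b c + β * γ = 0)
    (hac : s(a, c) ∉ F → K a c + α * γ = 0) : HasOpenPSD 3 F := by
  let q : V → Fin 3 → ℝ := Function.update p v (α • p a + β • p b + γ • p c)
  have hpq : ∀ i, i ≠ v → q i = p i := fun i hi => Function.update_of_ne hi _ _
  have hG := h.add_mem hF hpq hp.1 hK (α := α) (β := β) (γ := γ) (t := 1) (by simp [q])
    (by simpa using hab) (by simpa using hbc) (by simpa using hac)
  rw [one_smul] at hG
  have hGp := h.pinnedPos hF hp.1 hK hpin α β γ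
  obtain ⟨U, k, hU, hqU, hk, hkq, hkU⟩ := h.exists_continuous_stress hM hpq hp hG
  have hev : ∀ᶠ r in 𝓝 q, PinnedPos (k r) (X \ {a, b, c}) := by
    have := (hk.continuousAt (hU.mem_nhds hqU))
    rw [ContinuousAt, hkq] at this
    exact this.eventually hGp.eventually
  obtain ⟨W, hW, hWo, hqW⟩ := eventually_nhds_iff.1 hev
  obtain ⟨r, hrW, hr⟩ := (dense_isGeneric (V := V)).inter_open_nonempty (U ∩ W) (hU.inter hWo)
    ⟨q, hqU, hqW⟩
  obtain ⟨W', hW', hWo', hrW'⟩ := eventually_nhds_iff.1 hr.eventually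
  have hvX : v ∈ X := (mk_mem_edgesOn.1 (hF (h.claw_subset (Or.inl rfl)))).2.1
  refine ⟨U ∩ W ∩ W', k, (hU.inter hWo).inter hWo', ⟨r, hrW, hrW'⟩,
    hk.mono fun x hx => hx.1.1, fun x hx => ?_⟩
  have hpos := hW x hx.1.2
  refine ⟨hkU x hx.1.1, hpos.posSemidef (hW' x hx.2).1 hF (hkU x hx.1.1) h.ab h.ac h.bc, ?_⟩
  intro h0
  have := hpos (Pi.single v 1) (fun i hi => ?_) (by simp)
  · simp [h0] at this
  · refine Pi.single_eq_of_ne (fun e => hi ?_) _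
    rw [e]
    exact ⟨hvX, by simp [h.va, h.vb, h.vc]⟩

theorem hasOpenPSD_of_conn3 {F : Set (Sym2 V)} {X : Set V} (hM : MConn 𝓜 F) (h3 : Conn3 F X)
    {v : V} (hv : (starAt F v).ncard = 3) : HasOpenPSD 3 F := by
  obtain ⟨a, b, c, h⟩ := exists_isClawAt (fun e he => (h3.1 he).1) hv
  obtain ⟨p, hp, K, hK, hpin⟩ := h.exists_reduced h3 fun h5 =>
    hasFullStress_of_conn3 (hM.yDelta h (h3.yDelta h h5)) (h3.yDelta h h5)
  obtain ⟨q, N, hN⟩ := exists_isBalanced hp hK hpin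
  have hF' := h.yDelta_subset h3.1
  have hXY : (X \ {v}) \ ((X \ {v}) \ {a, b, c}) ⊆ {a, b, c} := fun x hx => by
    by_contra hn; exact hx.2 ⟨hx.1, hn⟩
  have htri : tri a b c ⊆ yDelta F v a b c := Set.subset_union_right
  have hmem : ∀ {q N}, IsBalanced (yDelta F v a b c) ((X \ {v}) \ {a, b, c}) q N →
      schur N ((X \ {v}) \ {a, b, c}) ∈ stressSpace q (yDelta F v a b c) := fun hN =>
    schur_mem hN.mem hN.pos.pinnedInjective hF' Set.sdiff_subset hXY htri hN.eq_zero
  have hpos : ∀ {q N}, IsBalanced (yDelta F v a b c) ((X \ {v}) \ {a, b, c}) q N →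
      PinnedPos (schur N ((X \ {v}) \ {a, b, c})) ((X \ {v}) \ {a, b, c}) := fun hN =>
    hN.pos.congr fun i hi j _ => schur_of_mem hN.mem.1 hN.pos.pinnedInjective hi j
  by_cases hab : s(a, b) ∈ F
  · refine h.hasOpenPSD hM h3.1 hN.generic (hmem hN) (hpos hN) (γ := 1)
      (α := -schur N ((X \ {v}) \ {a, b, c}) a c) (β := -schur N ((X \ {v}) \ {a, b, c}) b c)
      (fun hn => (hn hab).elim)
      (fun _ => ?_) (fun _ => ?_)
    · rw [mul_one]; exact add_neg_cancel _
    · rw [mul_one]; exact add_neg_cancel _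
  by_cases hbc : s(b, c) ∈ F
  · refine h.hasOpenPSD hM h3.1 hN.generic (hmem hN) (hpos hN) (α := 1)
      (β := -schur N ((X \ {v}) \ {a, b, c}) a b) (γ := -schur N ((X \ {v}) \ {a, b, c}) a c)
      (fun _ => ?_)
      (fun hn => (hn hbc).elim) (fun _ => ?_)
    · rw [one_mul]; exact add_neg_cancel _
    · rw [one_mul]; exact add_neg_cancel _
  by_cases hac : s(a, c) ∈ F
  · refine h.hasOpenPSD hM h3.1 hN.generic (hmem hN) (hpos hN) (β := 1)
      (α := -schur N ((X \ {v}) \ {a, b, c}) a b) (γ := -schur N ((X \ {v}) \ {a, b, c}) b c)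
      (fun _ => ?_)
      (fun _ => ?_) (fun hn => (hn hac).elim)
    · rw [mul_one]; exact add_neg_cancel _
    · rw [one_mul]; exact add_neg_cancel _
  have hX : ∀ j, s(v, j) ∈ F → j ∈ X := fun j hj => (mk_mem_edgesOn.1 (h3.1 hj)).2.2
  have hna := h.exists_two_neighbors h3.1 (h3.three_le_degree (hX a (h.claw_subset (Or.inl rfl))))
    hab hac
  have hnb := h.rotate.exists_two_neighbors h3.1
    (h3.three_le_degree (hX b (h.claw_subset (Or.inr (Or.inl rfl))))) hbc
    (by rwa [Sym2.eq_swap])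
  have hrot : ({b, c, a} : Set V) = {a, b, c} := by ext x; simp; tauto
  have hyrot : yDelta F v b c a = yDelta F v a b c := by rw [yDelta, yDelta, tri_rotate]
  rw [hrot, hyrot] at hnb
  obtain ⟨q', N', hN', s1, s2, s3⟩ := hN.exists_signs hF' hXY (by simp) (by simp)
    (by simp) h.ab h.ac h.bc hna hnb
  obtain ⟨α, β, γ, e1, e2, e3⟩ := exists_cancel_of_pos s1 s3 s2
  exact h.hasOpenPSD hM h3.1 hN'.generic (hmem hN') (hpos hN') (fun _ => e1) (fun _ => e2)
    fun _ => e3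

end OpenPSD

/-! ### Gluing positive semidefinite stresses along an edge -/

lemma exists_linearEquiv_apply_eq {ι K E : Type*} [Fintype ι] [Field K] [AddCommGroup E]
    [Module K E] [FiniteDimensional K E] {u w : ι → E} (hu : LinearIndependent K u)
    (hw : LinearIndependent K w) : ∃ A : E ≃ₗ[K] E, ∀ i, A (u i) = w i := by
  classical
  have hb : ∀ {v : ι → E} (hv : LinearIndependent K v) (i : ι),
      Module.Basis.sumExtend hv (Sum.inl i) = v i := fun hv i => by
    simp only [Module.Basis.sumExtend, Module.Basis.reindex_apply, Module.Basis.extend_apply_self]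
    rfl
  have fu : Finite (ι ⊕ Module.Basis.sumExtendIndex hu) :=
    Module.Finite.finite_basis (Module.Basis.sumExtend hu)
  have fw : Finite (ι ⊕ Module.Basis.sumExtendIndex hw) :=
    Module.Finite.finite_basis (Module.Basis.sumExtend hw)
  have fu' : Finite (Module.Basis.sumExtendIndex hu) :=
    Finite.of_injective _ (Sum.inr_injective (α := ι))
  have fw' : Finite (Module.Basis.sumExtendIndex hw) :=
    Finite.of_injective _ (Sum.inr_injective (α := ι))
  have hcard : Nat.card (Module.Basis.sumExtendIndex hu) =
      Nat.card (Module.Basis.sumExtendIndex hw) := by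
    have h1 := Module.finrank_eq_nat_card_basis (Module.Basis.sumExtend hu)
    have h2 := Module.finrank_eq_nat_card_basis (Module.Basis.sumExtend hw)
    rw [Nat.card_sum] at h1 h2
    omega
  refine ⟨(Module.Basis.sumExtend hu).equiv (Module.Basis.sumExtend hw)
    (Equiv.sumCongr (Equiv.refl ι) (Finite.card_eq.1 hcard).some), fun i => ?_⟩
  rw [← hb hu i, Module.Basis.equiv_apply]
  exact hb hw i

section Glue

open Topology Filter

variable {V : Type*} [Fintype V] [DecidableEq V] {d : ℕ}

local notation "𝓜" => rigidityMatroid V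

/-- Any two vectors of the configuration are linearly independent. -/
def PairPos (p : V → Fin d → ℝ) : Prop :=
  ∀ i j, i ≠ j → ∀ a b : ℝ, a • p i + b • p j = 0 → a = 0 ∧ b = 0

/-- The linear combinations of two of the configuration vectors. -/
noncomputable def pairMap (d : ℕ) (i j : V) :
    (V → Fin d → ℝ) →ₗ[ℝ] (ℝ × ℝ) →ₗ[ℝ] (Fin d → ℝ) :=
  LinearMap.mk₂ ℝ (fun p c => c.1 • p i + c.2 • p j)
    (fun p q c => by simp only [Pi.add_apply, smul_add]; abel)
    (fun c p q => by simp only [Pi.smul_apply, smul_add, smul_comm c])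
    (fun p c c' => by simp only [Prod.fst_add, Prod.snd_add, add_smul]; abel)
    (fun c p c' => by simp only [Prod.smul_fst, Prod.smul_snd, smul_eq_mul, mul_smul, smul_add])

lemma pairMap_injective_iff {i j : V} {p : V → Fin d → ℝ} :
    Function.Injective (pairMap d i j p) ↔
      ∀ a b : ℝ, a • p i + b • p j = 0 → a = 0 ∧ b = 0 := by
  rw [← LinearMap.ker_eq_bot, Submodule.eq_bot_iff]
  constructor
  · intro h a b hab
    have := h (a, b) (by simpa [pairMap] using hab)
    exact ⟨congrArg Prod.fst this, congrArg Prod.snd this⟩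
  · intro h c hc
    obtain ⟨h0, h1⟩ := h _ _ (show c.1 • p i + c.2 • p j = 0 from hc)
    exact Prod.ext h0 h1

lemma exists_pair (hd : 2 ≤ d) {i j : V} (hij : i ≠ j) :
    ∃ p : V → Fin d → ℝ, Function.Injective (pairMap d i j p) := by
  let e₀ : Fin d := ⟨0, by omega⟩
  let e₁ : Fin d := ⟨1, by omega⟩
  have he : e₀ ≠ e₁ := by simp [e₀, e₁]
  refine ⟨fun v => if v = i then Pi.single e₀ 1 else Pi.single e₁ 1, ?_⟩
  rw [pairMap_injective_iff]
  intro a b h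
  have h0 := congrFun h e₀
  have h1 := congrFun h e₁
  simp [hij.symm, he, he.symm] at h0 h1
  exact ⟨h0, h1⟩

lemma ae_pairPos (hd : 2 ≤ d) : ∀ᵐ p : V → Fin d → ℝ, PairPos p := by
  change ∀ᵐ p : V → Fin d → ℝ, ∀ i j, i ≠ j → ∀ a b : ℝ, a • p i + b • p j = 0 → a = 0 ∧ b = 0
  rw [MeasureTheory.ae_all_iff]; intro i
  rw [MeasureTheory.ae_all_iff]; intro j
  by_cases h : i = j
  · exact Filter.Eventually.of_forall fun p h' => (h' h).elim
  · obtain ⟨q, hq⟩ := exists_pair hd h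
    filter_upwards [ae_injective volume (pairMap d i j) hq] with p hp _
    exact pairMap_injective_iff.1 hp

lemma PairPos.eventually {p₀ : V → Fin d → ℝ} (h : PairPos p₀) : ∀ᶠ p in 𝓝 p₀, PairPos p := by
  change ∀ᶠ p in 𝓝 p₀, ∀ i j, i ≠ j → ∀ a b : ℝ, a • p i + b • p j = 0 → a = 0 ∧ b = 0
  simp only [Filter.eventually_all]
  intro i j hij
  filter_upwards [eventually_injective (pairMap d i j)
    (pairMap_injective_iff.2 (h i j hij))] with p hp
  exact pairMap_injective_iff.1 hp

lemma isOpen_pairPos : IsOpen {p : V → Fin d → ℝ | PairPos p} :=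
  isOpen_iff_mem_nhds.2 fun _ hp => PairPos.eventually hp

lemma PairPos.linearIndependent {p : V → Fin d → ℝ} (h : PairPos p) {x y : V} (hxy : x ≠ y) :
    LinearIndependent ℝ ![p x, p y] :=
  LinearIndependent.pair_iff.2 (h x y hxy)

lemma PairPos.ne_zero {p : V → Fin d → ℝ} (h : PairPos p) {x y : V} (hxy : x ≠ y) (i : V) :
    p i ≠ 0 := by
  intro h0
  by_cases hi : i = x
  · have := h i y (hi ▸ hxy) 1 0 (by simp [h0])
    simp at this
  · have := h i x hi 1 0 (by simp [h0])
    simp at this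

/-- A continuous family of positive semidefinite stresses of `F` over an open set, whose entry at
`x, y` has the sign of `s`. -/
def HasSignedPSD (d : ℕ) (F : Set (Sym2 V)) (x y : V) (s : ℝ) : Prop :=
  ∃ (U : Set (V → Fin d → ℝ)) (k : (V → Fin d → ℝ) → Matrix V V ℝ), IsOpen U ∧ U.Nonempty ∧
    ContinuousOn k U ∧ ∀ p ∈ U, PairPos p ∧ k p ∈ stressSpace p F ∧ (k p).PosSemidef ∧
      0 < s * k p x y

/-- The signs `-1` at `x` and `1` elsewhere. -/
def flipSign (x : V) : V → ℝ := fun i => if i = x then -1 else 1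

lemma flipSign_mul_self (x i : V) : flipSign x i * flipSign x i = 1 := by
  unfold flipSign; split_ifs <;> norm_num

lemma flipSign_smul_smul (x i : V) (w : Fin d → ℝ) : flipSign x i • flipSign x i • w = w := by
  rw [smul_smul, flipSign_mul_self, one_smul]

lemma HasSignedPSD.flip {F : Set (Sym2 V)} {x y : V} (hxy : x ≠ y) {s : ℝ}
    (h : HasSignedPSD d F x y s) : HasSignedPSD d F x y (-s) := by
  obtain ⟨U, k, hU, ⟨p₀, hp₀⟩, hk, hP⟩ := h
  let σ : (V → Fin d → ℝ) → V → Fin d → ℝ := fun p i => flipSign x i • p i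
  have hσ : Continuous σ := by fun_prop
  have hσσ : ∀ p, σ (σ p) = p := fun p => by funext i; exact flipSign_smul_smul x i _
  let k' : (V → Fin d → ℝ) → Matrix V V ℝ := fun p =>
    diagonal (flipSign x) * k (σ p) * diagonal (flipSign x)
  have hk' : ∀ p i j, k' p i j = flipSign x i * k (σ p) i j * flipSign x j := fun p i j => by
    simp [k']
  refine ⟨σ ⁻¹' U, k', hU.preimage hσ, ⟨σ p₀, by simpa [hσσ] using hp₀⟩, ?_, fun p hp => ?_⟩
  · have : ContinuousOn (fun p => k (σ p)) (σ ⁻¹' U) := hk.comp hσ.continuousOn fun p hp => hp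
    exact (continuousOn_const.mul this).mul continuousOn_const
  · obtain ⟨h1, h2, h3, h4⟩ := hP _ hp
    refine ⟨fun i j hij a b hab => ?_, ⟨⟨fun i j => ?_, fun i j hij hn => ?_⟩, fun i => ?_⟩, ?_, ?_⟩
    · have := h1 i j hij (a * flipSign x i) (b * flipSign x j) (by
        rw [mul_smul, mul_smul]
        simp only [σ, flipSign_smul_smul]
        exact hab)
      have hne : ∀ i, flipSign x i ≠ 0 := fun i h0 => by
        have := flipSign_mul_self x i
        simp [h0] at this
      simpa [hne] using this
    · rw [hk', hk', h2.1.1 i j]; ring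
    · rw [hk', h2.1.2 i j hij hn]; ring
    · have := congrArg (flipSign x i • ·) (h2.2 i)
      simp only [smul_zero, Finset.smul_sum] at this
      rw [← this]
      refine Finset.sum_congr rfl fun j _ => ?_
      rw [hk']
      simp only [σ, smul_smul]
      congr 1
      ring
    · have := h3.conjTranspose_mul_mul_same (diagonal (flipSign x))
      simpa [k', diagonal_conjTranspose] using this
    · rw [hk']
      have e1 : flipSign x x = -1 := by simp [flipSign]
      have e2 : flipSign x y = 1 := by simp [flipSign, hxy.symm]
      rw [e1, e2]
      linarith

lemma HasOpenPSD.hasSignedPSD (hd : 2 ≤ d) {F : Set (Sym2 V)} (h : HasOpenPSD d F) {x y : V}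
    (hxy : x ≠ y) : HasOpenPSD d (F \ {s(x, y)}) ∨ ∀ s, s ≠ 0 → HasSignedPSD d F x y s := by
  obtain ⟨U, k, hU, hne, hk, hP⟩ := h
  by_cases h0 : ∀ p ∈ U, k p x y = 0
  · refine Or.inl ⟨U, k, hU, hne, hk, fun p hp => ⟨?_, (hP p hp).2⟩⟩
    refine mem_stressSpace_of_eq_zero (hP p hp).1 fun i j _ hF hn => ?_
    have : s(i, j) = s(x, y) := by
      by_contra h1
      exact hn ⟨hF, h1⟩
    rcases Sym2.eq_iff.1 this with ⟨rfl, rfl⟩ | ⟨rfl, rfl⟩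
    · exact h0 p hp
    · rw [(hP p hp).1.1.1 j i]; exact h0 p hp
  · right
    push Not at h0
    obtain ⟨p₀, hp₀, hne₀⟩ := h0
    have key : HasSignedPSD d F x y (k p₀ x y) := by
      have hc : ContinuousOn (fun p => k p₀ x y * k p x y) U :=
        continuousOn_const.mul ((continuous_id.matrix_elem x y).comp_continuousOn hk)
      have hopen : IsOpen (U ∩ (fun p => k p₀ x y * k p x y) ⁻¹' Set.Ioi 0) :=
        hc.isOpen_inter_preimage hU isOpen_Ioi
      obtain ⟨r, hrW, hr⟩ := (Measure.dense_of_ae (ae_pairPos (V := V) hd)).inter_open_nonempty _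
        hopen ⟨p₀, hp₀, mul_self_pos.2 hne₀⟩
      exact ⟨_, k, hopen.inter isOpen_pairPos, ⟨r, hrW, hr⟩, hk.mono fun p hp => hp.1.1,
        fun p hp => ⟨hp.2, (hP p hp.1.1).1, (hP p hp.1.1).2.1, hp.1.2⟩⟩
    intro s hs
    have hscale : ∀ {t : ℝ}, HasSignedPSD d F x y t → 0 < t * s → HasSignedPSD d F x y s := by
      rintro t ⟨U, k, hU, hne, hk, hP⟩ hts
      refine ⟨U, k, hU, hne, hk, fun p hp => ⟨(hP p hp).1, (hP p hp).2.1, (hP p hp).2.2.1, ?_⟩⟩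
      have h1 := (hP p hp).2.2.2
      have h2 : 0 < t * t * (s * k p x y) := by nlinarith [mul_pos hts h1]
      exact pos_of_mul_pos_right h2 (mul_self_nonneg t)
    rcases lt_or_gt_of_ne (mul_ne_zero hne₀ hs) with h1 | h1
    · exact hscale (key.flip hxy) (by linarith)
    · exact hscale key h1

lemma mem_stressSpace_of_agree {F : Set (Sym2 V)} {X : Set V} (hF : F ⊆ edgesOn X)
    {p q : V → Fin d → ℝ} (A : (Fin d → ℝ) ≃ₗ[ℝ] (Fin d → ℝ)) (hq : ∀ i, q i ≠ 0)
    (hpq : ∀ i ∈ X, q i = A (p i)) {K : Matrix V V ℝ} (hK : K ∈ stressSpace q F) :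
    K ∈ stressSpace p F := by
  refine ⟨hK.1, fun i => A.injective ?_⟩
  rw [map_sum, map_zero, ← hK.2 i]
  refine Finset.sum_congr rfl fun j _ => ?_
  rw [map_smul]
  by_cases hj : j ∈ X
  · rw [hpq j hj]
  · rw [hK.1.1 j i, stress_row_eq_zero hF hK hj (hq j) i, zero_smul, zero_smul]

/-- Positive semidefinite stresses can be glued along an edge. -/
theorem HasOpenPSD.glue (hd : 2 ≤ d) {F₁ F₂ : Set (Sym2 V)} {Z W : Set V} {x y : V} (hxy : x ≠ y)
    (hZ : Disjoint Z {x, y}) (hZW : Disjoint Z W)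
    (h₁ : F₁ ⊆ edgesOn (Z ∪ {x, y})) (h₂ : F₂ ⊆ edgesOn (W ∪ {x, y}))
    (H₁ : HasOpenPSD d F₁) (H₂ : HasOpenPSD d F₂) : HasOpenPSD d ((F₁ ∪ F₂) \ {s(x, y)}) := by
  classical
  rcases H₁.hasSignedPSD hd hxy with h | S₁
  · exact h.mono (Set.sdiff_subset_sdiff_left Set.subset_union_left)
  rcases H₂.hasSignedPSD hd hxy with h | S₂
  · exact h.mono (Set.sdiff_subset_sdiff_left Set.subset_union_right)
  obtain ⟨U₁, k₁, hU₁, ⟨p₁, hp₁⟩, hk₁, P₁⟩ := S₁ 1 one_ne_zero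
  obtain ⟨U₂, k₂, hU₂, ⟨p₂, hp₂⟩, hk₂, P₂⟩ := S₂ (-1) (by norm_num)
  obtain ⟨A, hA⟩ := exists_linearEquiv_apply_eq ((P₁ p₁ hp₁).1.linearIndependent hxy)
    ((P₂ p₂ hp₂).1.linearIndependent hxy)
  have hAx : A (p₁ x) = p₂ x := hA 0
  have hAy : A (p₁ y) = p₂ y := hA 1
  let π₁ : (V → Fin d → ℝ) → V → Fin d → ℝ := fun p i => if i ∈ Z ∪ {x, y} then p i else p₁ i
  let π₂ : (V → Fin d → ℝ) → V → Fin d → ℝ := fun p i => if i ∈ W ∪ {x, y} then A (p i) else p₂ i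
  have hπ₁ : Continuous π₁ := by
    refine continuous_pi fun i => ?_
    by_cases hi : i ∈ Z ∪ {x, y}
    · simp only [π₁, if_pos hi]; exact continuous_apply i
    · simp only [π₁, if_neg hi]; exact continuous_const
  have hAc : Continuous A := A.toLinearMap.continuous_of_finiteDimensional
  have hπ₂ : Continuous π₂ := by
    refine continuous_pi fun i => ?_
    by_cases hi : i ∈ W ∪ {x, y}
    · simp only [π₂, if_pos hi]; exact hAc.comp (continuous_apply i)
    · simp only [π₂, if_neg hi]; exact continuous_const
  let r : V → Fin d → ℝ := fun i => if i ∈ Z ∪ {x, y} then p₁ i else A.symm (p₂ i)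
  have hr₁ : π₁ r = p₁ := by
    funext i
    by_cases hi : i ∈ Z ∪ {x, y}
    · simp only [π₁, r, if_pos hi]
    · simp only [π₁, if_neg hi]
  have hr₂ : π₂ r = p₂ := by
    funext i
    by_cases hi : i ∈ W ∪ {x, y}
    · simp only [π₂, if_pos hi]
      by_cases hi' : i ∈ Z ∪ {x, y}
      · simp only [r, if_pos hi']
        have : i ∈ ({x, y} : Set V) := by
          rcases hi with hW | hW
          · rcases hi' with hZ' | hZ'
            · exact (Set.disjoint_left.1 hZW hZ' hW).elim
            · exact hZ'
          · exact hW
        rcases this with rfl | rfl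
        · exact hAx
        · exact hAy
      · simp only [r, if_neg hi', LinearEquiv.apply_symm_apply]
    · simp only [π₂, if_neg hi]
  have c₁ : ContinuousOn (fun p => k₁ (π₁ p)) (π₁ ⁻¹' U₁ ∩ π₂ ⁻¹' U₂) :=
    hk₁.comp hπ₁.continuousOn fun p hp => hp.1
  have c₂ : ContinuousOn (fun p => k₂ (π₂ p)) (π₁ ⁻¹' U₁ ∩ π₂ ⁻¹' U₂) :=
    hk₂.comp hπ₂.continuousOn fun p hp => hp.2
  refine ⟨π₁ ⁻¹' U₁ ∩ π₂ ⁻¹' U₂, fun p => (-k₂ (π₂ p) x y) • k₁ (π₁ p) +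
    (k₁ (π₁ p) x y) • k₂ (π₂ p), (hU₁.preimage hπ₁).inter (hU₂.preimage hπ₂),
    ⟨r, by simpa [hr₁] using hp₁, by simpa [hr₂] using hp₂⟩, ?_, fun p hp => ?_⟩
  · have he : Continuous fun L : Matrix V V ℝ => L x y := continuous_id.matrix_elem x y
    exact ((he.comp_continuousOn c₂).neg.smul c₁).add ((he.comp_continuousOn c₁).smul c₂)
  · obtain ⟨g₁, m₁, s₁, n₁⟩ := P₁ _ hp.1
    obtain ⟨g₂, m₂, s₂, n₂⟩ := P₂ _ hp.2
    have m₁' : k₁ (π₁ p) ∈ stressSpace p F₁ := mem_stressSpace_of_agree h₁ (LinearEquiv.refl ℝ _)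
      (g₁.ne_zero hxy) (fun i hi => by simp only [π₁, if_pos hi, LinearEquiv.refl_apply]) m₁
    have m₂' : k₂ (π₂ p) ∈ stressSpace p F₂ := mem_stressSpace_of_agree h₂ A
      (g₂.ne_zero hxy) (fun i hi => by simp only [π₂, if_pos hi]) m₂
    rw [one_mul] at n₁
    have n₂' : 0 < -k₂ (π₂ p) x y := by linarith
    have q₁ := s₁.smul n₂'.le
    have q₂ := s₂.smul n₁.le
    refine ⟨mem_stressSpace_of_eq_zero (F := F₁ ∪ F₂) (Submodule.add_mem _ (Submodule.smul_mem _ _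
      (stressSpace_mono p Set.subset_union_left m₁')) (Submodule.smul_mem _ _
      (stressSpace_mono p Set.subset_union_right m₂'))) fun i j _ hF hn => ?_, q₁.add q₂, ?_⟩
    · have : s(i, j) = s(x, y) := by
        by_contra h1
        exact hn ⟨hF, h1⟩
      rcases Sym2.eq_iff.1 this with ⟨rfl, rfl⟩ | ⟨rfl, rfl⟩
      · simp; ring
      · simp [m₁.1.1 j i, m₂.1.1 j i]; ring
    · intro h0
      have hx := congrFun (congrFun h0 x) x
      have hy := congrFun (congrFun h0 y) y
      have x1 := q₁.diag_nonneg (i := x)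
      have x2 := q₂.diag_nonneg (i := x)
      have y1 := q₁.diag_nonneg (i := y)
      have y2 := q₂.diag_nonneg (i := y)
      simp only [Matrix.add_apply, Matrix.zero_apply] at hx hy
      have hv := q₁.dotProduct_mulVec_nonneg (Pi.single x 1 - Pi.single y 1)
      have hsym := m₁.1.1 x y
      simp [mulVec_sub, sub_dotProduct] at hv
      simp only [Matrix.smul_apply, smul_eq_mul] at hx hy x1 x2 y1 y2
      nlinarith [mul_pos n₁ n₂']

theorem hasOpenPSD_of_isCircuit {C : Set (Sym2 V)} (hC : (𝓜).IsCircuit C) : HasOpenPSD 3 C := by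
  induction hn : (verts C).ncard using Nat.strong_induction_on generalizing C with
  | _ n ih =>
  obtain ⟨v, hv⟩ := exists_degree_three hC
  by_cases h3 : Conn3 C (verts C)
  · exact hasOpenPSD_of_conn3 hC.mConn h3 hv
  have hd : ∀ e ∈ C, ¬ e.IsDiag := hC.subset_ground
  have hCV := subset_edgesOn_verts hd
  have h4 : 4 ≤ (verts C).ncard := by
    obtain ⟨a, b, c, h⟩ := exists_isClawAt hd hv
    have hsub : {v, a, b, c} ⊆ verts C := by
      have hm : ∀ e ∈ claw v a b c, e ∈ edgesOn (verts C) := fun e he => hCV (h.claw_subset he)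
      have ha := mk_mem_edgesOn.1 (hm _ (Or.inl rfl))
      have hb := mk_mem_edgesOn.1 (hm _ (Or.inr (Or.inl rfl)))
      have hc := mk_mem_edgesOn.1 (hm _ (Or.inr (Or.inr rfl)))
      rintro u (rfl | rfl | rfl | rfl)
      exacts [ha.2.1, ha.2.2, hb.2.2, hc.2.2]
    have hcard : ({v, a, b, c} : Set V).ncard = 4 := by
      rw [Set.ncard_insert_of_notMem (by simp [h.va, h.vb, h.vc]),
        Set.ncard_eq_three.2 ⟨a, b, c, h.ab, h.ac, h.bc, rfl⟩]
    rw [← hcard]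
    exact Set.ncard_le_ncard hsub
  obtain ⟨Z, S, W, hsep, hX, hS, hZ, hW⟩ : ∃ Z S W, Separates C Z S W ∧ Z ∪ S ∪ W = verts C ∧
      S.ncard ≤ 2 ∧ Z.Nonempty ∧ W.Nonempty := by
    by_contra hcon
    refine h3 ⟨hCV, h4, fun Z S W a b c d e => hcon ⟨Z, S, W, a, b, c, d, e⟩⟩
  obtain ⟨z, hz⟩ := hZ
  obtain ⟨w, hw⟩ := hW
  have hzC : z ∈ verts C := hX ▸ Or.inl (Or.inl hz)
  have hwC : w ∈ verts C := hX ▸ Or.inr hw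
  have iZ := mem_incident_of_mem_verts hz hzC
  have iW := mem_incident_of_mem_verts hw hwC
  have hS2 := hC.mConn.two_le_of_separates hsep iZ iW
  obtain ⟨x, y, hxy, rfl⟩ := Set.ncard_eq_two.1 (le_antisymm hS hS2)
  have key : ∀ {Z W : Set V}, Separates C Z {x, y} W → (incident C Z).Nonempty →
      (incident C W).Nonempty → Z ∪ {x, y} ∪ W = verts C → W.Nonempty →
      insert s(x, y) (incident C Z) ⊆ edgesOn (Z ∪ {x, y}) ∧
        HasOpenPSD 3 (insert s(x, y) (incident C Z)) := by
    rintro Z W hsep iZ iW hX ⟨w, hw⟩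
    have hsub : insert s(x, y) (incident C Z) ⊆ edgesOn (Z ∪ {x, y}) :=
      Set.insert_subset (mk_mem_edgesOn.2 ⟨hxy, by simp, by simp⟩) hsep.incident_subset
    refine ⟨hsub, ih _ ?_ (isCircuit_side hC hxy hsep iZ iW).2 rfl⟩
    rw [← hn]
    refine (Set.ncard_le_ncard (verts_subset hsub)).trans_lt (Set.ncard_lt_ncard ?_)
    rw [← hX]
    refine ⟨Set.subset_union_left, fun h => ?_⟩
    rcases h (Or.inr hw) with h1 | h1
    · exact Set.disjoint_left.1 hsep.disj h1 hw
    · exact Set.disjoint_left.1 hsep.disj_WS hw h1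
  obtain ⟨s1, H1⟩ := key hsep iZ iW hX ⟨w, hw⟩
  obtain ⟨s2, H2⟩ := key hsep.symm iW iZ (by rw [← hX]; ext; simp; tauto) ⟨z, hz⟩
  refine (H1.glue (by norm_num) hxy hsep.disj_ZS hsep.disj s1 s2 H2).mono ?_
  rintro e ⟨(h | h) | (h | h), hne⟩
  exacts [(hne h).elim, h.1, (hne h).elim, h.1]

theorem hasOpenPSD_of_not_genIndep {F : Set (Sym2 V)} (hF : ∀ e ∈ F, ¬ e.IsDiag)
    (h : ¬ GenIndep 3 F) : HasOpenPSD 3 F := by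
  have hdep : (𝓜).Dep F := by
    rw [Matroid.dep_iff]
    exact ⟨fun hI => h hI.2, subset_ground_iff.2 hF⟩
  obtain ⟨C, hCF, hC⟩ := hdep.exists_isCircuit_subset
  exact (hasOpenPSD_of_isCircuit hC).mono hCF

end Glue

/-! ### Dimensions one and two -/

section LowDim

open Topology Filter

variable {V : Type*} [Fintype V] [DecidableEq V] {d : ℕ}

lemma HasOpenPSD.of_rank_one {F : Set (Sym2 V)} {U : Set (V → Fin d → ℝ)} (hU : IsOpen U)
    (hne : U.Nonempty) {l : (V → Fin d → ℝ) → V → ℝ} (hl : Continuous l)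
    (h0 : ∀ p, ∑ j, l p j • p j = 0)
    (hF : ∀ p i j, i ≠ j → s(i, j) ∉ F → l p i * l p j = 0) (hlU : ∀ p ∈ U, l p ≠ 0) :
    HasOpenPSD d F := by
  refine ⟨U, fun p => vecMulVec (l p) (l p), hU, hne, ?_, fun p hp => ⟨⟨⟨fun i j => ?_,
    fun i j hij hn => ?_⟩, fun i => ?_⟩, ?_, fun h => ?_⟩⟩
  · exact (continuous_matrix fun i j =>
      ((continuous_apply i).comp hl).mul ((continuous_apply j).comp hl)).continuousOn
  · simp [vecMulVec_apply, mul_comm]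
  · exact hF p i j hij hn
  · simp only [vecMulVec_apply, mul_smul, ← Finset.smul_sum, h0, smul_zero]
  · simpa using posSemidef_vecMulVec_self_star (l p)
  · obtain ⟨i, hi⟩ := Function.ne_iff.1 (hlU p hp)
    have : l p i * l p i = 0 := congrFun (congrFun h i) i
    exact hi (mul_self_eq_zero.1 this)

lemma hasOpenPSD_one {x y : V} (hxy : x ≠ y) : HasOpenPSD 1 ({s(x, y)} : Set (Sym2 V)) := by
  refine HasOpenPSD.of_rank_one (U := {p | p x 0 ≠ 0})
    (l := fun p i => if i = x then p y 0 else if i = y then - p x 0 else 0) ?_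
    ⟨fun _ _ => 1, by simp⟩ ?_ (fun p => ?_) (fun p i j hij hn => ?_) (fun p hp h => ?_)
  · exact isOpen_ne_fun (by fun_prop) continuous_const
  · refine continuous_pi fun i => ?_
    split_ifs <;> fun_prop
  · rw [Finset.sum_eq_add (a := x) (b := y) hxy]
    · funext k
      rw [Subsingleton.elim k 0]
      simp [hxy.symm]; ring
    · rintro j - ⟨h1, h2⟩; simp [h1, h2]
    · simp
    · simp
  · by_contra hne
    apply hn
    have h1 : i = x ∨ i = y := by
      by_contra h; push Not at h; exact hne (by simp [h.1, h.2])
    have h2 : j = x ∨ j = y := by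
      by_contra h; push Not at h; exact hne (by simp [h.1, h.2])
    rcases h1 with rfl | rfl <;> rcases h2 with rfl | rfl <;> simp_all [Sym2.eq_swap]
  · have := congrFun h y
    simp [hxy.symm] at this
    exact hp this

/-- The oriented area of two vectors in the plane. -/
def area (u w : Fin 2 → ℝ) : ℝ := u 0 * w 1 - u 1 * w 0

lemma hasOpenPSD_two_tri {a b c : V} (hab : a ≠ b) (hac : a ≠ c) (hbc : b ≠ c) :
    HasOpenPSD 2 (tri a b c) := by
  refine HasOpenPSD.of_rank_one (U := {p | area (p a) (p b) ≠ 0})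
    (l := fun p i => if i = a then area (p b) (p c) else if i = b then area (p c) (p a) else
      if i = c then area (p a) (p b) else 0) ?_
    ⟨fun i => if i = a then ![1, 0] else ![0, 1], by simp [area, hab.symm]⟩ ?_ (fun p => ?_)
    (fun p i j hij hn => ?_) (fun p hp h => ?_)
  · exact isOpen_ne_fun (by unfold area; fun_prop) continuous_const
  · unfold area
    refine continuous_pi fun i => ?_
    split_ifs <;> fun_prop
  · rw [sum_eq_three hab hac hbc]
    · funext k
      fin_cases k <;> simp [hab.symm, hac.symm, hbc.symm, area] <;> ring
    · intro j h1 h2 h3; simp [h1, h2, h3]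
  · by_contra hne
    apply hn
    have key : ∀ i, (if i = a then area (p b) (p c) else if i = b then area (p c) (p a) else
      if i = c then area (p a) (p b) else 0) ≠ 0 → i = a ∨ i = b ∨ i = c := by
      intro i hi
      by_contra h; push Not at h; exact hi (by simp [h.1, h.2.1, h.2.2])
    have h1 := key i (left_ne_zero_of_mul hne)
    have h2 := key j (right_ne_zero_of_mul hne)
    simp only [tri, Set.mem_insert_iff, Set.mem_singleton_iff, Sym2.eq_iff]
    rcases h1 with h1 | h1 | h1 <;> rcases h2 with h2 | h2 | h2 <;>
      simp [h1, h2] <;> exact (hij (h1.trans h2.symm)).elim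
  · have := congrFun h c
    simp [hac.symm, hbc.symm] at this
    exact hp this

/-- A path together with the edge joining its ends carries a positive semidefinite stress in
dimension two. -/
lemma SimpleGraph.Walk.IsPath.hasOpenPSD {G : SimpleGraph V} {a b : V} {w : G.Walk a b}
    (hw : w.IsPath) (hab : a ≠ b) (hn : s(a, b) ∉ w.edges) :
    HasOpenPSD 2 (insert s(a, b) {e | e ∈ w.edges}) := by
  induction w with
  | nil => exact (hab rfl).elim
  | @cons a c b h w ih =>
    rw [SimpleGraph.Walk.cons_isPath_iff] at hw
    rw [SimpleGraph.Walk.edges_cons, List.mem_cons, not_or] at hn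
    have hcb : c ≠ b := fun h => hn.1 (by rw [h])
    have hac : a ≠ c := h.ne
    have htri := hasOpenPSD_two_tri hac hab hcb
    by_cases hcbw : s(c, b) ∈ w.edges
    · refine htri.mono ?_
      rintro e (rfl | rfl | rfl) <;> simp [hcbw]
    · have key := ih hw.1 hcb hcbw
      have hW : ∀ x y, s(x, y) ∈ w.edges → x ∈ w.support := fun x y h =>
        w.fst_mem_support_of_mem_edges h
      refine (htri.glue le_rfl hcb (Z := {a}) (W := {x | x ∈ w.support} \ {c, b}) ?_ ?_ ?_ ?_
        key).mono ?_
      · simp [hac, hab]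
      · simp [hw.2]
      · rintro e (rfl | rfl | rfl) <;> rw [mk_mem_edgesOn] <;> simp [hac, hcb, hab]
      · refine Set.insert_subset (mk_mem_edgesOn.2 ⟨hcb, by simp, by simp⟩) fun e he => ?_
        induction e using Sym2.ind with
        | _ x y =>
        have h1 := hW x y he
        have h2 := hW y x (by rwa [Sym2.eq_swap])
        refine mk_mem_edgesOn.2 ⟨(w.edges_subset_edgeSet he : G.Adj x y).ne, ?_, ?_⟩
        · by_cases hx : x ∈ ({c, b} : Set V)
          · exact Or.inr hx
          · exact Or.inl ⟨h1, hx⟩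
        · by_cases hx : y ∈ ({c, b} : Set V)
          · exact Or.inr hx
          · exact Or.inl ⟨h2, hx⟩
      · rintro e ⟨(rfl | rfl | rfl) | (rfl | he), hne⟩
        · simp
        · exact (hne rfl).elim
        · simp
        · exact (hne rfl).elim
        · exact Or.inr (by simpa using Or.inr he)

lemma hasOpenPSD_two_of_not_isAcyclic {G : SimpleGraph V} (h : ¬ G.IsAcyclic) :
    HasOpenPSD 2 G.edgeSet := by
  rw [SimpleGraph.isAcyclic_iff_forall_adj_isBridge] at h
  push Not at h
  obtain ⟨a, b, hab, hb⟩ := h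
  rw [SimpleGraph.isBridge_iff_forall_walk_mem_edges] at hb
  push Not at hb
  obtain ⟨w, hw⟩ := hb
  refine (w.bypass_isPath.hasOpenPSD hab.ne fun h => hw (w.edges_bypass_subset_edges h)).mono ?_
  exact Set.insert_subset hab fun e he => w.bypass.edges_subset_edgeSet he

lemma genIndep_two_of_isAcyclic {G : SimpleGraph V} (h : G.IsAcyclic) :
    GenIndep 2 G.edgeSet := by
  classical
  obtain ⟨f, hf⟩ : ∃ f : V → ℝ, Function.Injective f :=
    ⟨fun v => (Fintype.equivFin V v : ℕ), fun a b hab => by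
      simpa [Fin.val_inj] using hab⟩
  refine ⟨fun i => ![1, f i], (Submodule.eq_bot_iff _).2 fun K hK => ?_⟩
  rw [SimpleGraph.isAcyclic_iff_forall_adj_isBridge] at h
  have h0 : ∀ i, ∑ j, K i j = 0 := fun i => by
    simpa using congrFun (hK.2 i) 0
  have h1 : ∀ i, ∑ j, K i j * f j = 0 := fun i => by
    simpa using congrFun (hK.2 i) 1
  have hoff : ∀ a b, a ≠ b → K a b = 0 := by
    intro a b hab
    by_cases hG : G.Adj a b
    swap
    · exact hK.1.2 a b hab hG
    have hbr := SimpleGraph.isBridge_iff.1 (h hG)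
    let S : Finset V := {i | (G.deleteEdges {s(a, b)}).Reachable a i}
    have haS : a ∈ S := by simp [S]
    have hbS : b ∉ S := by simpa [S] using hbr
    have hrow : ∀ i, ∑ j, K i j * (f j - f i) = 0 := fun i => by
      simp only [mul_sub, Finset.sum_sub_distrib, h1 i, ← Finset.sum_mul, h0 i]; simp
    have hzero : ∀ i ∈ S, ∀ j ∉ S, (i, j) ≠ (a, b) → K i j = 0 := by
      intro i hi j hj hne
      have hij : i ≠ j := fun h => hj (h ▸ hi)
      refine hK.1.2 i j hij fun hadj => hj ?_
      simp only [S, Finset.mem_filter, Finset.mem_univ, true_and] at hi ⊢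
      refine hi.trans (SimpleGraph.Adj.reachable ?_)
      rw [SimpleGraph.deleteEdges_adj]
      refine ⟨hadj, fun he => ?_⟩
      rcases Sym2.eq_iff.1 he with ⟨rfl, rfl⟩ | ⟨rfl, rfl⟩
      · exact hne rfl
      · exact hbr (by simpa using hi)
    have hsum : ∑ i ∈ S, ∑ j, K i j * (f j - f i) = 0 :=
      Finset.sum_eq_zero fun i _ => hrow i
    have hin : ∑ i ∈ S, ∑ j ∈ S, K i j * (f j - f i) = 0 := by
      have : ∑ i ∈ S, ∑ j ∈ S, K i j * (f j - f i) = - ∑ i ∈ S, ∑ j ∈ S, K i j * (f j - f i) := by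
        conv_lhs => rw [Finset.sum_comm]
        rw [← Finset.sum_neg_distrib]
        refine Finset.sum_congr rfl fun i _ => ?_
        rw [← Finset.sum_neg_distrib]
        refine Finset.sum_congr rfl fun j _ => ?_
        rw [hK.1.1 i j]; ring
      linarith
    have hsplit : ∑ i ∈ S, ∑ j, K i j * (f j - f i) = ∑ i ∈ S, ∑ j ∈ S, K i j * (f j - f i)
        + ∑ i ∈ S, ∑ j ∈ Sᶜ, K i j * (f j - f i) := by
      rw [← Finset.sum_add_distrib]
      exact Finset.sum_congr rfl fun i _ => (Finset.sum_add_sum_compl S _).symm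
    have hout : ∑ i ∈ S, ∑ j ∈ Sᶜ, K i j * (f j - f i) = K a b * (f b - f a) := by
      rw [Finset.sum_eq_single_of_mem a haS, Finset.sum_eq_single_of_mem b (by simpa using hbS)]
      · intro j hj hjb
        rw [hzero a haS j (by simpa using hj) (by simp [hjb]), zero_mul]
      · intro i hi hia
        refine Finset.sum_eq_zero fun j hj => ?_
        rw [hzero i hi j (by simpa using hj) (by simp [hia]), zero_mul]
    have : K a b * (f b - f a) = 0 := by linarith
    exact (mul_eq_zero.1 this).resolve_right (sub_ne_zero.2 fun h => hab (hf h).symm)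
  ext i j
  by_cases hij : i = j
  · subst hij
    have := h0 i
    rw [Finset.sum_eq_single i (fun j _ hj => hoff i j hj.symm) (by simp)] at this
    exact this
  · exact hoff i j hij

end LowDim

/-! ### Existence of the maximum likelihood estimator -/

section Likelihood

open Topology Filter

variable {V : Type*} [Fintype V] [DecidableEq V]

lemma Matrix.PosSemidef.one_lt_det_one_add {M : Matrix V V ℝ} (hM : M.PosSemidef) (h0 : M ≠ 0) :
    1 < (1 + M).det := by
  have hN : (1 + M).PosSemidef := PosSemidef.one.add hM
  have hge : ∀ i, 1 ≤ hN.1.eigenvalues i := by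
    intro i
    rw [hN.1.eigenvalues_eq i]
    have h1 := hM.dotProduct_mulVec_nonneg (hN.1.eigenvectorBasis i)
    have h2 : star (⇑(hN.1.eigenvectorBasis i)) ⬝ᵥ ⇑(hN.1.eigenvectorBasis i) = (1 : ℝ) := by
      have := hN.1.eigenvectorBasis.orthonormal.1 i
      rw [EuclideanSpace.norm_eq, Real.sqrt_eq_one] at this
      simp only [dotProduct, Pi.star_apply, star_trivial]
      rw [← this]
      exact Finset.sum_congr rfl fun j _ => by rw [Real.norm_eq_abs, sq_abs, sq]
    rw [add_mulVec, one_mulVec, dotProduct_add, h2]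
    simpa using h1
  have hex : ∃ i, 1 < hN.1.eigenvalues i := by
    by_contra! hcon
    have heq : ∀ i, hN.1.eigenvalues i = 1 := fun i => le_antisymm (hcon i) (hge i)
    have ht := hN.1.trace_eq_sum_eigenvalues
    simp only [heq, trace_add, trace_one] at ht
    apply h0
    rw [← hM.trace_eq_zero_iff]
    simpa using ht
  rw [hN.1.det_eq_prod_eigenvalues]
  obtain ⟨i, hi⟩ := hex
  have := Finset.prod_lt_prod (s := Finset.univ) (f := fun _ : V => (1 : ℝ))
    (g := hN.1.eigenvalues) (fun _ _ => one_pos) (fun i _ => hge i) ⟨i, Finset.mem_univ i, hi⟩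
  simpa using this

lemma Matrix.PosDef.det_lt_det_add {A B : Matrix V V ℝ} (hA : A.PosDef) (hB : B.PosSemidef)
    (h0 : B ≠ 0) : A.det < (A + B).det := by
  obtain ⟨C, hC⟩ : ∃ C : Matrix V V ℝ, A = Cᴴ * C := by
    open scoped MatrixOrder in
    exact CStarAlgebra.nonneg_iff_eq_star_mul_self.1 hA.posSemidef.nonneg
  have hdet : C.det ≠ 0 := by
    intro h
    have := hA.det_pos
    rw [hC, det_mul, h, mul_zero] at this
    exact lt_irrefl _ this
  have hu : IsUnit C.det := isUnit_iff_ne_zero.2 hdet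
  let M := (C⁻¹)ᴴ * B * C⁻¹
  have hM : M.PosSemidef := hB.conjTranspose_mul_mul_same _
  have hinv : C⁻¹ * C = 1 := nonsing_inv_mul _ hu
  have hinv' : Cᴴ * (C⁻¹)ᴴ = 1 := by rw [← conjTranspose_mul, hinv, conjTranspose_one]
  have hB' : B = Cᴴ * M * C := by
    simp only [M]
    calc B = (Cᴴ * (C⁻¹)ᴴ) * B * (C⁻¹ * C) := by rw [hinv, hinv', Matrix.one_mul, Matrix.mul_one]
      _ = _ := by simp only [Matrix.mul_assoc]
  have hM0 : M ≠ 0 := fun h => h0 (by rw [hB', h]; simp)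
  have hsum : A + B = Cᴴ * (1 + M) * C := by
    rw [Matrix.mul_add, Matrix.add_mul, Matrix.mul_one, ← hB', ← hC]
  have h1 := hM.one_lt_det_one_add hM0
  have h2 := hA.det_pos
  have h3 : (A + B).det = A.det * (1 + M).det := by
    rw [hsum, hC]; simp only [det_mul]; ring
  rw [h3]
  nlinarith

lemma Matrix.PosDef.log_det_le {K : Matrix V V ℝ} (hK : K.PosDef) {a : ℝ} (ha : 0 < a) :
    Real.log K.det ≤ a * K.trace - Fintype.card V * (1 + Real.log a) := by
  rw [hK.1.det_eq_prod_eigenvalues, hK.1.trace_eq_sum_eigenvalues]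
  simp only [RCLike.ofReal_real_eq_id, id]
  rw [Real.log_prod fun i _ => (hK.eigenvalues_pos i).ne', Finset.mul_sum]
  have : (Fintype.card V : ℝ) * (1 + Real.log a) = ∑ _i : V, (1 + Real.log a) := by
    rw [Finset.sum_const, nsmul_eq_mul, Finset.card_univ]
  rw [this, ← Finset.sum_sub_distrib]
  refine Finset.sum_le_sum fun i _ => ?_
  have hp := hK.eigenvalues_pos i
  have h1 := Real.log_le_sub_one_of_pos (mul_pos ha hp)
  rw [Real.log_mul ha.ne' hp.ne'] at h1
  linarith

lemma Matrix.PosSemidef.abs_apply_le_trace {K : Matrix V V ℝ} (hK : K.PosSemidef) (i j : V) :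
    |K i j| ≤ K.trace := by
  have hd : ∀ i, 0 ≤ K i i := fun i => hK.diag_nonneg
  have hs : K j i = K i j := by simpa using hK.1.apply i j
  by_cases hij : i = j
  · subst hij
    rw [abs_of_nonneg (hd i)]
    exact Finset.single_le_sum (f := fun i => K i i) (fun i _ => hd i) (Finset.mem_univ i)
  have ht : K i i + K j j ≤ K.trace := by
    rw [← Finset.sum_pair (f := fun i => K i i) hij]
    exact Finset.sum_le_sum_of_subset_of_nonneg (Finset.subset_univ _) fun i _ _ => hd i
  have h1 := hK.dotProduct_mulVec_nonneg (Pi.single i 1 - Pi.single j 1)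
  have h2 := hK.dotProduct_mulVec_nonneg (Pi.single i 1 + Pi.single j 1)
  simp [mulVec_sub, sub_dotProduct, mulVec_add, add_dotProduct, hs] at h1 h2
  have := hd i
  have := hd j
  rw [abs_le]
  constructor <;> linarith

lemma isClosed_posSemidef : IsClosed {K : Matrix V V ℝ | K.PosSemidef} := by
  have : {K : Matrix V V ℝ | K.PosSemidef} = {K | Kᴴ = K} ∩
      ⋂ x : V → ℝ, {K | 0 ≤ star x ⬝ᵥ (K *ᵥ x)} := by
    ext K
    simp only [posSemidef_iff_dotProduct_mulVec, Set.mem_inter_iff, Set.mem_iInter,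
      Set.mem_ofPred_eq]
    rfl
  rw [this]
  refine (isClosed_eq (by fun_prop) continuous_id).inter (isClosed_iInter fun x => ?_)
  exact isClosed_le continuous_const (by fun_prop)

lemma isClosed_patternSpace (F : Set (Sym2 V)) : IsClosed (patternSpace F : Set (Matrix V V ℝ)) :=
  (patternSpace F).closed_of_finiteDimensional

lemma isCompact_posSemidef_trace_le (T : ℝ) :
    IsCompact {K : Matrix V V ℝ | K.PosSemidef ∧ K.trace ≤ T} := by
  have hcl : IsClosed {K : Matrix V V ℝ | K.PosSemidef ∧ K.trace ≤ T} :=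
    isClosed_posSemidef.inter (isClosed_le continuous_id.matrix_trace continuous_const)
  have hbox : IsCompact (Set.univ.pi fun _ : V => Set.univ.pi fun _ : V => Set.Icc (-T) T) :=
    isCompact_univ_pi fun _ => isCompact_univ_pi fun _ => isCompact_Icc
  refine hbox.of_isClosed_subset hcl fun K hK => ?_
  intro i _ j _
  exact abs_le.1 ((hK.1.abs_apply_le_trace i j).trans hK.2)

lemma trace_mul_transpose_mul {d : ℕ} (X : V → Fin d → ℝ) (K : Matrix V V ℝ) :
    (Matrix.of X * (Matrix.of X)ᵀ * K).trace
      = ∑ l, (fun i => X i l) ⬝ᵥ (K *ᵥ fun i => X i l) := by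
  rw [Matrix.mul_assoc, trace_mul_comm, Matrix.mul_assoc]
  refine Finset.sum_congr rfl fun l _ => ?_
  rfl

lemma mulVec_eq_zero_iff_stress {d : ℕ} {X : V → Fin d → ℝ} {K : Matrix V V ℝ} :
    (∀ i, ∑ j, K i j • X j = 0) ↔ ∀ l, K *ᵥ (fun i => X i l) = 0 := by
  constructor
  · intro h l
    funext i
    simpa [mulVec, dotProduct] using congrFun (h i) l
  · intro h i
    funext l
    simpa [mulVec, dotProduct] using congrFun (h l) i

/-- Without positive semidefinite stresses the trace term is coercive. -/
lemma exists_mul_trace_le {d : ℕ} {X : V → Fin d → ℝ} {F : Set (Sym2 V)}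
    (h : ∀ K ∈ stressSpace X F, K.PosSemidef → K = 0) :
    ∃ c > 0, ∀ K ∈ patternSpace F, K.PosSemidef →
      c * K.trace ≤ (Matrix.of X * (Matrix.of X)ᵀ * K).trace := by
  let B : Set (Matrix V V ℝ) := {K | K.PosSemidef ∧ K.trace ≤ 1} ∩
    ((patternSpace F : Set (Matrix V V ℝ)) ∩ {K | K.trace = 1})
  have hB : IsCompact B := (isCompact_posSemidef_trace_le 1).inter_right
    ((isClosed_patternSpace F).inter (isClosed_eq continuous_id.matrix_trace continuous_const))
  have hcont : Continuous fun K : Matrix V V ℝ => (Matrix.of X * (Matrix.of X)ᵀ * K).trace := by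
    fun_prop
  have hnn : ∀ K : Matrix V V ℝ, K.PosSemidef → ∀ l : Fin d,
      0 ≤ (fun i => X i l) ⬝ᵥ (K *ᵥ fun i => X i l) := fun K hK l => by
    simpa using hK.dotProduct_mulVec_nonneg fun i => X i l
  have hpos : ∀ K ∈ B, 0 < (Matrix.of X * (Matrix.of X)ᵀ * K).trace := by
    rintro K ⟨⟨hK, -⟩, hKF, hK1⟩
    rw [trace_mul_transpose_mul]
    refine lt_of_le_of_ne (Finset.sum_nonneg fun l _ => hnn K hK l) fun h0 => ?_
    have hz := (Finset.sum_eq_zero_iff_of_nonneg fun l _ => hnn K hK l).1 h0.symm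
    have hK0 : K = 0 := h K ⟨hKF, mulVec_eq_zero_iff_stress.2 fun l =>
      (hK.dotProduct_mulVec_zero_iff _).1 (by simpa using hz l (Finset.mem_univ l))⟩ hK
    rw [Set.mem_ofPred_eq, hK0] at hK1
    simp at hK1
  obtain ⟨c, hc, hcB⟩ : ∃ c > 0, ∀ K ∈ B, c ≤ (Matrix.of X * (Matrix.of X)ᵀ * K).trace := by
    by_cases hne : B.Nonempty
    · obtain ⟨K₀, hK₀, hmin⟩ := hB.exists_isMinOn hne hcont.continuousOn
      exact ⟨_, hpos K₀ hK₀, fun K hK => hmin hK⟩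
    · exact ⟨1, one_pos, fun K hK => (hne ⟨K, hK⟩).elim⟩
  refine ⟨c, hc, fun K hKF hK => ?_⟩
  rcases hK.trace_nonneg.eq_or_lt with h0 | h0
  · rw [← h0, mul_zero, trace_mul_transpose_mul]
    exact Finset.sum_nonneg fun l _ => hnn K hK l
  · have hm : K.trace⁻¹ • K ∈ B := by
      have ht : (K.trace⁻¹ • K).trace = 1 := by
        rw [trace_smul, smul_eq_mul, inv_mul_cancel₀ h0.ne']
      exact ⟨⟨hK.smul (inv_nonneg.2 h0.le), ht.le⟩, Submodule.smul_mem _ _ hKF, ht⟩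
    have := hcB _ hm
    rw [Matrix.mul_smul, trace_smul, smul_eq_mul, inv_mul_eq_div, le_div_iff₀ h0] at this
    exact this

end Likelihood

section Model

variable {n d : ℕ} {G : SimpleGraph (Fin n)}

lemma mem_graphModel_iff {K : Matrix (Fin n) (Fin n) ℝ} :
    K ∈ graphModel n G ↔ K.PosDef ∧ K ∈ patternSpace G.edgeSet := by
  refine and_congr_right fun hK => ⟨fun h => ⟨fun i j => ?_, h⟩, fun h => h.2⟩
  simpa using hK.1.apply i j

lemma one_mem_graphModel : (1 : Matrix (Fin n) (Fin n) ℝ) ∈ graphModel n G :=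
  ⟨PosDef.one, fun _ _ hij _ => one_apply_ne hij⟩

/-- The minimum is attained when there is no positive semidefinite stress. -/
lemma exists_forall_mlObjective_le {X : Fin n → Fin d → ℝ}
    (h : ∀ K ∈ stressSpace X G.edgeSet, K.PosSemidef → K = 0) :
    ∃ K ∈ graphModel n G, ∀ K' ∈ graphModel n G,
      mlObjective (Matrix.of X * (Matrix.of X)ᵀ) K ≤
        mlObjective (Matrix.of X * (Matrix.of X)ᵀ) K' := by
  obtain ⟨c, hc, hcK⟩ := exists_mul_trace_le h
  set S := Matrix.of X * (Matrix.of X)ᵀ with hS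
  set f₁ := mlObjective S 1 with hf₁
  have hlow : ∀ K ∈ graphModel n G, mlObjective S K ≤ f₁ →
      K.trace ≤ (f₁ - n * (1 + Real.log (c / 2))) / (c / 2) ∧ Real.exp (-f₁) ≤ K.det := by
    intro K hK hf
    obtain ⟨hpd, hpat⟩ := mem_graphModel_iff.1 hK
    have h1 := hcK K hpat hpd.posSemidef
    have h2 := hpd.log_det_le (half_pos hc)
    rw [Fintype.card_fin] at h2
    unfold mlObjective at hf
    constructor
    · rw [le_div_iff₀ (half_pos hc)]
      linarith
    · rw [← Real.exp_log hpd.det_pos]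
      refine Real.exp_le_exp.2 ?_
      have := mul_nonneg hc.le hpd.posSemidef.trace_nonneg
      linarith
  set T := (f₁ - n * (1 + Real.log (c / 2))) / (c / 2)
  let B : Set (Matrix (Fin n) (Fin n) ℝ) := {K | K.PosSemidef ∧ K.trace ≤ T} ∩
    ((patternSpace G.edgeSet : Set (Matrix (Fin n) (Fin n) ℝ)) ∩ {K | Real.exp (-f₁) ≤ K.det})
  have hB : IsCompact B := (isCompact_posSemidef_trace_le T).inter_right
    ((isClosed_patternSpace _).inter (isClosed_le continuous_const continuous_id.matrix_det))
  have hmem : ∀ K ∈ graphModel n G, mlObjective S K ≤ f₁ → K ∈ B := fun K hK hf =>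
    ⟨⟨(mem_graphModel_iff.1 hK).1.posSemidef, (hlow K hK hf).1⟩, (mem_graphModel_iff.1 hK).2,
      (hlow K hK hf).2⟩
  have hdet : ∀ K ∈ B, K.det ≠ 0 := fun K hK => ((Real.exp_pos _).trans_le hK.2.2).ne'
  have hcont : ContinuousOn (mlObjective S) B := by
    have h1 : Continuous fun K : Matrix (Fin n) (Fin n) ℝ => (S * K).trace := by fun_prop
    exact h1.continuousOn.sub (continuous_id.matrix_det.continuousOn.log hdet)
  obtain ⟨K₀, hK₀, hmin⟩ := hB.exists_isMinOn ⟨1, hmem 1 one_mem_graphModel le_rfl⟩ hcont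
  refine ⟨K₀, mem_graphModel_iff.2 ⟨(hK₀.1.1.posDef_iff_det_ne_zero).2 (hdet _ hK₀), hK₀.2.1⟩,
    fun K hK => ?_⟩
  by_cases hf : mlObjective S K ≤ f₁
  · exact hmin (hmem K hK hf)
  · exact (hmin (hmem 1 one_mem_graphModel le_rfl)).trans (not_le.1 hf).le

/-- The minimum is not attained when there is a positive semidefinite stress. -/
lemma not_exists_forall_mlObjective_le {X : Fin n → Fin d → ℝ} {K : Matrix (Fin n) (Fin n) ℝ}
    (hK : K ∈ stressSpace X G.edgeSet) (hpos : K.PosSemidef) (h0 : K ≠ 0) :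
    ¬ ∃ K₀ ∈ graphModel n G, ∀ K' ∈ graphModel n G,
      mlObjective (Matrix.of X * (Matrix.of X)ᵀ) K₀ ≤
        mlObjective (Matrix.of X * (Matrix.of X)ᵀ) K' := by
  rintro ⟨K₀, hK₀, hmin⟩
  obtain ⟨hpd, hpat⟩ := mem_graphModel_iff.1 hK₀
  have h1 := hmin (K₀ + K) (mem_graphModel_iff.2 ⟨hpd.add_posSemidef hpos, add_mem hpat hK.1⟩)
  have h2 : (Matrix.of X * (Matrix.of X)ᵀ * K).trace = 0 := by
    rw [trace_mul_transpose_mul]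
    refine Finset.sum_eq_zero fun l _ => ?_
    rw [mulVec_eq_zero_iff_stress.1 hK.2 l, dotProduct_zero]
  have h3 := hpd.det_lt_det_add hpos h0
  have h4 := Real.log_lt_log hpd.det_pos h3
  unfold mlObjective at h1
  rw [Matrix.mul_add, trace_add, h2] at h1
  linarith

end Model

/-! ### Rigidity vectors and stress matrices -/

section Rigidity

open Topology Filter

variable {n d : ℕ} {G : SimpleGraph (Fin n)}

/-- The homogeneous coordinates of a point configuration. -/
def homogenize (p : Fin n → Fin d → ℝ) : Fin n → Fin (d + 1) → ℝ := fun i => Fin.cons 1 (p i)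

lemma sum_smul_homogenize_eq_zero_iff {w : Fin n → ℝ} {p : Fin n → Fin d → ℝ} :
    ∑ j, w j • homogenize p j = 0 ↔ ∑ j, w j = 0 ∧ ∑ j, w j • p j = 0 := by
  rw [funext_iff, Fin.forall_fin_succ]
  refine and_congr (by simp [homogenize]) ?_
  rw [funext_iff]
  simp [homogenize]

lemma rigidityVec_apply {p : Fin n → Fin d → ℝ} {i j : Fin n} (hij : i ≠ j) (k : Fin n) :
    rigidityVec p i j k = (if i = k then p k - p j else 0) + if j = k then p k - p i else 0 := by
  unfold rigidityVec
  by_cases h1 : k = i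
  · subst h1
    simp [hij.symm]
  · by_cases h2 : k = j
    · subst h2
      simp [h1, hij]
    · simp [h1, h2, Ne.symm h1, Ne.symm h2]

open scoped Classical in
lemma sum_smul_rigidityVec (p : Fin n → Fin d → ℝ) {W : Matrix (Fin n) (Fin n) ℝ}
    (hW : W ∈ patternSpace G.edgeSet) (k : Fin n) :
    (∑ e : {e : Fin n × Fin n // G.Adj e.1 e.2 ∧ e.1 < e.2},
      W e.1.1 e.1.2 • rigidityVec p e.1.1 e.1.2) k = ∑ j, W k j • (p k - p j) := by
  have h1 : (∑ e : {e : Fin n × Fin n // G.Adj e.1 e.2 ∧ e.1 < e.2},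
      W e.1.1 e.1.2 • rigidityVec p e.1.1 e.1.2)
      = ∑ i, ∑ j, if i < j then W i j • rigidityVec p i j else 0 := by
    rw [← Finset.sum_subtype (Finset.univ.filter fun e : Fin n × Fin n => G.Adj e.1 e.2 ∧ e.1 < e.2)
      (by simp) (fun e => W e.1 e.2 • rigidityVec p e.1 e.2), Finset.sum_filter,
      Fintype.sum_prod_type]
    refine Finset.sum_congr rfl fun i _ => Finset.sum_congr rfl fun j _ => ?_
    by_cases hij : i < j
    · by_cases hG : G.Adj i j
      · simp [hij, hG]
      · simp [hG, hW.2 i j hij.ne hG]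
    · simp [hij]
  rw [h1]
  simp only [Finset.sum_apply]
  have h2 : ∀ i j, (if i < j then W i j • rigidityVec p i j else 0) k
      = (if i = k then (if k < j then W k j • (p k - p j) else 0) else 0)
        + if j = k then (if i < k then W k i • (p k - p i) else 0) else 0 := by
    intro i j
    by_cases hij : i < j
    · rw [if_pos hij, Pi.smul_apply, rigidityVec_apply hij.ne, smul_add]
      congr 1
      · by_cases hik : i = k
        · subst hik; simp [hij]
        · simp [hik]
      · by_cases hjk : j = k
        · subst hjk; simp [hij, hW.1 i j]
        · simp [hjk]
    · by_cases hik : i = k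
      · subst hik
        by_cases hjk : j = i <;> simp [hij, hjk]
      · by_cases hjk : j = k
        · subst hjk; simp [hij, hik]
        · simp [hij, hik, hjk]
  simp only [h2, Finset.sum_add_distrib]
  rw [Finset.sum_comm (f := fun i j => if i = k then _ else _)]
  simp only [Finset.sum_ite_eq', Finset.mem_univ, if_true]
  rw [← Finset.sum_add_distrib]
  refine Finset.sum_congr rfl fun j _ => ?_
  rcases lt_trichotomy k j with h | h | h
  · simp [h, h.not_gt]
  · simp [h]
  · simp [h, h.not_gt]

/-- The rigidity vectors are independent exactly when the homogenized configuration has no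
stress. -/
lemma linearIndependent_rigidityVec_iff {p : Fin n → Fin d → ℝ} :
    LinearIndependent ℝ (fun e : {e : Fin n × Fin n // G.Adj e.1 e.2 ∧ e.1 < e.2} =>
      rigidityVec p e.1.1 e.1.2) ↔ stressSpace (homogenize p) G.edgeSet = ⊥ := by
  classical
  rw [Fintype.linearIndependent_iff, Submodule.eq_bot_iff]
  constructor
  · intro h K hK
    have hrow := fun i => sum_smul_homogenize_eq_zero_iff.1 (hK.2 i)
    have h0 := h (fun e => K e.1.1 e.1.2) (by
      funext k
      rw [sum_smul_rigidityVec p hK.1 k]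
      simp only [smul_sub, Finset.sum_sub_distrib, ← Finset.sum_smul, (hrow k).1, (hrow k).2]
      simp)
    have hoff : ∀ i j, i ≠ j → K i j = 0 := by
      have hlt : ∀ i j, i < j → K i j = 0 := fun i j hij => by
        by_cases hG : G.Adj i j
        · exact h0 ⟨(i, j), hG, hij⟩
        · exact hK.1.2 i j hij.ne hG
      intro i j hij
      rcases lt_or_gt_of_ne hij with h | h
      · exact hlt i j h
      · rw [hK.1.1 j i]; exact hlt j i h
    ext i j
    by_cases hij : i = j
    · subst hij
      have := (hrow i).1
      rw [Finset.sum_eq_single i (fun j _ hj => hoff i j hj.symm) (by simp)] at this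
      exact this
    · exact hoff i j hij
  · intro h g hg
    let W : Matrix (Fin n) (Fin n) ℝ := Matrix.of fun i j =>
      if h : G.Adj i j ∧ i < j then g ⟨(i, j), h⟩ else
      if h : G.Adj j i ∧ j < i then g ⟨(j, i), h⟩ else 0
    have hW : W ∈ patternSpace G.edgeSet := by
      refine ⟨fun i j => ?_, fun i j hij hn => ?_⟩
      · simp only [W, of_apply]
        by_cases h1 : G.Adj i j ∧ i < j
        · have h2 : ¬ (G.Adj j i ∧ j < i) := fun h => h1.2.not_gt h.2
          rw [dif_pos h1, dif_neg h2, dif_pos h1]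
        · by_cases h2 : G.Adj j i ∧ j < i
          · simp only [dif_neg h1, dif_pos h2]
          · simp only [dif_neg h1, dif_neg h2]
      · have hn' : ¬ G.Adj i j := hn
        simp [W, hn', G.adj_comm j i]
    have hgW : ∀ e : {e : Fin n × Fin n // G.Adj e.1 e.2 ∧ e.1 < e.2}, W e.1.1 e.1.2 = g e :=
      fun e => dif_pos e.2
    let K : Matrix (Fin n) (Fin n) ℝ := W - diagonal fun i => ∑ j, W i j
    have hK : K ∈ stressSpace (homogenize p) G.edgeSet := by
      refine ⟨⟨fun i j => ?_, fun i j hij hn => ?_⟩, fun i => ?_⟩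
      · simp only [K, Matrix.sub_apply, hW.1 i j]
        by_cases hij : i = j
        · rw [hij]
        · rw [diagonal_apply_ne _ hij, diagonal_apply_ne _ (Ne.symm hij)]
      · simp only [K, Matrix.sub_apply, diagonal_apply_ne _ hij, hW.2 i j hij hn, sub_zero]
      · rw [sum_smul_homogenize_eq_zero_iff]
        have h1 := sum_smul_rigidityVec p hW i
        simp only [hgW, hg, Pi.zero_apply] at h1
        simp only [smul_sub, Finset.sum_sub_distrib, ← Finset.sum_smul] at h1
        constructor
        · simp [K, diagonal_apply]
        · simp only [K, Matrix.sub_apply, sub_smul, Finset.sum_sub_distrib, diagonal_apply,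
            ite_smul, zero_smul, Finset.sum_ite_eq, Finset.mem_univ, if_true]
          rw [← neg_sub, ← h1, neg_zero]
    have hK0 := h K hK
    intro e
    rw [← hgW e]
    have := congrFun (congrFun hK0 e.1.1) e.1.2
    simpa [K, diagonal_apply_ne _ e.2.2.ne] using this

lemma IsIndepGraph.genIndep (h : IsIndepGraph d G) : GenIndep (d + 1) G.edgeSet := by
  obtain ⟨p, hp⟩ := h.exists
  exact ⟨_, linearIndependent_rigidityVec_iff.1 hp⟩

/-- Combinations of rigidity vectors, bilinear in the configuration and the coefficients. -/
noncomputable def rigidityMap (d : ℕ) (G : SimpleGraph (Fin n)) :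
    (Fin n → Fin d → ℝ) →ₗ[ℝ] ({e : Fin n × Fin n // G.Adj e.1 e.2 ∧ e.1 < e.2} →₀ ℝ) →ₗ[ℝ]
      (Fin n → Fin d → ℝ) where
  toFun p := Finsupp.linearCombination ℝ fun e => rigidityVec p e.1.1 e.1.2
  map_add' p q := by
    ext e k l
    simp only [rigidityVec, LinearMap.comp_apply, LinearMap.add_apply, Finsupp.lsingle_apply,
      Finsupp.linearCombination_single, one_smul, Pi.add_apply]
    split_ifs <;> simp <;> ring
  map_smul' c p := by
    ext e k l
    simp only [rigidityVec, LinearMap.comp_apply, LinearMap.smul_apply, Finsupp.lsingle_apply,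
      Finsupp.linearCombination_single, one_smul, Pi.smul_apply, RingHom.id_apply]
    split_ifs <;> simp <;> ring

lemma isIndepGraph_of_exists {p : Fin n → Fin d → ℝ}
    (h : stressSpace (homogenize p) G.edgeSet = ⊥) : IsIndepGraph d G := by
  have h1 : Function.Injective (rigidityMap d G p) := linearIndependent_rigidityVec_iff.2 h
  exact (ae_injective volume (rigidityMap d G) h1).mono fun q hq => hq

lemma ae_apply_zero_ne_zero : ∀ᵐ q : Fin n → Fin (d + 1) → ℝ, ∀ i, q i 0 ≠ 0 := by
  rw [ae_all_iff]
  intro i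
  let A : (Fin n → Fin (d + 1) → ℝ) →ₗ[ℝ] ℝ →ₗ[ℝ] ℝ :=
    LinearMap.mk₂ ℝ (fun q t => t * q i 0) (fun _ _ _ => by simp [mul_add])
      (fun _ _ _ => by simp; ring) (fun _ _ _ => by simp [add_mul]) (fun _ _ _ => by simp; ring)
  have hA : Function.Injective (A fun _ _ => 1) := fun s t h => by simpa [A] using h
  filter_upwards [ae_injective volume A hA] with q hq h0
  have : A q 1 = A q 0 := by simp [A, h0]
  exact one_ne_zero (hq this)

lemma GenIndep.isIndepGraph (h : GenIndep (d + 1) G.edgeSet) : IsIndepGraph d G := by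
  obtain ⟨q, hq, hq0⟩ := (h.ae.and ae_apply_zero_ne_zero).exists
  refine isIndepGraph_of_exists (p := fun i l => (q i 0)⁻¹ * q i l.succ) ?_
  rw [Submodule.eq_bot_iff] at hq ⊢
  intro K hK
  have hh : ∀ i, homogenize (fun i l => (q i 0)⁻¹ * q i l.succ) i = (q i 0)⁻¹ • q i := by
    intro i
    funext l
    refine Fin.cases ?_ (fun l => ?_) l
    · simp [homogenize, hq0 i]
    · simp [homogenize]
  let D : Matrix (Fin n) (Fin n) ℝ := Matrix.of fun i j => (q i 0)⁻¹ * K i j * (q j 0)⁻¹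
  have hD : D ∈ stressSpace q G.edgeSet := by
    refine ⟨⟨fun i j => ?_, fun i j hij hn => ?_⟩, fun i => ?_⟩
    · simp only [D, of_apply, hK.1.1 i j]; ring
    · simp only [D, of_apply, hK.1.2 i j hij hn]; ring
    · have := congrArg ((q i 0)⁻¹ • ·) (hK.2 i)
      simp only [hh, smul_zero, Finset.smul_sum, smul_smul] at this
      simpa [D, mul_assoc] using this
  have h0 := hq D hD
  ext i j
  have := congrFun (congrFun h0 i) j
  simpa [D, hq0 i, hq0 j] using this

lemma hasOpenPSD_of_not_isIndepGraph {m : ℕ} (hm : m < 3) (h : ¬ IsIndepGraph m G) :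
    HasOpenPSD (m + 1) G.edgeSet := by
  have h1 : ¬ GenIndep (m + 1) G.edgeSet := fun h' => h h'.isIndepGraph
  interval_cases m
  · obtain ⟨e, he⟩ : G.edgeSet.Nonempty := by
      by_contra hne
      rw [Set.not_nonempty_iff_eq_empty] at hne
      refine h1 ⟨fun _ _ => 1, (Submodule.eq_bot_iff _).2 fun K hK => ?_⟩
      have hoff : ∀ i j, i ≠ j → K i j = 0 := fun i j hij => hK.1.2 i j hij (by simp [hne])
      ext i j
      by_cases hij : i = j
      · subst hij
        have := congrFun (hK.2 i) 0
        rw [Finset.sum_eq_single i (fun j _ hj => by rw [hoff i j hj.symm, zero_smul])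
          (by simp)] at this
        simpa using this
      · exact hoff i j hij
    induction e using Sym2.ind with
    | _ x y => exact (hasOpenPSD_one (SimpleGraph.Adj.ne he)).mono (by simpa using he)
  · exact hasOpenPSD_two_of_not_isAcyclic fun ha => h1 (genIndep_two_of_isAcyclic ha)
  · exact hasOpenPSD_of_not_genIndep (fun e he => G.not_isDiag_of_mem_edgeSet he) h1

end Rigidity

/-- If `G` is `3`-independent, then `MLT(G) = d + 1`, where `d` is the smallest nonnegative integer
such that `G` is `d`-independent. -/
theorem mlt_eq_min_indep_of_three_indep (n : ℕ) (G : SimpleGraph (Fin n))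
    (h : IsIndepGraph 3 G) :
    mlt n (graphModel n G) = sInf {d : ℕ | IsIndepGraph d G} + 1 := by
  have hmem : IsIndepGraph (sInf {d : ℕ | IsIndepGraph d G}) G :=
    Nat.sInf_mem (s := {d : ℕ | IsIndepGraph d G}) ⟨3, h⟩
  have hle : sInf {d : ℕ | IsIndepGraph d G} ≤ 3 := Nat.sInf_le h
  have hlt : ∀ m < sInf {d : ℕ | IsIndepGraph d G}, ¬ IsIndepGraph m G := fun m hm h' =>
    Nat.notMem_of_lt_sInf hm h'
  set m := sInf {d : ℕ | IsIndepGraph d G}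
  refine IsLeast.csInf_eq ⟨⟨m.succ_pos, ?_⟩, ?_⟩
  · filter_upwards [hmem.genIndep.ae] with X hX
    exact exists_forall_mlObjective_le fun K hK _ => by simpa [hX] using hK
  · rintro d ⟨hd, hae⟩
    by_contra hcon
    obtain ⟨k, rfl⟩ := Nat.exists_eq_add_of_le' hd
    obtain ⟨U, κ, hU, hne, -, hP⟩ := hasOpenPSD_of_not_isIndepGraph (m := k) (G := G) (by omega)
      (hlt k (by omega))
    obtain ⟨X, hXU, hX⟩ := (Measure.dense_of_ae hae).inter_open_nonempty U hU hne
    obtain ⟨h1, h2, h3⟩ := hP X hXU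
    exact not_exists_forall_mlObjective_le h1 h2 h3 hX
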